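/- arXiv:1910.10533 — 5 statements merged into one kernel-verified Lean document; each statement's English description precedes it below -/
import Mathlib

section
/- For every smooth quartic form F ∈ ℂ[x,y,z] there exist nonzero, pairwise non-proportional vectors v₁, …, v₇ ∈ ℂ⁴ and symmetric 4×4 complex matrices A₀, A₁, A₂ such that: the quadratic forms of A₀, A₁, A₂ form a basis of the space L of quadratic forms on ℂ⁴ vanishing at all of v₁, …, v₇, which has dimension 3; every nonzero member of L has rank at least 3; the set of common zeros of L in ℙ³ consists of exactly 8 distinct points; and det(x·A₀ + y·A₁ + z·A₂) = F(x,y,z). In other words, every smooth plane quartic arises as the Hessian quartic of the net of quadrics through an Aronhold heptad in ℙ³. -/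
open Matrix MvPolynomial

theorem exists_ne_zero_common_zero {n r : ℕ} (hr : r < n)
    (f : Fin r → MvPolynomial (Fin n) ℂ) (hf : ∀ i, eval 0 (f i) = 0) :
    ∃ x : Fin n → ℂ, x ≠ 0 ∧ ∀ i, eval x (f i) = 0 := by
  by_contra! hne
  have hdim : ringKrullDim (MvPolynomial (Fin n) ℂ) = n := by
    rw [MvPolynomial.ringKrullDim_of_isNoetherianRing]; simp
  have : FiniteRingKrullDim (MvPolynomial (Fin n) ℂ) := by
    rw [finiteRingKrullDim_iff_ne_bot_and_top, hdim]
    exact ⟨WithBot.coe_ne_bot, fun h => ENat.natCast_ne_top n (WithBot.coe_injective h)⟩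
  obtain ⟨m, hm, hmh⟩ := Ideal.exists_isMaximal_height (R := MvPolynomial (Fin n) ℂ)
  obtain ⟨a, ha⟩ := isMaximal_iff_eq_vanishingIdeal_singleton.1 hm
  set g : Fin r → MvPolynomial (Fin n) ℂ := fun i => bind₁ (fun j => X j - C (a j)) (f i) with hg
  have hge : ∀ x i, eval x (g i) = eval (x - a) (f i) := by
    intro x i
    simp only [hg, ← MvPolynomial.coe_aeval_eq_eval, RingHom.coe_coe, aeval_bind₁]
    congr 2
    ext j
    simp
  set I := Ideal.span (Set.range g) with hI
  have hz : zeroLocus ℂ I = {a} := by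
    ext x
    rw [hI, zeroLocus_span]
    simp only [Set.mem_ofPred_eq, Set.forall_mem_range, Set.mem_singleton_iff]
    constructor
    · intro h
      by_contra hx
      obtain ⟨i, hi⟩ := hne (x - a) (sub_ne_zero.2 hx)
      exact hi (by rw [← hge, ← h i, MvPolynomial.aeval_eq_eval])
    · rintro rfl i
      have := hge x i
      rw [sub_self, hf] at this
      rw [MvPolynomial.aeval_eq_eval]; exact this
  have hrad : I.radical = m := by
    rw [← vanishingIdeal_zeroLocus_eq_radical (K := ℂ), hz, ha]
  have hmin : m ∈ I.minimalPrimes := by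
    rw [← Ideal.radical_minimalPrimes, hrad, Ideal.minimalPrimes_eq_subsingleton_self]
    simp
  have h1 := Ideal.height_le_card_of_mem_minimalPrimes_span (Set.finite_range g) hmin
  have h2 : (Set.range g).ncard ≤ r := by
    rw [← Set.image_univ]
    exact (Set.ncard_image_le Set.finite_univ).trans (by simp)
  have h3 : ((n : ℕ∞) : WithBot ℕ∞) ≤ ((r : ℕ∞) : WithBot ℕ∞) := by
    rw [show ((n : ℕ∞) : WithBot ℕ∞) = (n : WithBot ℕ∞) from rfl, ← hdim, ← hmh]
    exact WithBot.coe_le_coe.2 (h1.trans (by exact_mod_cast h2))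
  have := WithBot.coe_le_coe.1 h3
  exact absurd (by exact_mod_cast this) (not_le.2 hr)

/-- The restriction of a quartic with an ordinary flex at `(0,0,1)` to some line not through the
flex is a square. -/
theorem exists_square_of_flex (k : Fin 10 → ℂ) :
    ∃ a b u v w s : ℂ, s ≠ 0 ∧ ∀ x y z : ℂ, z = a * x + b * y →
      z ^ 3 * x + y ^ 3 * z + s ^ 3 * k 0 * z ^ 2 * x ^ 2 + s * k 1 * z ^ 2 * x * y
        + s ^ 6 * k 2 * z * x ^ 3 + s ^ 4 * k 3 * z * x ^ 2 * y + s ^ 2 * k 4 * z * x * y ^ 2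
        + s ^ 9 * k 5 * x ^ 4 + s ^ 7 * k 6 * x ^ 3 * y + s ^ 5 * k 7 * x ^ 2 * y ^ 2
        + s ^ 3 * k 8 * x * y ^ 3 + s * k 9 * y ^ 4 = (u * x ^ 2 + v * x * y + w * y ^ 2) ^ 2 := by
  obtain ⟨x, hx0, hx⟩ := exists_ne_zero_common_zero (n := 6) (r := 5) (by norm_num)
    ![X 0 ^ 3 + C (k 0) * X 5 ^ 3 * X 0 ^ 2 + C (k 2) * X 5 ^ 6 * X 0 + C (k 5) * X 5 ^ 9 - X 2 ^ 2,
      3 * X 0 ^ 2 * X 1 + 2 * C (k 0) * X 5 ^ 3 * X 0 * X 1 + C (k 1) * X 5 * X 0 ^ 2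
        + C (k 2) * X 5 ^ 6 * X 1 + C (k 3) * X 5 ^ 4 * X 0 + C (k 6) * X 5 ^ 7 - 2 * X 2 * X 3,
      3 * X 0 * X 1 ^ 2 + C (k 0) * X 5 ^ 3 * X 1 ^ 2 + 2 * C (k 1) * X 5 * X 0 * X 1
        + C (k 3) * X 5 ^ 4 * X 1 + C (k 4) * X 5 ^ 2 * X 0 + C (k 7) * X 5 ^ 5
        - X 3 ^ 2 - 2 * X 2 * X 4,
      X 1 ^ 3 + X 0 + C (k 1) * X 5 * X 1 ^ 2 + C (k 4) * X 5 ^ 2 * X 1 + C (k 8) * X 5 ^ 3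
        - 2 * X 3 * X 4,
      X 1 + C (k 9) * X 5 - X 4 ^ 2]
    (by intro i; fin_cases i <;> simp)
  have h0 := hx 0
  have h1 := hx 1
  have h2 := hx 2
  have h3 := hx 3
  have h4 := hx 4
  simp at h0 h1 h2 h3 h4
  set a := x 0
  set b := x 1
  set u := x 2
  set v := x 3
  set w := x 4
  set s := x 5
  refine ⟨a, b, u, v, w, s, ?_, ?_⟩
  · intro hs
    rw [hs] at h0 h1 h2 h3 h4
    simp at h0 h1 h2 h3 h4
    have hb : b = w ^ 2 := by linear_combination h4
    have key : a = 0 ∧ w = 0 := by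
      by_cases ha : a = 0
      · have hu : u = 0 := by
          rw [ha] at h0
          simpa using h0
        have hv : v = 0 := by
          rw [ha, hu] at h2
          simpa using h2
        rw [hb, ha, hv] at h3
        refine ⟨ha, ?_⟩
        simpa using h3
      · exfalso
        have hu : u ≠ 0 := by
          rintro hu
          rw [hu] at h0
          exact ha (by simpa using h0)
        have e1 : 4 * a ^ 3 * v ^ 2 = 9 * a ^ 4 * b ^ 2 := by
          linear_combination (3 * a ^ 2 * b + 2 * u * v) * (-h1) + 4 * v ^ 2 * h0
        have e2 : 4 * v ^ 2 = 9 * a * b ^ 2 := by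
          have := pow_ne_zero 3 ha
          apply mul_left_cancel₀ this
          linear_combination e1
        have e3 : 8 * (u * w) = 3 * a * b ^ 2 := by
          linear_combination -4 * h2 - e2
        have e4 : 64 * a ^ 3 * b = 9 * a ^ 2 * b ^ 4 := by
          linear_combination (8 * u * w + 3 * a * b ^ 2) * e3 + 64 * a ^ 3 * hb + 64 * w ^ 2 * h0
        by_cases hb0 : b = 0
        · have hw : w = 0 := by
            rw [hb0] at hb
            simpa using hb.symm
          rw [hb0, hw] at h3
          exact ha (by simpa using h3)
        · have e5 : 64 * a = 9 * b ^ 3 := by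
            have : a ^ 2 * b ≠ 0 := mul_ne_zero (pow_ne_zero 2 ha) hb0
            apply mul_left_cancel₀ this
            linear_combination e4
          have e6 : (b ^ 3 + a) ^ 2 = 9 * a * b ^ 3 := by
            linear_combination (b ^ 3 + a + 2 * v * w) * h3 - 4 * v ^ 2 * hb + b * e2
          have e7 : b ^ 6 = 0 := by
            have ha' : a = 9 * b ^ 3 / 64 := by linear_combination e5 / 64
            rw [ha'] at e6
            linear_combination 4096 / 145 * e6
          exact hb0 (by simpa using e7)
    obtain ⟨ha, hw⟩ := key
    have hb' : b = 0 := by rw [hb, hw]; ring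
    have hu : u = 0 := by
      rw [ha] at h0
      simpa using h0
    have hv : v = 0 := by
      rw [ha, hu] at h2
      simpa using h2
    apply hx0
    ext i
    fin_cases i
    exacts [ha, hb', hu, hv, hw, hs]
  · rintro x y z rfl
    linear_combination x ^ 4 * h0 + x ^ 3 * y * h1 + x ^ 2 * y ^ 2 * h2 + x * y ^ 3 * h3
      + y ^ 4 * h4

/-- A cubic surface with a parabolic point at `(0,1,0,0)` of general type contains a line. -/
theorem exists_line_of_parabolic (k : Fin 12 → ℂ) :
    ∃ a b c d s : ℂ, s ≠ 0 ∧ ∀ x y z w : ℂ, y = a * x + b * w → z = c * x + d * w →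
      x * y ^ 2 + y * w ^ 2 + z ^ 3 + s ^ 12 * k 0 * x ^ 3 + s ^ 6 * k 1 * x ^ 2 * y
        + s ^ 8 * k 2 * x ^ 2 * z + s ^ 9 * k 3 * x ^ 2 * w + s ^ 2 * k 4 * x * y * z
        + s ^ 3 * k 5 * x * y * w + s ^ 4 * k 6 * x * z ^ 2 + s ^ 5 * k 7 * x * z * w
        + s ^ 6 * k 8 * x * w ^ 2 + s * k 9 * z ^ 2 * w + s ^ 2 * k 10 * z * w ^ 2
        + s ^ 3 * k 11 * w ^ 3 = 0 := by
  obtain ⟨x, hx0, hx⟩ := exists_ne_zero_common_zero (n := 5) (r := 4) (by norm_num)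
    ![X 0 ^ 2 + X 2 ^ 3 + C (k 0) * X 4 ^ 12 + C (k 1) * X 4 ^ 6 * X 0 + C (k 2) * X 4 ^ 8 * X 2
        + C (k 4) * X 4 ^ 2 * X 0 * X 2 + C (k 6) * X 4 ^ 4 * X 2 ^ 2,
      2 * X 0 * X 1 + 3 * X 2 ^ 2 * X 3 + C (k 1) * X 4 ^ 6 * X 1 + C (k 2) * X 4 ^ 8 * X 3
        + C (k 3) * X 4 ^ 9 + C (k 4) * X 4 ^ 2 * (X 0 * X 3 + X 1 * X 2) + C (k 5) * X 4 ^ 3 * X 0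
        + 2 * C (k 6) * X 4 ^ 4 * X 2 * X 3 + C (k 7) * X 4 ^ 5 * X 2 + C (k 9) * X 4 * X 2 ^ 2,
      X 1 ^ 2 + X 0 + 3 * X 2 * X 3 ^ 2 + C (k 4) * X 4 ^ 2 * X 1 * X 3 + C (k 5) * X 4 ^ 3 * X 1
        + C (k 6) * X 4 ^ 4 * X 3 ^ 2 + C (k 7) * X 4 ^ 5 * X 3 + C (k 8) * X 4 ^ 6
        + 2 * C (k 9) * X 4 * X 2 * X 3 + C (k 10) * X 4 ^ 2 * X 2,
      X 1 + X 3 ^ 3 + C (k 9) * X 4 * X 3 ^ 2 + C (k 10) * X 4 ^ 2 * X 3 + C (k 11) * X 4 ^ 3]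
    (by intro i; fin_cases i <;> simp)
  have h0 := hx 0
  have h1 := hx 1
  have h2 := hx 2
  have h3 := hx 3
  simp at h0 h1 h2 h3
  set a := x 0
  set b := x 1
  set c := x 2
  set d := x 3
  set s := x 4
  refine ⟨a, b, c, d, s, ?_, ?_⟩
  · intro hs
    rw [hs] at h0 h1 h2 h3
    simp at h0 h1 h2 h3
    have hb : b = -d ^ 3 := by linear_combination h3
    have ha : a = -3 * c * d ^ 2 - d ^ 6 := by rw [hb] at h2; linear_combination h2
    have hd : d = 0 := by
      by_contra hd
      have e1 : 3 * c ^ 2 + 6 * c * d ^ 4 + 2 * d ^ 8 = 0 := by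
        apply mul_left_cancel₀ hd
        rw [ha, hb] at h1
        linear_combination h1
      have e2 : c ^ 3 + d ^ 4 * (3 * c + d ^ 4) ^ 2 = 0 := by
        rw [ha] at h0
        linear_combination h0
      have e3 : d ^ 8 * (26 * c + 11 * d ^ 4) = 0 := by
        linear_combination (c + 7 * d ^ 4) * e1 - 3 * e2
      have e4 : 26 * c + 11 * d ^ 4 = 0 :=
        (mul_eq_zero.1 e3).resolve_left (pow_ne_zero 8 hd)
      have e5 : c = -11 / 26 * d ^ 4 := by linear_combination e4 / 26
      rw [e5] at e1
      exact hd (by simpa using (show d ^ 8 = 0 by linear_combination -676 * e1))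
    have hb' : b = 0 := by rw [hb, hd]; ring
    have ha' : a = 0 := by rw [ha, hd]; ring
    have hc : c = 0 := by
      rw [ha'] at h0
      simpa using h0
    apply hx0
    ext i
    fin_cases i
    exacts [ha', hb', hc, hd, hs]
  · rintro x y z w rfl rfl
    linear_combination x ^ 3 * h0 + x ^ 2 * w * h1 + x * w ^ 2 * h2 + w ^ 3 * h3

/-- `f` is the polynomial function of a form of degree `d` in `n` variables. -/
def IsForm (n d : ℕ) (f : (Fin n → ℂ) → ℂ) : Prop :=
  ∃ G : MvPolynomial (Fin n) ℂ, G.IsHomogeneous d ∧ ∀ p, f p = eval p G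

theorem IsForm.comp {n m d : ℕ} {f : (Fin n → ℂ) → ℂ} (hf : IsForm n d f)
    (g : (Fin m → ℂ) →ₗ[ℂ] (Fin n → ℂ)) : IsForm m d (fun p => f (g p)) := by
  obtain ⟨G, hG, hfG⟩ := hf
  refine ⟨aeval (fun i => ∑ j, C (g (Pi.single j 1) i) * X j) G, ?_, fun p => ?_⟩
  · have := hG.aeval (fun i => ∑ j, C (g (Pi.single j 1) i) * X j) (n := 1) fun i =>
      IsHomogeneous.sum _ _ _ fun j _ => by
        simpa using (isHomogeneous_C (Fin m) (g (Pi.single j 1) i)).mul (isHomogeneous_X ℂ j)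
    rwa [one_mul] at this
  · show f (g p) = _
    rw [hfG, ← MvPolynomial.coe_aeval_eq_eval p, RingHom.coe_coe, ← AlgHom.comp_apply,
      comp_aeval, ← MvPolynomial.aeval_eq_eval]
    congr 2
    ext i
    simp only [map_sum, map_mul, aeval_X, algHom_C, Algebra.algebraMap_self, RingHom.id_apply]
    rw [LinearMap.pi_apply_eq_sum_univ g p, Finset.sum_apply]
    refine Finset.sum_congr rfl fun j _ => ?_
    rw [Pi.smul_apply, smul_eq_mul, mul_comm]
    congr 1
    exact congrArg (fun v => g v i) (funext fun l => by simp [Pi.single_apply, eq_comm])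

theorem IsForm.exists_coeffs {n d m : ℕ} {f : (Fin n → ℂ) → ℂ} (hf : IsForm n d f)
    (μ : Fin m → Fin n → ℕ)
    (hμ : ∀ e : Fin n → Fin (d + 1), ∑ i, (e i : ℕ) = d → ∃ j, ∀ i, (e i : ℕ) = μ j i) :
    ∃ c : Fin m → ℂ, ∀ p, f p = ∑ j, c j * ∏ i, p i ^ μ j i := by
  obtain ⟨G, hG, hfG⟩ := hf
  suffices h : ∃ c : Fin m → ℂ, ∀ p, eval p G = ∑ j, c j * ∏ i, p i ^ μ j i by
    simpa only [hfG] using h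
  rw [G.as_sum]
  refine Finset.sum_induction _
    (fun G => ∃ c : Fin m → ℂ, ∀ p, eval p G = ∑ j, c j * ∏ i, p i ^ μ j i) ?_
    ⟨0, by simp⟩ fun e he => ?_
  · rintro A B ⟨a, ha⟩ ⟨b, hb⟩
    exact ⟨a + b, fun p => by simp [ha, hb, add_mul, Finset.sum_add_distrib]⟩
  · have hd : ∑ i, e i = d := by
      have := hG (mem_support_iff.1 he)
      rw [← this, Finsupp.weight_apply, Finsupp.sum_fintype] <;> simp
    obtain ⟨j, hj⟩ := hμ (fun i => ⟨e i, Nat.lt_succ_of_le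
      (hd ▸ Finset.single_le_sum (fun _ _ => Nat.zero_le _) (Finset.mem_univ i))⟩) hd
    refine ⟨Pi.single j (coeff e G), fun p => ?_⟩
    rw [eval_monomial, Finsupp.prod_fintype _ _ (by simp), Finset.sum_eq_single j]
    · simp [← hj]
    · simp +contextual
    · simp

theorem IsForm.ternary_quartic {f : (Fin 3 → ℂ) → ℂ} (hf : IsForm 3 4 f) :
    ∃ c : Fin 15 → ℂ, ∀ x y z, f ![x, y, z] =
      c 0 * z ^ 4 + c 1 * z ^ 3 * x + c 2 * z ^ 3 * y + c 3 * z ^ 2 * x ^ 2 + c 4 * z ^ 2 * x * y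
      + c 5 * z ^ 2 * y ^ 2 + c 6 * z * x ^ 3 + c 7 * z * x ^ 2 * y + c 8 * z * x * y ^ 2
      + c 9 * z * y ^ 3 + c 10 * x ^ 4 + c 11 * x ^ 3 * y + c 12 * x ^ 2 * y ^ 2 + c 13 * x * y ^ 3
      + c 14 * y ^ 4 := by
  obtain ⟨c, hc⟩ := hf.exists_coeffs (m := 15) ![![0, 0, 4], ![1, 0, 3], ![0, 1, 3], ![2, 0, 2],
    ![1, 1, 2], ![0, 2, 2], ![3, 0, 1], ![2, 1, 1], ![1, 2, 1], ![0, 3, 1], ![4, 0, 0],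
    ![3, 1, 0], ![2, 2, 0], ![1, 3, 0], ![0, 4, 0]] (by decide +kernel)
  refine ⟨c, fun x y z => ?_⟩
  rw [hc]
  simp [Fin.sum_univ_succ, Fin.prod_univ_succ]
  ring

theorem IsForm.quaternary_cubic {f : (Fin 4 → ℂ) → ℂ} (hf : IsForm 4 3 f) :
    ∃ c : Fin 20 → ℂ, ∀ x y z w, f ![x, y, z, w] =
      c 0 * x ^ 3 + c 1 * x ^ 2 * y + c 2 * x ^ 2 * z + c 3 * x ^ 2 * w + c 4 * x * y * z
      + c 5 * x * y * w + c 6 * x * z ^ 2 + c 7 * x * z * w + c 8 * x * w ^ 2 + c 9 * z ^ 2 * w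
      + c 10 * z * w ^ 2 + c 11 * w ^ 3 + c 12 * y ^ 3 + c 13 * y ^ 2 * z + c 14 * y ^ 2 * w
      + c 15 * y * z ^ 2 + c 16 * y * z * w + c 17 * x * y ^ 2 + c 18 * y * w ^ 2
      + c 19 * z ^ 3 := by
  obtain ⟨c, hc⟩ := hf.exists_coeffs (m := 20) ![![3, 0, 0, 0], ![2, 1, 0, 0], ![2, 0, 1, 0],
    ![2, 0, 0, 1], ![1, 1, 1, 0], ![1, 1, 0, 1], ![1, 0, 2, 0], ![1, 0, 1, 1], ![1, 0, 0, 2],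
    ![0, 0, 2, 1], ![0, 0, 1, 2], ![0, 0, 0, 3], ![0, 3, 0, 0], ![0, 2, 1, 0], ![0, 2, 0, 1],
    ![0, 1, 2, 0], ![0, 1, 1, 1], ![1, 2, 0, 0], ![0, 1, 0, 2], ![0, 0, 3, 0]] (by decide +kernel)
  refine ⟨c, fun x y z w => ?_⟩
  rw [hc]
  simp [Fin.sum_univ_succ, Fin.prod_univ_succ]
  ring

/-- `f` vanishes to order at least two at `p` along every line through `p`. -/
def SingularAt {n : ℕ} (f : (Fin n → ℂ) → ℂ) (p : Fin n → ℂ) : Prop :=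
  ∀ v, ∃ a b c : ℂ, ∀ t : ℂ, f (p + t • v) = t ^ 2 * a + t ^ 3 * b + t ^ 4 * c

/-- The projective hypersurface `f = 0` has no singular points. -/
def Smooth {n : ℕ} (f : (Fin n → ℂ) → ℂ) : Prop :=
  ∀ p, SingularAt f p → p = 0

theorem Smooth.comp {n : ℕ} {f : (Fin n → ℂ) → ℂ} (hf : Smooth f)
    {g : (Fin n → ℂ) →ₗ[ℂ] (Fin n → ℂ)} (hg : Function.Injective g) :
    Smooth (fun p => f (g p)) := by
  intro p hp
  have h : g p = 0 := hf _ fun v => by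
    obtain ⟨w, rfl⟩ := LinearMap.surjective_of_injective hg v
    simpa using hp w
  exact hg (h.trans (map_zero g).symm)

theorem IsForm.quartic_hessian {f : (Fin 3 → ℂ) → ℂ} (hf : IsForm 3 4 f) :
    ∃ H : Matrix (Fin 3) (Fin 3) (MvPolynomial (Fin 3) ℂ), H.IsSymm ∧ H.map (eval 0) = 0 ∧
      ∀ p v, ∃ e : ℂ, ∀ z y : ℂ, f (z • p + y • v) =
        z ^ 4 * (p ⬝ᵥ H.map (eval p) *ᵥ p) / 12 + z ^ 3 * y * (v ⬝ᵥ H.map (eval p) *ᵥ p) / 3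
          + z ^ 2 * y ^ 2 * (v ⬝ᵥ H.map (eval p) *ᵥ v) / 2 + z * y ^ 3 * e + y ^ 4 * f v := by
  obtain ⟨c, hc⟩ := hf.ternary_quartic
  let xx : MvPolynomial (Fin 3) ℂ := C (2 * c 3) * X 2 ^ 2 + C (6 * c 6) * X 2 * X 0
    + C (2 * c 7) * X 2 * X 1 + C (12 * c 10) * X 0 ^ 2 + C (6 * c 11) * X 0 * X 1
    + C (2 * c 12) * X 1 ^ 2
  let xy : MvPolynomial (Fin 3) ℂ := C (c 4) * X 2 ^ 2 + C (2 * c 7) * X 2 * X 0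
    + C (2 * c 8) * X 2 * X 1 + C (3 * c 11) * X 0 ^ 2 + C (4 * c 12) * X 0 * X 1
    + C (3 * c 13) * X 1 ^ 2
  let xz : MvPolynomial (Fin 3) ℂ := C (3 * c 1) * X 2 ^ 2 + C (4 * c 3) * X 2 * X 0
    + C (2 * c 4) * X 2 * X 1 + C (3 * c 6) * X 0 ^ 2 + C (2 * c 7) * X 0 * X 1
    + C (c 8) * X 1 ^ 2
  let yy : MvPolynomial (Fin 3) ℂ := C (2 * c 5) * X 2 ^ 2 + C (2 * c 8) * X 2 * X 0
    + C (6 * c 9) * X 2 * X 1 + C (2 * c 12) * X 0 ^ 2 + C (6 * c 13) * X 0 * X 1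
    + C (12 * c 14) * X 1 ^ 2
  let yz : MvPolynomial (Fin 3) ℂ := C (3 * c 2) * X 2 ^ 2 + C (2 * c 4) * X 2 * X 0
    + C (4 * c 5) * X 2 * X 1 + C (c 7) * X 0 ^ 2 + C (2 * c 8) * X 0 * X 1
    + C (3 * c 9) * X 1 ^ 2
  let zz : MvPolynomial (Fin 3) ℂ := C (12 * c 0) * X 2 ^ 2 + C (6 * c 1) * X 2 * X 0
    + C (6 * c 2) * X 2 * X 1 + C (2 * c 3) * X 0 ^ 2 + C (2 * c 4) * X 0 * X 1
    + C (2 * c 5) * X 1 ^ 2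
  let H : Matrix (Fin 3) (Fin 3) (MvPolynomial (Fin 3) ℂ) := !![xx, xy, xz; xy, yy, yz; xz, yz, zz]
  refine ⟨H, ?_, ?_, fun p v => ⟨(p ⬝ᵥ H.map (eval v) *ᵥ v) / 3, fun z y => ?_⟩⟩
  · ext i j; fin_cases i <;> fin_cases j <;> rfl
  · ext i j; fin_cases i <;> fin_cases j <;> simp [H, xx, xy, xz, yy, yz, zz]
  · have hp : z • p + y • v = ![z * p 0 + y * v 0, z * p 1 + y * v 1, z * p 2 + y * v 2] := by
      ext i; fin_cases i <;> rfl
    have hv : v = ![v 0, v 1, v 2] := by ext i; fin_cases i <;> rfl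
    have hfv : f v = _ := (congrArg f hv).trans (hc _ _ _)
    rw [hp, hc, hfv]
    simp only [H, xx, xy, xz, yy, yz, zz, dotProduct, mulVec, Fin.sum_univ_three, map_apply,
      of_apply, cons_val, map_add, map_mul, map_pow, eval_C, eval_X]
    ring

theorem injective_linearCombination_three {n : ℕ} {a b c : Fin n → ℂ}
    (h : ∀ x y z : ℂ, x • a + y • b + z • c = 0 → x = 0 ∧ y = 0 ∧ z = 0) :
    Function.Injective (Fintype.linearCombination ℂ ![a, b, c]) := by
  rw [injective_iff_map_eq_zero]
  intro p hp
  rw [Fintype.linearCombination_apply, Fin.sum_univ_three] at hp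
  obtain ⟨h0, h1, h2⟩ := h _ _ _ hp
  ext i; fin_cases i <;> assumption

theorem linearCombination_three {n : ℕ} (a b c : Fin n → ℂ) (x y z : ℂ) :
    Fintype.linearCombination ℂ ![a, b, c] ![x, y, z] = x • a + y • b + z • c := by
  simp [Fintype.linearCombination_apply, Fin.sum_univ_three]

/-- A smooth quartic in coordinates adapted to a flex and its tangent line. -/
theorem exists_flex_coordinates {f : (Fin 3 → ℂ) → ℂ} (hf : IsForm 3 4 f) (hs : Smooth f) :
    ∃ g : (Fin 3 → ℂ) →ₗ[ℂ] (Fin 3 → ℂ), Function.Injective g ∧ ∃ (e : ℂ) (c : Fin 10 → ℂ),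
      ∀ x y z, f (g ![x, y, z]) = z ^ 3 * x + e * y ^ 3 * z + c 0 * z ^ 2 * x ^ 2
        + c 1 * z ^ 2 * x * y + c 2 * z * x ^ 3 + c 3 * z * x ^ 2 * y + c 4 * z * x * y ^ 2
        + c 5 * x ^ 4 + c 6 * x ^ 3 * y + c 7 * x ^ 2 * y ^ 2 + c 8 * x * y ^ 3 + c 9 * y ^ 4 := by
  obtain ⟨H, hH, hH0, hfH⟩ := hf.quartic_hessian
  obtain ⟨G, hG, hfG⟩ := id hf
  obtain ⟨P, hP0, hP⟩ := exists_ne_zero_common_zero (n := 3) (r := 2) (by norm_num) ![G, H.det] (by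
    intro i
    fin_cases i
    · have := hfH 0 0
      obtain ⟨e, he⟩ := this
      have := he 0 0
      simpa [hfG] using this
    · show eval 0 H.det = 0
      rw [RingHom.map_det, RingHom.mapMatrix_apply, hH0, det_zero])
  have hPf : f P = 0 := (hfG P).trans (hP 0)
  have hPH : (H.map (eval P)).det = 0 := by
    rw [← RingHom.mapMatrix_apply, ← RingHom.map_det]; exact hP 1
  obtain ⟨k, hk0, hk⟩ := exists_mulVec_eq_zero_iff.2 hPH
  replace hfH := hfH P
  have hsymm : (H.map (eval P)).IsSymm := hH.map _
  set h := H.map (eval P)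
  have hcomm : ∀ v w, v ⬝ᵥ h *ᵥ w = w ⬝ᵥ h *ᵥ v := fun v w => by
    rw [dotProduct_mulVec, ← mulVec_transpose, hsymm.eq, dotProduct_comm]
  have hPP : P ⬝ᵥ h *ᵥ P = 0 := by
    obtain ⟨e, he⟩ := hfH 0
    have := he 1 0
    rw [one_smul, zero_smul, add_zero, hPf] at this
    linear_combination -12 * this
  have hsing : ¬ ∀ v, v ⬝ᵥ h *ᵥ P = 0 := fun hv => hP0 <| hs P fun v => by
    obtain ⟨e, he⟩ := hfH v
    refine ⟨v ⬝ᵥ h *ᵥ v / 2, e, f v, fun t => ?_⟩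
    have := he 1 t
    rw [one_smul, hPP, hv] at this
    rw [this]; ring
  obtain ⟨E', hE'⟩ := not_forall.1 hsing
  obtain ⟨E, hE⟩ : ∃ E, E ⬝ᵥ h *ᵥ P = 3 :=
    ⟨(3 / (E' ⬝ᵥ h *ᵥ P)) • E', by rw [smul_dotProduct, smul_eq_mul, div_mul_cancel₀ _ hE']⟩
  have hkP : k ⬝ᵥ h *ᵥ P = 0 := by rw [hcomm, hk, dotProduct_zero]
  have hinj : Function.Injective (Fintype.linearCombination ℂ ![E, k, P]) := by
    refine injective_linearCombination_three fun x y z hxyz => ?_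
    have hx : x = 0 := by
      have := congrArg (· ⬝ᵥ h *ᵥ P) hxyz
      simpa [hE, hkP, hPP] using this
    subst hx
    rw [zero_smul, zero_add] at hxyz
    have hy : z = 0 := by
      by_contra hz
      refine hsing fun v => ?_
      have := congrArg (fun w => v ⬝ᵥ h *ᵥ w) hxyz
      simpa [mulVec_add, mulVec_smul, hk, hz] using this
    subst hy
    simpa [hk0] using hxyz
  refine ⟨_, hinj, ?_⟩
  obtain ⟨c, hc⟩ := (hf.comp (Fintype.linearCombination ℂ ![E, k, P])).ternary_quartic
  obtain ⟨e, he⟩ := hfH k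
  obtain ⟨e', he'⟩ := hfH E
  simp only [linearCombination_three] at hc ⊢
  have h1 : ∀ y z, f (z • P + y • k) = z * y ^ 3 * e + y ^ 4 * f k := fun y z => by
    rw [he, hk, hkP, hPP]; simp
  have h2 : ∀ y z, z * y ^ 3 * e + y ^ 4 * f k = c 0 * z ^ 4 + c 2 * z ^ 3 * y
      + c 5 * z ^ 2 * y ^ 2 + c 9 * z * y ^ 3 + c 14 * y ^ 4 := fun y z => by
    rw [← h1, add_comm]
    simpa using hc 0 y z
  have h3 : ∀ x z, f (z • P + x • E) = c 0 * z ^ 4 + c 1 * z ^ 3 * x + c 3 * z ^ 2 * x ^ 2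
      + c 6 * z * x ^ 3 + c 10 * x ^ 4 := fun x z => by
    rw [add_comm]
    simpa using hc x 0 z
  simp only [he', hE, hPP] at h3
  have c0 : c 0 = 0 := by simpa using (h2 0 1).symm
  have c2 : c 2 = 0 := by
    linear_combination (h2 1 1 - h2 1 (-1)) / 6 - (h2 1 2 - h2 1 (-2)) / 12
  have c5 : c 5 = 0 := by
    linear_combination -(h2 1 1 + h2 1 (-1)) / 2 + h2 1 0 - c0
  have c1 : c 1 = 1 := by
    linear_combination (h3 1 1 - h3 1 (-1)) / 6 - (h3 1 2 - h3 1 (-2)) / 12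
  refine ⟨c 9, ![c 3, c 4, c 6, c 7, c 8, c 10, c 11, c 12, c 13, c 14], fun x y z => ?_⟩
  rw [hc, c0, c1, c2, c5]
  simp
  ring

theorem exists_pow_eq {n : ℕ} (hn : n ≠ 0) (a : ℂ) : ∃ b, b ^ n = a :=
  IsAlgClosed.exists_pow_nat_eq a (Nat.pos_of_ne_zero hn)

/-- A smooth quartic has a bitangent. -/
theorem exists_bitangent {f : (Fin 3 → ℂ) → ℂ} (hf : IsForm 3 4 f) (hs : Smooth f) :
    ∃ g : (Fin 3 → ℂ) →ₗ[ℂ] (Fin 3 → ℂ), Function.Injective g ∧ ∃ u v w : ℂ,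
      ∀ x y, f (g ![x, y, 0]) = (u * x ^ 2 + v * x * y + w * y ^ 2) ^ 2 := by
  obtain ⟨g, hg, e, c, hc⟩ := exists_flex_coordinates hf hs
  by_cases he : e = 0
  · obtain ⟨r, hr⟩ := exists_pow_eq two_ne_zero (c 9)
    refine ⟨g ∘ₗ Fintype.linearCombination ℂ ![![0, 1, 0], ![0, 0, 1], ![1, 0, 0]],
      hg.comp (injective_linearCombination_three fun x y z h => ?_), r, 0, 0, fun x y => ?_⟩
    · have h0 := congrFun h 0
      have h1 := congrFun h 1
      have h2 := congrFun h 2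
      simp_all
    · rw [LinearMap.comp_apply, linearCombination_three]
      have := hc 0 x y
      simp only [smul_cons, smul_eq_mul, smul_empty, cons_add_cons, empty_add_empty, mul_one,
        mul_zero, add_zero, zero_add]
      rw [this, he, ← hr]
      ring
  · obtain ⟨ρ, hρ⟩ := exists_pow_eq three_ne_zero e⁻¹
    have hρ' : e * ρ ^ 3 = 1 := by rw [hρ, mul_inv_cancel₀ he]
    have hρ0 : ρ ≠ 0 := by rintro rfl; simp at hρ'
    obtain ⟨a, b, u, v, w, s, hs0, h⟩ := exists_square_of_flex ![c 0, ρ * c 1, c 2, ρ * c 3,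
      ρ ^ 2 * c 4, c 5, ρ * c 6, ρ ^ 2 * c 7, ρ ^ 3 * c 8, ρ ^ 4 * c 9]
    obtain ⟨r, hr⟩ := exists_pow_eq two_ne_zero (s ^ 3)
    refine ⟨g ∘ₗ Fintype.linearCombination ℂ ![![s ^ 3, 0, a], ![0, ρ * s, b], ![0, 0, 1]],
      hg.comp (injective_linearCombination_three fun x y z h => ?_), r * u, r * v, r * w,
      fun x y => ?_⟩
    · have h0 := congrFun h 0
      have h1 := congrFun h 1
      have h2 := congrFun h 2
      simp_all
    · rw [LinearMap.comp_apply, linearCombination_three]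
      have h1 := hc (s ^ 3 * x) (ρ * s * y) (a * x + b * y)
      have h2 := h x y _ rfl
      simp only [smul_cons, smul_eq_mul, smul_empty, cons_add_cons, empty_add_empty, mul_one,
        mul_zero, add_zero, zero_add]
      rw [mul_comm x, mul_comm y, mul_comm x, mul_comm y, h1]
      simp only [cons_val] at h2
      linear_combination (u * x ^ 2 + v * x * y + w * y ^ 2) ^ 2 * (-hr) + s ^ 3 * h2
        + (s * y) ^ 3 * (a * x + b * y) * hρ'

theorem IsForm.map_smul {n d : ℕ} {f : (Fin n → ℂ) → ℂ} (hf : IsForm n d f) (t : ℂ)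
    (p : Fin n → ℂ) : f (t • p) = t ^ d * f p := by
  obtain ⟨G, hG, hfG⟩ := hf
  rw [hfG, hfG, eval_eq', eval_eq', Finset.mul_sum]
  refine Finset.sum_congr rfl fun e he => ?_
  have hd : ∑ i, e i = d := by
    have := hG (mem_support_iff.1 he)
    rw [← this, Finsupp.weight_apply, Finsupp.sum_fintype] <;> simp
  simp only [Pi.smul_apply, smul_eq_mul, mul_pow, Finset.prod_mul_distrib,
    Finset.prod_pow_eq_pow_sum, hd]
  ring

theorem IsForm.cubic_hessian {f : (Fin 4 → ℂ) → ℂ} (hf : IsForm 4 3 f) :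
    ∃ H : Matrix (Fin 4) (Fin 4) (MvPolynomial (Fin 4) ℂ), H.IsSymm ∧ H.map (eval 0) = 0 ∧
      ∀ p v, ∀ y : ℂ, f (y • p + v) = y ^ 3 * (p ⬝ᵥ H.map (eval p) *ᵥ p) / 6
        + y ^ 2 * (v ⬝ᵥ H.map (eval p) *ᵥ p) / 2 + y * (v ⬝ᵥ H.map (eval p) *ᵥ v) / 2 + f v := by
  obtain ⟨c, hc⟩ := hf.quaternary_cubic
  let xx : MvPolynomial (Fin 4) ℂ := C (6 * c 0) * X 0 + C (2 * c 1) * X 1 + C (2 * c 2) * X 2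
    + C (2 * c 3) * X 3
  let xy : MvPolynomial (Fin 4) ℂ := C (2 * c 1) * X 0 + C (c 4) * X 2 + C (c 5) * X 3
    + C (2 * c 17) * X 1
  let xz : MvPolynomial (Fin 4) ℂ := C (2 * c 2) * X 0 + C (c 4) * X 1 + C (2 * c 6) * X 2
    + C (c 7) * X 3
  let xw : MvPolynomial (Fin 4) ℂ := C (2 * c 3) * X 0 + C (c 5) * X 1 + C (c 7) * X 2
    + C (2 * c 8) * X 3
  let yy : MvPolynomial (Fin 4) ℂ := C (6 * c 12) * X 1 + C (2 * c 13) * X 2 + C (2 * c 14) * X 3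
    + C (2 * c 17) * X 0
  let yz : MvPolynomial (Fin 4) ℂ := C (c 4) * X 0 + C (2 * c 13) * X 1 + C (2 * c 15) * X 2
    + C (c 16) * X 3
  let yw : MvPolynomial (Fin 4) ℂ := C (c 5) * X 0 + C (2 * c 14) * X 1 + C (c 16) * X 2
    + C (2 * c 18) * X 3
  let zz : MvPolynomial (Fin 4) ℂ := C (2 * c 6) * X 0 + C (2 * c 9) * X 3 + C (2 * c 15) * X 1
    + C (6 * c 19) * X 2
  let zw : MvPolynomial (Fin 4) ℂ := C (c 7) * X 0 + C (2 * c 9) * X 2 + C (2 * c 10) * X 3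
    + C (c 16) * X 1
  let ww : MvPolynomial (Fin 4) ℂ := C (2 * c 8) * X 0 + C (2 * c 10) * X 2 + C (6 * c 11) * X 3
    + C (2 * c 18) * X 1
  let H : Matrix (Fin 4) (Fin 4) (MvPolynomial (Fin 4) ℂ) :=
    !![xx, xy, xz, xw; xy, yy, yz, yw; xz, yz, zz, zw; xw, yw, zw, ww]
  refine ⟨H, ?_, ?_, fun p v y => ?_⟩
  · ext i j; fin_cases i <;> fin_cases j <;> rfl
  · ext i j; fin_cases i <;> fin_cases j <;> simp [H, xx, xy, xz, yy, yz, zz, xw, yw, zw, ww]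
  · have hp : y • p + v = ![y * p 0 + v 0, y * p 1 + v 1, y * p 2 + v 2, y * p 3 + v 3] := by
      ext i; fin_cases i <;> rfl
    have hv : v = ![v 0, v 1, v 2, v 3] := by ext i; fin_cases i <;> rfl
    have hfv : f v = _ := (congrArg f hv).trans (hc _ _ _ _)
    rw [hp, hc, hfv]
    simp only [H, xx, xy, xz, yy, yz, zz, xw, yw, zw, ww, dotProduct, mulVec, Fin.sum_univ_four,
      map_apply, of_apply, cons_val, map_add, map_mul, eval_C, eval_X]
    ring

theorem linearCombination_four {n : ℕ} (a b c d : Fin n → ℂ) (x y z w : ℂ) :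
    Fintype.linearCombination ℂ ![a, b, c, d] ![x, y, z, w] = x • a + y • b + z • c + w • d := by
  simp [Fintype.linearCombination_apply, Fin.sum_univ_four]

theorem injective_linearCombination_four {n : ℕ} {a b c d : Fin n → ℂ}
    (h : ∀ x y z w : ℂ, x • a + y • b + z • c + w • d = 0 → x = 0 ∧ y = 0 ∧ z = 0 ∧ w = 0) :
    Function.Injective (Fintype.linearCombination ℂ ![a, b, c, d]) := by
  rw [injective_iff_map_eq_zero]
  intro p hp
  rw [Fintype.linearCombination_apply, Fin.sum_univ_four] at hp
  obtain ⟨h0, h1, h2, h3⟩ := h _ _ _ _ hp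
  ext i; fin_cases i <;> assumption

/-- A smooth cubic surface in coordinates adapted to a parabolic point. -/
theorem exists_parabolic_coordinates {f : (Fin 4 → ℂ) → ℂ} (hf : IsForm 4 3 f) (hs : Smooth f) :
    ∃ g : (Fin 4 → ℂ) →ₗ[ℂ] (Fin 4 → ℂ), Function.Injective g ∧ ∃ (h κ : ℂ) (c : Fin 12 → ℂ),
      ∀ x y z w, f (g ![x, y, z, w]) = x * y ^ 2 + h * y * w ^ 2 + κ * z ^ 3 + c 0 * x ^ 3
        + c 1 * x ^ 2 * y + c 2 * x ^ 2 * z + c 3 * x ^ 2 * w + c 4 * x * y * z + c 5 * x * y * w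
        + c 6 * x * z ^ 2 + c 7 * x * z * w + c 8 * x * w ^ 2 + c 9 * z ^ 2 * w + c 10 * z * w ^ 2
        + c 11 * w ^ 3 := by
  obtain ⟨H, hH, hH0, hfH⟩ := hf.cubic_hessian
  have hf0 : f 0 = 0 := by
    obtain ⟨c, hc⟩ := hf.quaternary_cubic
    have h0 : (0 : Fin 4 → ℂ) = ![0, 0, 0, 0] := by ext i; fin_cases i <;> rfl
    rw [h0, hc]; ring
  obtain ⟨G, hG, hfG⟩ := id hf
  obtain ⟨P, hP0, hP⟩ := exists_ne_zero_common_zero (n := 4) (r := 2) (by norm_num) ![G, H.det] (by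
    intro i
    fin_cases i
    · exact (hfG 0).symm.trans hf0
    · show eval 0 H.det = 0
      rw [RingHom.map_det, RingHom.mapMatrix_apply, hH0, det_zero])
  have hPf : f P = 0 := (hfG P).trans (hP 0)
  have hPH : (H.map (eval P)).det = 0 := by
    rw [← RingHom.mapMatrix_apply, ← RingHom.map_det]; exact hP 1
  obtain ⟨k, hk0, hk⟩ := exists_mulVec_eq_zero_iff.2 hPH
  replace hfH := hfH P
  have hsymm : (H.map (eval P)).IsSymm := hH.map _
  set h := H.map (eval P)
  have hcomm : ∀ v w, v ⬝ᵥ h *ᵥ w = w ⬝ᵥ h *ᵥ v := fun v w => by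
    rw [dotProduct_mulVec, ← mulVec_transpose, hsymm.eq, dotProduct_comm]
  have hPP : P ⬝ᵥ h *ᵥ P = 0 := by
    have := hfH 0 1
    rw [one_smul, add_zero, hPf, hf0, zero_dotProduct, zero_dotProduct] at this
    linear_combination -6 * this
  have hsing : ¬ ∀ v, v ⬝ᵥ h *ᵥ P = 0 := fun hv => hP0 <| hs P fun v => by
    refine ⟨v ⬝ᵥ h *ᵥ v / 2, f v, 0, fun t => ?_⟩
    have h1 := hfH (t • v) 1
    have h3 : f (t • v) = t ^ 3 * f v := by
      exact hf.map_smul t v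
    rw [one_smul, hPP, hv, h3, mulVec_smul, smul_dotProduct, dotProduct_smul] at h1
    rw [h1, smul_eq_mul, smul_eq_mul]; ring
  obtain ⟨E', hE'⟩ := not_forall.1 hsing
  obtain ⟨E, hE⟩ : ∃ E, E ⬝ᵥ h *ᵥ P = 2 :=
    ⟨(2 / (E' ⬝ᵥ h *ᵥ P)) • E', by rw [smul_dotProduct, smul_eq_mul, div_mul_cancel₀ _ hE']⟩
  have hkP : k ⬝ᵥ h *ᵥ P = 0 := by rw [hcomm, hk, dotProduct_zero]
  obtain ⟨W', hW'⟩ : ∃ W', ∀ x y z : ℂ, W' ≠ x • E + y • P + z • k := by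
    by_contra! hne
    have hsur : Function.Surjective (Fintype.linearCombination ℂ ![E, P, k]) := fun v => by
      obtain ⟨x, y, z, hv⟩ := hne v
      exact ⟨![x, y, z], by rw [linearCombination_three, hv]⟩
    have := LinearMap.finrank_le_finrank_of_surjective hsur
    simp at this
  obtain ⟨W, hWP, hW⟩ : ∃ W, W ⬝ᵥ h *ᵥ P = 0 ∧ ∀ x y z : ℂ, W ≠ x • E + y • P + z • k := by
    refine ⟨W' - (W' ⬝ᵥ h *ᵥ P / 2) • E, ?_, fun x y z hx => ?_⟩
    · rw [sub_dotProduct, smul_dotProduct, hE, smul_eq_mul]; ring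
    · refine hW' (x + W' ⬝ᵥ h *ᵥ P / 2) y z ?_
      rw [sub_eq_iff_eq_add] at hx
      exact hx.trans (by module)
  have hinj : Function.Injective (Fintype.linearCombination ℂ ![E, P, k, W]) := by
    refine injective_linearCombination_four fun x y z w hxyz => ?_
    have hw : w = 0 := by
      by_contra hw
      refine hW (-x / w) (-y / w) (-z / w) ?_
      have : w • W = -x • E + -y • P + -z • k := by
        rw [← sub_eq_zero, ← hxyz]; module
      rw [div_eq_inv_mul, div_eq_inv_mul, div_eq_inv_mul, mul_smul, mul_smul, mul_smul,
        ← smul_add, ← smul_add, ← this, inv_smul_smul₀ hw]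
    subst hw
    rw [zero_smul, add_zero] at hxyz
    have hx : x = 0 := by
      have := congrArg (· ⬝ᵥ h *ᵥ P) hxyz
      simpa [hE, hkP, hPP] using this
    subst hx
    rw [zero_smul, zero_add] at hxyz
    have hy : y = 0 := by
      by_contra hy
      refine hsing fun v => ?_
      have := congrArg (fun w => v ⬝ᵥ h *ᵥ w) hxyz
      simpa [mulVec_add, mulVec_smul, hk, hy] using this
    subst hy
    simpa [hk0] using hxyz
  refine ⟨_, hinj, ?_⟩
  obtain ⟨c, hc⟩ := (hf.comp (Fintype.linearCombination ℂ ![E, P, k, W])).quaternary_cubic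
  simp only [linearCombination_four] at hc ⊢
  have h1 : ∀ y z w : ℂ, f (y • P + (z • k + w • W)) =
      y * w ^ 2 * (W ⬝ᵥ h *ᵥ W) / 2 + f (z • k + w • W) := fun y z w => by
    rw [hfH, hPP, add_dotProduct, smul_dotProduct, smul_dotProduct, hkP, hWP]
    simp only [mulVec_add, mulVec_smul, hk, smul_zero, zero_add, smul_dotProduct, dotProduct_smul,
      add_dotProduct, smul_eq_mul, hcomm k W, dotProduct_zero]
    ring
  have h2 : ∀ y z w : ℂ, f (y • P + (z • k + w • W)) = c 9 * z ^ 2 * w + c 10 * z * w ^ 2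
      + c 11 * w ^ 3 + c 12 * y ^ 3 + c 13 * y ^ 2 * z + c 14 * y ^ 2 * w + c 15 * y * z ^ 2
      + c 16 * y * z * w + c 18 * y * w ^ 2 + c 19 * z ^ 3 := fun y z w => by
    have := hc 0 y z w
    rw [zero_smul, zero_add, add_assoc] at this
    rw [this]; ring
  have h3 : ∀ z w : ℂ, f (z • k + w • W) = c 9 * z ^ 2 * w + c 10 * z * w ^ 2
      + c 11 * w ^ 3 + c 19 * z ^ 3 := fun z w => by
    have := h2 0 z w
    rw [zero_smul, zero_add] at this
    rw [this]; ring
  simp only [h2, h3] at h1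
  have h4 : ∀ x y : ℂ, c 0 * x ^ 3 + c 1 * x ^ 2 * y + c 12 * y ^ 3 + c 17 * x * y ^ 2 =
      y ^ 2 * x + y * (x ^ 2 * (E ⬝ᵥ h *ᵥ E)) / 2 + f (x • E) := fun x y => by
    have h5 := hc x y 0 0
    have h6 := hfH (x • E) y
    rw [zero_smul, zero_smul, add_zero, add_zero, add_comm, h6] at h5
    simp only [hPP, smul_dotProduct, mulVec_smul, dotProduct_smul, smul_eq_mul, hE] at h5
    linear_combination -h5
  have c12 : c 12 = 0 := by linear_combination h1 1 0 0
  have c13 : c 13 = 0 := by linear_combination (h1 1 1 0 - h1 1 (-1) 0) / 2 - h1 0 1 0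
  have c15 : c 15 = 0 := by linear_combination (h1 1 1 0 + h1 1 (-1) 0) / 2 - c12
  have c14 : c 14 = 0 := by linear_combination (h1 1 0 1 + h1 (-1) 0 1) / 2 - h1 0 0 1
  have c16 : c 16 = 0 := by
    linear_combination h1 1 1 1 - h1 1 0 1 - c13 - c15
  have c17 : c 17 = 1 := by linear_combination (h4 1 1 + h4 1 (-1)) / 2 - h4 1 0
  refine ⟨c 18, c 19, ![c 0, c 1, c 2, c 3, c 4, c 5, c 6, c 7, c 8, c 9, c 10, c 11],
    fun x y z w => ?_⟩
  rw [hc, c12, c13, c14, c15, c16, c17]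
  simp
  ring

/-- A smooth cubic surface contains a line. -/
theorem exists_line {f : (Fin 4 → ℂ) → ℂ} (hf : IsForm 4 3 f) (hs : Smooth f) :
    ∃ U V : Fin 4 → ℂ, (∀ x y : ℂ, x • U + y • V = 0 → x = 0 ∧ y = 0) ∧
      ∀ x y : ℂ, f (x • U + y • V) = 0 := by
  obtain ⟨g, hg, h, κ, c, hc⟩ := exists_parabolic_coordinates hf hs
  suffices ∃ U V : Fin 4 → ℂ, (∀ x y : ℂ, x • U + y • V = 0 → x = 0 ∧ y = 0) ∧
      ∀ x y : ℂ, f (g (x • U + y • V)) = 0 by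
    obtain ⟨U, V, hUV, hf⟩ := this
    refine ⟨g U, g V, fun x y hxy => hUV x y ?_, fun x y => ?_⟩
    · exact hg (by rw [map_zero, ← hxy]; simp)
    · simpa using hf x y
  by_cases hh : h = 0
  · obtain ⟨q, hq0, hq⟩ := exists_ne_zero_common_zero (n := 2) (r := 1) (by norm_num)
      ![C κ * X 0 ^ 3 + C (c 9) * X 0 ^ 2 * X 1 + C (c 10) * X 0 * X 1 ^ 2 + C (c 11) * X 1 ^ 3]
      (by intro i; fin_cases i; simp)
    have hq := hq 0
    simp at hq
    refine ⟨![0, 1, 0, 0], ![0, 0, q 0, q 1], fun x y hxy => ?_, fun x y => ?_⟩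
    · have h1 := congrFun hxy 1
      have h2 := congrFun hxy 2
      have h3 := congrFun hxy 3
      simp at h1 h2 h3
      refine ⟨h1, ?_⟩
      by_contra hy
      refine hq0 ?_
      ext i; fin_cases i
      · simpa [hy] using h2
      · simpa [hy] using h3
    · have := hc 0 x (y * q 0) (y * q 1)
      simp
      rw [this, hh]
      linear_combination y ^ 3 * hq
  by_cases hκ : κ = 0
  · refine ⟨![0, 1, 0, 0], ![0, 0, 1, 0], fun x y hxy => ?_, fun x y => ?_⟩
    · have h1 := congrFun hxy 1
      have h2 := congrFun hxy 2
      simp_all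
    · have := hc 0 x y 0
      simp
      rw [this, hκ]
      ring
  obtain ⟨ρ, hρ⟩ := exists_pow_eq three_ne_zero κ⁻¹
  obtain ⟨σ, hσ⟩ := exists_pow_eq two_ne_zero h⁻¹
  have hρ' : κ * ρ ^ 3 = 1 := by rw [hρ, mul_inv_cancel₀ hκ]
  have hσ' : h * σ ^ 2 = 1 := by rw [hσ, mul_inv_cancel₀ hh]
  have hσ0 : σ ≠ 0 := by rintro rfl; simp at hσ'
  obtain ⟨a, b, a', b', s, hs0, hl⟩ := exists_line_of_parabolic ![c 0, c 1, ρ * c 2, σ * c 3,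
    ρ * c 4, σ * c 5, ρ ^ 2 * c 6, ρ * σ * c 7, σ ^ 2 * c 8, ρ ^ 2 * σ * c 9, ρ * σ ^ 2 * c 10,
    σ ^ 3 * c 11]
  refine ⟨![s ^ 6, a, s ^ 2 * ρ * a', 0], ![0, b, s ^ 2 * ρ * b', s ^ 3 * σ],
    fun x y hxy => ?_, fun x y => ?_⟩
  · have h1 := congrFun hxy 0
    have h2 := congrFun hxy 3
    simp_all
  · have h1 := hc (s ^ 6 * x) (a * x + b * y) (s ^ 2 * ρ * (a' * x + b' * y)) (s ^ 3 * σ * y)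
    have h2 := hl x _ _ y rfl rfl
    have h3 : x • ![s ^ 6, a, s ^ 2 * ρ * a', 0] + y • ![0, b, s ^ 2 * ρ * b', s ^ 3 * σ] =
        ![s ^ 6 * x, a * x + b * y, s ^ 2 * ρ * (a' * x + b' * y), s ^ 3 * σ * y] := by
      ext i; fin_cases i <;> simp <;> ring
    rw [h3, h1]
    simp only [cons_val] at h2
    linear_combination s ^ 6 * h2 + s ^ 6 * (a' * x + b' * y) ^ 3 * hρ'
      + (a * x + b * y) * (s ^ 3 * y) ^ 2 * hσ'

theorem isForm_of_coeffs {n d m : ℕ} (c : Fin m → ℂ) (μ : Fin m → Fin n → ℕ)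
    (hμ : ∀ j, ∑ i, μ j i = d) : IsForm n d (fun p => ∑ j, c j * ∏ i, p i ^ μ j i) := by
  refine ⟨∑ j, C (c j) * ∏ i, X i ^ μ j i, IsHomogeneous.sum _ _ _ fun j _ => ?_, fun p => ?_⟩
  · have := (isHomogeneous_C (Fin n) (c j)).mul (IsHomogeneous.prod Finset.univ
      (fun i => (X i : MvPolynomial (Fin n) ℂ) ^ μ j i) (fun i => μ j i) fun i _ => by
        simpa using (isHomogeneous_X ℂ i).pow (μ j i))
    rwa [zero_add, hμ] at this
  · simp

/-- A smooth quartic with the bitangent `z = 0` has another one. -/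
theorem exists_second_bitangent {f : (Fin 3 → ℂ) → ℂ} (hf : IsForm 3 4 f) (hs : Smooth f)
    {u v w : ℂ} (hz : ∀ x y, f ![x, y, 0] = (u * x ^ 2 + v * x * y + w * y ^ 2) ^ 2) :
    ∃ U V : Fin 3 → ℂ, (∀ x y : ℂ, x • U + y • V = 0 → x = 0 ∧ y = 0) ∧ (U 2 ≠ 0 ∨ V 2 ≠ 0) ∧
      ∃ u' v' w' : ℂ, ∀ x y, f (x • U + y • V) = (u' * x ^ 2 + v' * x * y + w' * y ^ 2) ^ 2 := by
  obtain ⟨c, hc⟩ := hf.ternary_quartic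
  obtain ⟨S, hS⟩ : ∃ S : ℂ → ℂ → ℂ, ∀ x y, S x y = u * x ^ 2 + v * x * y + w * y ^ 2 :=
    ⟨_, fun _ _ => rfl⟩
  obtain ⟨T, hT⟩ : ∃ T : ℂ → ℂ → ℂ → ℂ, ∀ x y z, T x y z = c 0 * z ^ 3 + c 1 * z ^ 2 * x
      + c 2 * z ^ 2 * y + c 3 * z * x ^ 2 + c 4 * z * x * y + c 5 * z * y ^ 2 + c 6 * x ^ 3
      + c 7 * x ^ 2 * y + c 8 * x * y ^ 2 + c 9 * y ^ 3 := ⟨_, fun _ _ _ => rfl⟩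
  have hfST : ∀ x y z, f ![x, y, z] = S x y ^ 2 + z * T x y z := fun x y z => by
    have := hz x y
    rw [hc] at this ⊢
    rw [hS, hT]
    linear_combination this
  have eta : ∀ p : Fin 3 → ℂ, p = ![p 0, p 1, p 2] := fun p => by ext i; fin_cases i <;> rfl
  have eta4 : ∀ p : Fin 4 → ℂ, p = ![p 0, p 1, p 2, p 3] := fun p => by
    ext i; fin_cases i <;> rfl
  have hadd : ∀ x y z a b d t : ℂ,
      ![x, y, z] + t • ![a, b, d] = ![x + t * a, y + t * b, z + t * d] := fun x y z a b d t => by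
    ext i; fin_cases i <;> rfl
  have hadd4 : ∀ x y z m a b d n t : ℂ, ![x, y, z, m] + t • ![a, b, d, n] =
      ![x + t * a, y + t * b, z + t * d, m + t * n] := fun x y z m a b d n t => by
    ext i; fin_cases i <;> rfl
  have hS2 : ∀ x y a b, ∃ s, ∀ t, S (x + t * a) (y + t * b) = S x y + t * s + t ^ 2 * S a b :=
    fun x y a b => ⟨2 * u * x * a + v * (x * b + y * a) + 2 * w * y * b, fun t => by
      simp only [hS]; ring⟩
  have hT2 : ∀ x y z a b d, ∃ s s', ∀ t, T (x + t * a) (y + t * b) (z + t * d) =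
      T x y z + t * s + t ^ 2 * s' + t ^ 3 * T a b d := fun x y z a b d =>
    ⟨(T (x + a) (y + b) (z + d) - T (x - a) (y - b) (z - d)) / 2 - T a b d,
      (T (x + a) (y + b) (z + d) + T (x - a) (y - b) (z - d)) / 2 - T x y z, fun t => by
      simp only [hT]; ring⟩
  have hsing : ∀ x y, S x y = 0 → T x y 0 = 0 → ![x, y, 0] = 0 := fun x y h1 h2 =>
    hs _ fun p => by
      obtain ⟨s, hs⟩ := hS2 x y (p 0) (p 1)
      obtain ⟨t1, t2, ht⟩ := hT2 x y 0 (p 0) (p 1) (p 2)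
      refine ⟨s ^ 2 + p 2 * t1, 2 * s * S (p 0) (p 1) + p 2 * t2,
        S (p 0) (p 1) ^ 2 + p 2 * T (p 0) (p 1) (p 2), fun t => ?_⟩
      conv_lhs => rw [eta p]
      rw [hadd, hfST, hs, ht, h1, h2]
      ring
  obtain ⟨K, hK⟩ : ∃ K : (Fin 4 → ℂ) → ℂ, ∀ x y z m, K ![x, y, z, m] =
      z * m ^ 2 + 2 * S x y * m - T x y z :=
    ⟨fun p => p 2 * p 3 ^ 2 + 2 * S (p 0) (p 1) * p 3 - T (p 0) (p 1) (p 2), fun _ _ _ _ => rfl⟩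
  have hKf : IsForm 4 3 K := by
    convert isForm_of_coeffs (n := 4) (d := 3) ![1, 2 * u, 2 * v, 2 * w, -c 0, -c 1, -c 2, -c 3,
      -c 4, -c 5, -c 6, -c 7, -c 8, -c 9] ![![0, 0, 1, 2], ![2, 0, 0, 1], ![1, 1, 0, 1],
      ![0, 2, 0, 1], ![0, 0, 3, 0], ![1, 0, 2, 0], ![0, 1, 2, 0], ![2, 0, 1, 0], ![1, 1, 1, 0],
      ![0, 2, 1, 0], ![3, 0, 0, 0], ![2, 1, 0, 0], ![1, 2, 0, 0], ![0, 3, 0, 0]] (by decide)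
      using 1
    ext p
    rw [eta4 p, hK, hS, hT]
    simp [Fin.sum_univ_succ, Fin.prod_univ_succ]
    ring
  have hKs : Smooth K := by
    intro p hp
    rw [eta4 p] at hp ⊢
    generalize p 0 = x at *
    generalize p 1 = y at *
    generalize p 2 = z at *
    generalize p 3 = m at *
    have hp3 : ∀ a b d n, ∃ α β : ℂ, ∀ t, K ![x + t * a, y + t * b, z + t * d, m + t * n] =
        t ^ 2 * α + t ^ 3 * β := fun a b d n => by
      obtain ⟨α, β, γ, h⟩ := hp ![a, b, d, n]
      simp only [hadd4] at h
      refine ⟨α, β, fun t => ?_⟩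
      have hγ : γ = 0 := by
        have h0 := h 0
        have h1 := h 1
        have h2 := h 2
        have h3 := h 3
        have h4 := h 4
        simp only [hK, hS, hT] at h0 h1 h2 h3 h4
        linear_combination -(h4 - 4 * h3 + 6 * h2 - 4 * h1 + h0) / 24
      rw [h, hγ, mul_zero, add_zero]
    have hL : z * m + S x y = 0 := by
      obtain ⟨α, β, h⟩ := hp3 0 0 0 1
      have h1 := h 1
      have h2 := h (-1)
      have h3 := h 2
      have h4 := h (-2)
      simp only [hK, mul_zero, add_zero] at h1 h2 h3 h4
      linear_combination (h1 - h2) / 3 - (h3 - h4) / 24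
    have hq : ![x, y, z] = 0 := hs _ fun r => by
      obtain ⟨α, β, h⟩ := hp3 (r 0) (r 1) (r 2) 0
      obtain ⟨s, hs⟩ := hS2 x y (r 0) (r 1)
      refine ⟨(r 2 * m + s) ^ 2 - z * α, 2 * (r 2 * m + s) * S (r 0) (r 1) - z * β - r 2 * α,
        S (r 0) (r 1) ^ 2 - r 2 * β, fun t => ?_⟩
      conv_lhs => rw [eta r]
      have := h t
      rw [hK, hs] at this
      rw [hadd, hfST, hs]
      linear_combination -(z + t * r 2) * this + (z * m + S x y + 2 * (t * (r 2 * m + s)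
        + t ^ 2 * S (r 0) (r 1))) * hL
    have hx : x = 0 := congrFun hq 0
    have hy : y = 0 := congrFun hq 1
    have hz : z = 0 := congrFun hq 2
    subst hx hy hz
    have hm : m = 0 := by
      obtain ⟨α, β, h⟩ := hp3 0 0 1 0
      have h1 := h 1
      have h2 := h (-1)
      have h3 := h 2
      have h4 := h (-2)
      simp only [hK, hS, hT] at h1 h2 h3 h4
      have : m ^ 2 = 0 := by linear_combination (h1 - h2) * 2 / 3 - (h3 - h4) / 12
      simpa using this
    subst hm
    ext i; fin_cases i <;> rfl
  obtain ⟨U, V, hUV, hl⟩ := exists_line hKf hKs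
  have hcomb : ∀ x y : ℂ, x • U + y • V =
      ![x * U 0 + y * V 0, x * U 1 + y * V 1, x * U 2 + y * V 2, x * U 3 + y * V 3] :=
    fun x y => by ext i; fin_cases i <;> rfl
  have hcomb3 : ∀ x y : ℂ, x • ![U 0, U 1, U 2] + y • ![V 0, V 1, V 2] =
      ![x * U 0 + y * V 0, x * U 1 + y * V 1, x * U 2 + y * V 2] :=
    fun x y => by ext i; fin_cases i <;> rfl
  have hl' : ∀ x y, (x * U 2 + y * V 2) * (x * U 3 + y * V 3) ^ 2
      + 2 * S (x * U 0 + y * V 0) (x * U 1 + y * V 1) * (x * U 3 + y * V 3)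
      = T (x * U 0 + y * V 0) (x * U 1 + y * V 1) (x * U 2 + y * V 2) := fun x y => by
    have := hl x y
    rw [hcomb, hK] at this
    linear_combination this
  have hind : ∀ x y : ℂ, x • ![U 0, U 1, U 2] + y • ![V 0, V 1, V 2] = 0 → x = 0 ∧ y = 0 := by
    intro x y hxy
    rw [hcomb3] at hxy
    have h0 : x * U 0 + y * V 0 = 0 := congrFun hxy 0
    have h1 : x * U 1 + y * V 1 = 0 := congrFun hxy 1
    have h2 : x * U 2 + y * V 2 = 0 := congrFun hxy 2
    refine hUV x y ?_
    by_contra hne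
    have hm : x * U 3 + y * V 3 ≠ 0 := fun hm => hne <| by
      rw [hcomb, h0, h1, h2, hm]; ext i; fin_cases i <;> rfl
    set m := x * U 3 + y * V 3 with hm'
    have key : ∀ a b, a * U 0 + b * V 0 = 0 ∧ a * U 1 + b * V 1 = 0 ∧ a * U 2 + b * V 2 = 0 := by
      intro a b
      have hl2 : ∀ t, (t * (a * U 2 + b * V 2)) * (m + t * (a * U 3 + b * V 3)) ^ 2
          + 2 * (t ^ 2 * S (a * U 0 + b * V 0) (a * U 1 + b * V 1)) * (m + t * (a * U 3 + b * V 3))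
          = t ^ 3 * T (a * U 0 + b * V 0) (a * U 1 + b * V 1) (a * U 2 + b * V 2) := fun t => by
        have := hl' (x + t * a) (y + t * b)
        rw [show (x + t * a) * U 0 + (y + t * b) * V 0 = t * (a * U 0 + b * V 0) by
            linear_combination h0,
          show (x + t * a) * U 1 + (y + t * b) * V 1 = t * (a * U 1 + b * V 1) by
            linear_combination h1,
          show (x + t * a) * U 2 + (y + t * b) * V 2 = t * (a * U 2 + b * V 2) by
            linear_combination h2,
          show (x + t * a) * U 3 + (y + t * b) * V 3 = m + t * (a * U 3 + b * V 3) by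
            rw [hm']; ring] at this
        simp only [hS, hT] at this ⊢
        linear_combination this
      have hz : a * U 2 + b * V 2 = 0 := by
        have : (a * U 2 + b * V 2) * m ^ 2 = 0 := by
          linear_combination hl2 1 - hl2 (-1) / 3 - hl2 2 / 6
        simpa [hm] using this
      have hs : S (a * U 0 + b * V 0) (a * U 1 + b * V 1) = 0 := by
        have : S (a * U 0 + b * V 0) (a * U 1 + b * V 1) * m = 0 := by
          linear_combination (hl2 1 + hl2 (-1)) / 4 - m * (a * U 3 + b * V 3) * hz
        simpa [hm] using this
      have ht : T (a * U 0 + b * V 0) (a * U 1 + b * V 1) (a * U 2 + b * V 2) = 0 := by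
        have := hl2 1
        rw [hz, hs] at this
        rw [hz]
        linear_combination -this
      have := hsing _ _ hs (by rw [hz] at ht; exact ht)
      exact ⟨congrFun this 0, congrFun this 1, hz⟩
    have hcol : V 3 • U + -U 3 • V = 0 := by
      obtain ⟨k0, k1, k2⟩ := key (V 3) (-U 3)
      rw [hcomb, k0, k1, k2]
      ext i; fin_cases i <;> simp
      ring
    obtain ⟨hV3, hU3⟩ := hUV _ _ hcol
    refine hm ?_
    rw [hm', hV3, neg_eq_zero.1 hU3]
    ring
  refine ⟨![U 0, U 1, U 2], ![V 0, V 1, V 2], hind, ?_, ?_⟩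
  · by_contra! hne
    have hU : U 2 = 0 := hne.1
    have hV : V 2 = 0 := hne.2
    obtain ⟨q, hq0, hq⟩ := exists_ne_zero_common_zero (n := 2) (r := 1) (by norm_num)
      ![C (S (U 0) (U 1)) * X 0 ^ 2 + C (S (V 0) (V 1)) * X 1 ^ 2 + C (2 * u * U 0 * V 0
        + v * (U 0 * V 1 + U 1 * V 0) + 2 * w * U 1 * V 1) * X 0 * X 1]
      (by intro i; fin_cases i; simp)
    have hq := hq 0
    simp at hq
    have hSq : S (q 0 * U 0 + q 1 * V 0) (q 0 * U 1 + q 1 * V 1) = 0 := by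
      rw [← hq]; simp only [hS]; ring
    have := hl' (q 0) (q 1)
    rw [hSq, hU, hV, mul_zero, mul_zero, add_zero, zero_mul, mul_zero, zero_mul, add_zero] at this
    have h0 := hsing _ _ hSq this.symm
    obtain ⟨h1, h2⟩ := hind (q 0) (q 1) (by rw [hcomb3, hU, hV, ← h0]; simp)
    exact hq0 (by ext i; fin_cases i <;> assumption)
  · refine ⟨S (U 0) (U 1) + U 2 * U 3, 2 * u * U 0 * V 0 + v * (U 0 * V 1 + U 1 * V 0)
      + 2 * w * U 1 * V 1 + U 2 * V 3 + V 2 * U 3, S (V 0) (V 1) + V 2 * V 3, fun x y => ?_⟩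
    have h1 : (S (U 0) (U 1) + U 2 * U 3) * x ^ 2 + (2 * u * U 0 * V 0
        + v * (U 0 * V 1 + U 1 * V 0) + 2 * w * U 1 * V 1 + U 2 * V 3 + V 2 * U 3) * x * y
        + (S (V 0) (V 1) + V 2 * V 3) * y ^ 2 = S (x * U 0 + y * V 0) (x * U 1 + y * V 1)
          + (x * U 2 + y * V 2) * (x * U 3 + y * V 3) := by
      simp only [hS]; ring
    rw [h1, hcomb3, hfST, ← hl']
    ring

theorem exists_coeffs_of_bitangents {f : (Fin 3 → ℂ) → ℂ} (hf : IsForm 3 4 f)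
    (h1 : ∃ d e c : ℂ, ∀ x z : ℂ, f ![x, 0, z] = (d * x ^ 2 + e * x * z + c * z ^ 2) ^ 2)
    (h2 : ∃ a b c : ℂ, ∀ y z : ℂ, f ![0, y, z] = (a * y ^ 2 + b * y * z + c * z ^ 2) ^ 2) :
    ∃ (a b c d e : ℂ) (r : Fin 6 → ℂ), ∀ x y z, f ![x, y, z] =
      (a * y ^ 2 + b * y * z + c * z ^ 2 + d * x ^ 2 + e * x * z) ^ 2
        - 4 * x * y * (r 0 * x ^ 2 + r 1 * y ^ 2 + r 2 * z ^ 2 + r 3 * x * y + r 4 * x * z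
          + r 5 * y * z) := by
  obtain ⟨d, e, c', h1⟩ := h1
  obtain ⟨a, b, c, h2⟩ := h2
  obtain ⟨d, e, h1⟩ : ∃ d e : ℂ, ∀ x z : ℂ, f ![x, 0, z] =
      (d * x ^ 2 + e * x * z + c * z ^ 2) ^ 2 := by
    have hc : c ^ 2 = c' ^ 2 := by
      have h3 := h1 0 1
      have h4 := h2 0 1
      linear_combination h3 - h4
    rcases sq_eq_sq_iff_eq_or_eq_neg.1 hc with rfl | rfl
    · exact ⟨d, e, h1⟩
    · exact ⟨-d, -e, fun x z => by rw [h1]; ring⟩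
  obtain ⟨k, hk⟩ := hf.ternary_quartic
  refine ⟨a, b, c, d, e, ![-k 11 / 4, -k 13 / 4, -(k 4 - 2 * b * e) / 4, -(k 12 - 2 * a * d) / 4,
    -(k 7 - 2 * b * d) / 4, -(k 8 - 2 * a * e) / 4], fun x y z => ?_⟩
  have k1 := hk x 0 z
  have k2 := hk 0 y z
  have k3 := hk 0 0 z
  have h3 := h1 0 z
  rw [h1] at k1
  rw [h2] at k2
  rw [h1] at k3
  rw [hk]
  simp only [cons_val]
  linear_combination k3 - k1 - k2

theorem exists_independent_of_last_eq_zero {O : Fin 3 → ℂ} (hO0 : O ≠ 0) (hO2 : O 2 = 0) :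
    ∃ A : Fin 3 → ℂ, A 2 = 0 ∧ ∀ x z : ℂ, x • A + z • O = 0 → x = 0 ∧ z = 0 := by
  by_cases h : O 1 = 0
  · have h0 : O 0 ≠ 0 := fun h0 => hO0 (by ext i; fin_cases i <;> assumption)
    refine ⟨![0, 1, 0], rfl, fun x z hxz => ?_⟩
    have h1 := congrFun hxz 0
    have h2 := congrFun hxz 1
    simp_all
  · refine ⟨![1, 0, 0], rfl, fun x z hxz => ?_⟩
    have h1 := congrFun hxz 0
    have h2 := congrFun hxz 1
    simp_all

/-- A smooth quartic in coordinates where two of the coordinate lines are bitangents. -/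
theorem exists_bitangent_coordinates {f : (Fin 3 → ℂ) → ℂ} (hf : IsForm 3 4 f) (hs : Smooth f) :
    ∃ g : (Fin 3 → ℂ) →ₗ[ℂ] (Fin 3 → ℂ), Function.Injective g ∧ ∃ (a b c d e : ℂ) (r : Fin 6 → ℂ),
      ∀ x y z, f (g ![x, y, z]) = (a * y ^ 2 + b * y * z + c * z ^ 2 + d * x ^ 2 + e * x * z) ^ 2
        - 4 * x * y * (r 0 * x ^ 2 + r 1 * y ^ 2 + r 2 * z ^ 2 + r 3 * x * y + r 4 * x * z
          + r 5 * y * z) := by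
  obtain ⟨g, hg, u, v, w, hz⟩ := exists_bitangent hf hs
  suffices ∃ A B O : Fin 3 → ℂ, (∀ x y z : ℂ, x • A + y • B + z • O = 0 → x = 0 ∧ y = 0 ∧ z = 0) ∧
      (∃ d e c : ℂ, ∀ x z : ℂ, f (g (x • A + z • O)) = (d * x ^ 2 + e * x * z + c * z ^ 2) ^ 2) ∧
      ∃ a b c : ℂ, ∀ y z : ℂ, f (g (y • B + z • O)) = (a * y ^ 2 + b * y * z + c * z ^ 2) ^ 2 by
    obtain ⟨A, B, O, hABO, h1, h2⟩ := this
    refine ⟨g ∘ₗ Fintype.linearCombination ℂ ![A, B, O],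
      hg.comp (injective_linearCombination_three hABO), exists_coeffs_of_bitangents (hf.comp _)
        ?_ ?_⟩ <;> simpa only [LinearMap.comp_apply, linearCombination_three, zero_smul, zero_add,
          add_zero]
  obtain ⟨U, V, hUV, hne, u', v', w', hl⟩ := exists_second_bitangent (hf.comp g) (hs.comp hg) hz
  obtain ⟨O, hO⟩ : ∃ O, O = V 2 • U - U 2 • V := ⟨_, rfl⟩
  have hOz : O 2 = 0 := by
    rw [hO]; simp; ring
  have hO0 : O ≠ 0 := fun h => by
    obtain ⟨h1, h2⟩ := hUV (V 2) (-U 2) (by rw [← h, hO]; module)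
    rcases hne with h | h
    · exact h (neg_eq_zero.1 h2)
    · exact h h1
  obtain ⟨B, hB2, hB⟩ : ∃ B : Fin 3 → ℂ, B 2 ≠ 0 ∧
      ∃ a b c : ℂ, ∀ y z : ℂ, f (g (y • B + z • O)) = (a * y ^ 2 + b * y * z + c * z ^ 2) ^ 2 := by
    rcases hne with h | h
    · refine ⟨U, h, u', 2 * u' * V 2 - v' * U 2, u' * V 2 ^ 2 - v' * V 2 * U 2 + w' * U 2 ^ 2,
        fun y z => ?_⟩
      have := hl (y + z * V 2) (-z * U 2)
      rw [hO, show y • U + z • (V 2 • U - U 2 • V) = (y + z * V 2) • U + (-z * U 2) • V by module,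
        this]
      ring
    · refine ⟨V, h, w', -2 * w' * U 2 + v' * V 2, u' * V 2 ^ 2 - v' * V 2 * U 2 + w' * U 2 ^ 2,
        fun y z => ?_⟩
      have := hl (z * V 2) (y - z * U 2)
      rw [hO, show y • V + z • (V 2 • U - U 2 • V) = (z * V 2) • U + (y - z * U 2) • V by module,
        this]
      ring
  obtain ⟨A, hA2, hA⟩ := exists_independent_of_last_eq_zero hO0 hOz
  refine ⟨A, B, O, fun x y z hxyz => ?_, ?_, hB⟩
  · have hy : y = 0 := by
      have := congrFun hxyz 2
      simpa [hA2, hOz, hB2] using this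
    subst hy
    rw [zero_smul, add_zero] at hxyz
    exact ⟨(hA x z hxyz).1, rfl, (hA x z hxyz).2⟩
  · refine ⟨u * A 0 ^ 2 + v * A 0 * A 1 + w * A 1 ^ 2, 2 * u * A 0 * O 0
      + v * (A 0 * O 1 + A 1 * O 0) + 2 * w * A 1 * O 1,
      u * O 0 ^ 2 + v * O 0 * O 1 + w * O 1 ^ 2, fun x z => ?_⟩
    have := hz (x * A 0 + z * O 0) (x * A 1 + z * O 1)
    rw [show x • A + z • O = ![x * A 0 + z * O 0, x * A 1 + z * O 1, 0] by
      ext i; fin_cases i <;> simp [hA2, hOz], this]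
    ring

/-- The ternary quadratic form with coefficients `q`. -/
def ternaryQuadratic (q : Fin 6 → ℂ) (p : Fin 3 → ℂ) : ℂ :=
  q 0 * p 0 ^ 2 + q 1 * p 1 ^ 2 + q 2 * p 2 ^ 2 + q 3 * p 0 * p 1 + q 4 * p 0 * p 2
    + q 5 * p 1 * p 2

/-- Half of the determinant of the Hessian matrix of a ternary quadratic form. -/
def ternaryDisc (q : Fin 6 → ℂ) : ℂ :=
  4 * q 0 * q 1 * q 2 + q 3 * q 4 * q 5 - q 0 * q 5 ^ 2 - q 1 * q 4 ^ 2 - q 2 * q 3 ^ 2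

theorem exists_factor_binary (a b c : ℂ) : ∃ α β γ δ : ℂ, ∀ x y : ℂ,
    a * x ^ 2 + b * x * y + c * y ^ 2 = (α * x + β * y) * (γ * x + δ * y) := by
  by_cases ha : a = 0
  · exact ⟨0, 1, b, c, fun x y => by rw [ha]; ring⟩
  · obtain ⟨s, hs⟩ := exists_pow_eq two_ne_zero (b ^ 2 - 4 * a * c)
    refine ⟨a, (b - s) / 2, 1, (b + s) / (2 * a), fun x y => ?_⟩
    field_simp
    linear_combination y ^ 2 * hs

theorem exists_factor_of_radical {a b c d e f k l : ℂ} (h0 : e = -2 * a * k - d * l)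
    (h1 : f = -d * k - 2 * b * l) (h2 : 2 * c = -e * k - f * l) :
    ∃ u v : Fin 3 → ℂ, ∀ x y z : ℂ, a * x ^ 2 + b * y ^ 2 + c * z ^ 2 + d * x * y + e * x * z
      + f * y * z = (u 0 * x + u 1 * y + u 2 * z) * (v 0 * x + v 1 * y + v 2 * z) := by
  obtain ⟨α, β, γ, δ, h⟩ := exists_factor_binary a d b
  refine ⟨![α, β, -α * k - β * l], ![γ, δ, -γ * k - δ * l], fun x y z => ?_⟩
  simp only [cons_val]
  linear_combination h (x - k * z) (y - l * z) + z * x * h0 + z * y * h1 + z ^ 2 / 2 * h2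
    - z ^ 2 * k / 2 * h0 - z ^ 2 * l / 2 * h1

theorem exists_factor_of_ternaryDisc_eq_zero {q : Fin 6 → ℂ} (hq : ternaryDisc q = 0) :
    ∃ u v : Fin 3 → ℂ, ∀ p, ternaryQuadratic q p = (u ⬝ᵥ p) * (v ⬝ᵥ p) := by
  have hdet : (!![2 * q 0, q 3, q 4; q 3, 2 * q 1, q 5; q 4, q 5, 2 * q 2]).det = 0 := by
    rw [det_fin_three]
    simp only [of_apply, cons_val]
    rw [ternaryDisc] at hq
    linear_combination 2 * hq
  obtain ⟨k, hk0, hk⟩ := exists_mulVec_eq_zero_iff.2 hdet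
  have e0 := congrFun hk 0
  have e1 := congrFun hk 1
  have e2 := congrFun hk 2
  simp only [mulVec, dotProduct, Fin.sum_univ_three, of_apply, cons_val, Pi.zero_apply]
    at e0 e1 e2
  obtain ⟨i, hi⟩ := Function.ne_iff.1 hk0
  simp only [ternaryQuadratic, dotProduct, Fin.sum_univ_three]
  fin_cases i
  · simp only [Fin.zero_eta, Pi.zero_apply] at hi
    obtain ⟨u, v, h⟩ := exists_factor_of_radical (a := q 1) (b := q 2) (c := q 0) (d := q 5)
      (e := q 3) (f := q 4) (k := k 1 / k 0) (l := k 2 / k 0)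
      (by field_simp; linear_combination e1) (by field_simp; linear_combination e2)
      (by field_simp; linear_combination e0)
    exact ⟨![u 2, u 0, u 1], ![v 2, v 0, v 1], fun p => by
      simp only [cons_val]; linear_combination h (p 1) (p 2) (p 0)⟩
  · simp only [Fin.mk_one, Pi.zero_apply] at hi
    obtain ⟨u, v, h⟩ := exists_factor_of_radical (a := q 0) (b := q 2) (c := q 1) (d := q 4)
      (e := q 3) (f := q 5) (k := k 0 / k 1) (l := k 2 / k 1)
      (by field_simp; linear_combination e0) (by field_simp; linear_combination e2)
      (by field_simp; linear_combination e1)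
    exact ⟨![u 0, u 2, u 1], ![v 0, v 2, v 1], fun p => by
      simp only [cons_val]; linear_combination h (p 0) (p 2) (p 1)⟩
  · simp only [Fin.reduceFinMk, Pi.zero_apply] at hi
    obtain ⟨u, v, h⟩ := exists_factor_of_radical (a := q 0) (b := q 1) (c := q 2) (d := q 3)
      (e := q 4) (f := q 5) (k := k 0 / k 2) (l := k 1 / k 2)
      (by field_simp; linear_combination e0) (by field_simp; linear_combination e1)
      (by field_simp; linear_combination e2)
    exact ⟨u, v, fun p => h (p 0) (p 1) (p 2)⟩

/-- A member of the family `λ²xy + λs + r` is singular. -/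
theorem exists_ternaryDisc_eq_zero (s r : Fin 6 → ℂ) (hs : s 2 ≠ 0) :
    ∃ t : ℂ, ternaryDisc (t • s + r + Pi.single 3 (t ^ 2)) = 0 := by
  let q : Fin 6 → MvPolynomial (Fin 2) ℂ := fun i => C (s i) * X 0 + C (r i) * X 1
  let q3 : MvPolynomial (Fin 2) ℂ := X 0 ^ 2 + C (s 3) * X 0 * X 1 + C (r 3) * X 1 ^ 2
  obtain ⟨x, hx0, hx⟩ := exists_ne_zero_common_zero (n := 2) (r := 1) (by norm_num)
    ![(4 * q 0 * q 1 * q 2 - q 0 * q 5 ^ 2 - q 1 * q 4 ^ 2) * X 1 ^ 2 + q3 * q 4 * q 5 * X 1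
      - q 2 * q3 ^ 2] (by intro i; fin_cases i; simp [q, q3])
  have h := hx 0
  simp [q, q3] at h
  have h1 : x 1 ≠ 0 := fun h1 => hx0 <| by
    have h0 : x 0 = 0 := by simpa [h1, hs] using h
    ext i; fin_cases i <;> assumption
  refine ⟨x 0 / x 1, ?_⟩
  simp only [ternaryDisc, Pi.add_apply, Pi.smul_apply, smul_eq_mul, Pi.single_apply, Fin.isValue,
    Fin.reduceEq, if_true, if_false, add_zero]
  field_simp
  linear_combination h

theorem exists_ne_zero_ternaryDisc_eq_zero (s : Fin 6 → ℂ) (l m : Fin 3 → ℂ) (hs : s 2 ≠ 0)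
    (hlm : ternaryQuadratic s (l ⨯₃ m) ≠ 0) :
    ∃ t : ℂ, t ≠ 0 ∧ ternaryDisc (t • s + ![l 0 * m 0, l 1 * m 1, l 2 * m 2, l 0 * m 1 + l 1 * m 0,
      l 0 * m 2 + l 2 * m 0, l 1 * m 2 + l 2 * m 1] + Pi.single 3 (t ^ 2)) = 0 := by
  set r := ![l 0 * m 0, l 1 * m 1, l 2 * m 2, l 0 * m 1 + l 1 * m 0, l 0 * m 2 + l 2 * m 0,
    l 1 * m 2 + l 2 * m 1] with hr
  let D : ℂ := 4 * (r 0 * r 1 * s 2 + r 0 * s 1 * r 2 + s 0 * r 1 * r 2)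
    + (r 3 * r 4 * s 5 + r 3 * s 4 * r 5) - (s 0 * r 5 ^ 2 + 2 * r 0 * r 5 * s 5)
    - (s 1 * r 4 ^ 2 + 2 * r 1 * r 4 * s 4) - s 2 * r 3 ^ 2
  let u : MvPolynomial (Fin 2) ℂ := X 0 + C (s 3) * X 1
  obtain ⟨x, hx0, hx⟩ := exists_ne_zero_common_zero (n := 2) (r := 1) (by norm_num)
    ![C D * X 1 ^ 4 + C (r 4 * r 5 - 2 * r 2 * r 3) * u * X 1 ^ 3
      + X 0 * X 1 ^ 3 * C (4 * (r 0 * s 1 * s 2 + s 0 * r 1 * s 2 + s 0 * s 1 * r 2)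
        + r 3 * s 4 * s 5 - r 0 * s 5 ^ 2 - 2 * s 0 * r 5 * s 5 - r 1 * s 4 ^ 2
        - 2 * s 1 * r 4 * s 4)
      + X 0 * X 1 ^ 2 * u * C (r 4 * s 5 + s 4 * r 5 - 2 * s 2 * r 3) - X 0 * X 1 * u ^ 2 * C (r 2)
      + X 0 ^ 2 * (C (4 * s 0 * s 1 * s 2 - s 0 * s 5 ^ 2 - s 1 * s 4 ^ 2) * X 1 ^ 2
        + C (s 4 * s 5) * u * X 1 - C (s 2) * u ^ 2)] (by intro i; fin_cases i; simp [u])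
  have h := hx 0
  simp only [cons_val, map_add, map_sub, map_mul, map_pow, eval_C, eval_X, u, D] at h
  have h1 : x 1 ≠ 0 := fun h1 => hx0 <| by
    have h0 : x 0 = 0 := by simpa [h1, hs] using h
    ext i; fin_cases i <;> assumption
  have h0 : x 0 ≠ 0 := fun h0 => hlm <| by
    rw [h0] at h
    have h2 : ternaryQuadratic s (l ⨯₃ m) * x 1 ^ 4 = 0 := by
      rw [ternaryQuadratic, cross_apply]
      simp only [hr, cons_val] at h ⊢
      linear_combination -h
    simpa [h1] using h2
  refine ⟨x 0 / x 1, div_ne_zero h0 h1, ?_⟩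
  simp only [ternaryDisc, Pi.add_apply, Pi.smul_apply, smul_eq_mul, Pi.single_apply, Fin.isValue,
    Fin.reduceEq, if_true, if_false, add_zero]
  have hr0 : ternaryDisc r = 0 := by
    simp only [ternaryDisc, hr, cons_val]; ring
  clear_value r
  rw [ternaryDisc] at hr0
  field_simp
  linear_combination x 0 * h + x 1 ^ 5 * hr0

theorem ternaryQuadratic_add_smul (q : Fin 6 → ℂ) (p v : Fin 3 → ℂ) : ∃ s : ℂ, ∀ t : ℂ,
    ternaryQuadratic q (p + t • v) =
      ternaryQuadratic q p + t * s + t ^ 2 * ternaryQuadratic q v := by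
  refine ⟨ternaryQuadratic q (p + v) - ternaryQuadratic q p - ternaryQuadratic q v, fun t => ?_⟩
  simp only [ternaryQuadratic, Pi.add_apply, Pi.smul_apply, smul_eq_mul]
  ring

theorem eq_zero_of_common_zero {f : (Fin 3 → ℂ) → ℂ} (hs : Smooth f) {q : Fin 6 → ℂ}
    {u v : Fin 3 → ℂ} (hf : ∀ p, f p = ternaryQuadratic q p ^ 2
      - 4 * p 0 * p 1 * ((u ⬝ᵥ p) * (v ⬝ᵥ p))) {p : Fin 3 → ℂ} (hq : ternaryQuadratic q p = 0)
    (hu : u ⬝ᵥ p = 0) (hv : v ⬝ᵥ p = 0) : p = 0 := by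
  refine hs p fun w => ?_
  obtain ⟨s, hs⟩ := ternaryQuadratic_add_smul q p w
  have hk : ∃ k : ℂ, k = (u ⬝ᵥ w) * (v ⬝ᵥ w) := ⟨_, rfl⟩
  obtain ⟨k, hk⟩ := hk
  refine ⟨s ^ 2 - 4 * p 0 * p 1 * k, 2 * s * ternaryQuadratic q w
    - 4 * (p 0 * w 1 + p 1 * w 0) * k, ternaryQuadratic q w ^ 2 - 4 * w 0 * w 1 * k, fun t => ?_⟩
  rw [hf, hs, hq, dotProduct_add, dotProduct_add, hu, hv, dotProduct_smul, dotProduct_smul]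
  simp only [Pi.add_apply, Pi.smul_apply, smul_eq_mul]
  rw [hk]
  ring

theorem exists_common_zero_of_cross {q : Fin 6 → ℂ} {u v : Fin 3 → ℂ}
    (h : ternaryQuadratic q (u ⨯₃ v) = 0) :
    ∃ p : Fin 3 → ℂ, p ≠ 0 ∧ ternaryQuadratic q p = 0 ∧ u ⬝ᵥ p = 0 ∧ v ⬝ᵥ p = 0 := by
  by_cases hn : u ⨯₃ v = 0
  · obtain ⟨w, hw⟩ : ∃ w : Fin 3 → ℂ, ∀ p, w ⬝ᵥ p = 0 → u ⬝ᵥ p = 0 ∧ v ⬝ᵥ p = 0 := by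
      by_cases hu : u = 0
      · exact ⟨v, fun p hp => ⟨by rw [hu, zero_dotProduct], hp⟩⟩
      · refine ⟨u, fun p hp => ⟨hp, ?_⟩⟩
        obtain ⟨i, hi⟩ := Function.ne_iff.1 hu
        have h0 := congrFun hn 0
        have h1 := congrFun hn 1
        have h2 := congrFun hn 2
        simp only [cross_apply, cons_val, Pi.zero_apply] at h0 h1 h2 hi
        rw [dotProduct, Fin.sum_univ_three] at hp ⊢
        have : u i * (v 0 * p 0 + v 1 * p 1 + v 2 * p 2) = 0 := by
          fin_cases i
          · simp only [Fin.zero_eta]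
            linear_combination v 0 * hp + p 1 * h2 - p 2 * h1
          · simp only [Fin.mk_one]
            linear_combination v 1 * hp + p 2 * h0 - p 0 * h2
          · simp only [Fin.reduceFinMk]
            linear_combination v 2 * hp + p 0 * h1 - p 1 * h0
        simpa [hi] using this
    obtain ⟨p, hp0, hp⟩ := exists_ne_zero_common_zero (n := 3) (r := 2) (by norm_num)
      ![∑ i, C (w i) * X i, C (q 0) * X 0 ^ 2 + C (q 1) * X 1 ^ 2 + C (q 2) * X 2 ^ 2
        + C (q 3) * X 0 * X 1 + C (q 4) * X 0 * X 2 + C (q 5) * X 1 * X 2]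
      (by intro i; fin_cases i <;> simp)
    refine ⟨p, hp0, ?_, hw p ?_⟩
    · simpa [ternaryQuadratic] using hp 1
    · simpa [dotProduct] using hp 0
  · exact ⟨_, hn, h, by simp, by simp⟩

/-- Every smooth quartic is the determinant of a symmetric matrix of linear forms with zero
diagonal. -/
theorem exists_six_linear_forms {f : (Fin 3 → ℂ) → ℂ} (hf : IsForm 3 4 f) (hs : Smooth f) :
    ∃ g : (Fin 3 → ℂ) →ₗ[ℂ] (Fin 3 → ℂ), Function.Injective g ∧ ∃ a b c d e h : Fin 3 → ℂ, ∀ p,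
      f (g p) = ((a ⬝ᵥ p) * (h ⬝ᵥ p) - (b ⬝ᵥ p) * (e ⬝ᵥ p) - (c ⬝ᵥ p) * (d ⬝ᵥ p)) ^ 2
        - 4 * ((b ⬝ᵥ p) * (e ⬝ᵥ p)) * ((c ⬝ᵥ p) * (d ⬝ᵥ p)) := by
  obtain ⟨g, hg, a, b, c, d, e, r, hfg⟩ := exists_bitangent_coordinates hf hs
  refine ⟨g, hg, ?_⟩
  replace hs := hs.comp hg
  set s : Fin 6 → ℂ := ![d, a, c, 0, e, b] with hs'
  have hfS : ∀ p, f (g p) = ternaryQuadratic s p ^ 2 - 4 * p 0 * p 1 * ternaryQuadratic r p :=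
    fun p => by
      have hp : p = ![p 0, p 1, p 2] := by ext i; fin_cases i <;> rfl
      have := hfg (p 0) (p 1) (p 2)
      rw [← hp] at this
      rw [this]
      simp only [ternaryQuadratic, hs', cons_val]
      ring
  have hs2 : s 2 ≠ 0 := fun h => by
    have : ![0, 0, (1 : ℂ)] = 0 := hs _ fun v => by
      obtain ⟨k, hk⟩ := ternaryQuadratic_add_smul s ![0, 0, 1] v
      obtain ⟨l, hl⟩ := ternaryQuadratic_add_smul r ![0, 0, 1] v
      refine ⟨k ^ 2 - 4 * v 0 * v 1 * ternaryQuadratic r ![0, 0, 1],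
        2 * k * ternaryQuadratic s v - 4 * v 0 * v 1 * l,
        ternaryQuadratic s v ^ 2 - 4 * v 0 * v 1 * ternaryQuadratic r v, fun t => ?_⟩
      show f (g _) = _
      rw [hfS, hk, hl, show ternaryQuadratic s ![0, 0, 1] = 0 by simp [ternaryQuadratic, h]]
      simp only [Pi.add_apply, Pi.smul_apply, smul_eq_mul, cons_val]
      ring
    simpa using congrFun this 2
  clear_value s
  obtain ⟨t, ht⟩ := exists_ternaryDisc_eq_zero s r hs2
  obtain ⟨u, v, huv⟩ := exists_factor_of_ternaryDisc_eq_zero ht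
  obtain ⟨s', hs2', hs'⟩ : ∃ s' : Fin 6 → ℂ, s' 2 ≠ 0 ∧ ∀ p, f (g p) = ternaryQuadratic s' p ^ 2
      - 4 * p 0 * p 1 * ((u ⬝ᵥ p) * (v ⬝ᵥ p)) := by
    refine ⟨s + Pi.single 3 (2 * t), by simpa using hs2, fun p => ?_⟩
    rw [hfS, ← huv]
    simp only [ternaryQuadratic, Pi.add_apply, Pi.smul_apply, smul_eq_mul, Pi.single_apply,
      Fin.isValue, Fin.reduceEq, if_true, if_false, add_zero]
    ring
  have hn : ternaryQuadratic s' (u ⨯₃ v) ≠ 0 := fun h => by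
    obtain ⟨p, hp0, hp, hu, hv⟩ := exists_common_zero_of_cross h
    exact hp0 (eq_zero_of_common_zero hs hs' hp hu hv)
  obtain ⟨k, hk0, hk⟩ := exists_ne_zero_ternaryDisc_eq_zero s' u v hs2' hn
  obtain ⟨A, H, hAH⟩ := exists_factor_of_ternaryDisc_eq_zero hk
  refine ⟨k⁻¹ • A, ![k, 0, 0], k⁻¹ • u, v, ![0, 1, 0], H, fun p => ?_⟩
  have h1 : ternaryQuadratic s' p =
      k⁻¹ * ((A ⬝ᵥ p) * (H ⬝ᵥ p)) - k * p 0 * p 1 - k⁻¹ * ((u ⬝ᵥ p) * (v ⬝ᵥ p)) := by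
    rw [← hAH]
    simp only [ternaryQuadratic, Pi.add_apply, Pi.smul_apply, smul_eq_mul, Pi.single_apply,
      Fin.isValue, Fin.reduceEq, if_true, if_false, add_zero, cons_val, dotProduct,
      Fin.sum_univ_three]
    field_simp
    ring
  rw [hs', h1, smul_dotProduct, smul_dotProduct, show ![k, 0, 0] ⬝ᵥ p = k * p 0 by
    simp [dotProduct, Fin.sum_univ_three], show ![0, 1, 0] ⬝ᵥ p = p 1 by
    simp [dotProduct, Fin.sum_univ_three]]
  generalize (A ⬝ᵥ p) = α
  generalize (H ⬝ᵥ p) = β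
  generalize (u ⬝ᵥ p) = γ
  generalize (v ⬝ᵥ p) = δ
  simp only [smul_eq_mul]
  field_simp

/-- The discriminant form `a² + b² + c² - 2ab - 2ac - 2bc`. -/
def heronForm (a : Fin 3 → ℂ) : ℂ :=
  a 0 ^ 2 + a 1 ^ 2 + a 2 ^ 2 - 2 * a 0 * a 1 - 2 * a 0 * a 2 - 2 * a 1 * a 2

/-- Half of the gradient of `heronForm`. -/
def heronGrad (a : Fin 3 → ℂ) : Fin 3 → ℂ :=
  ![a 0 - a 1 - a 2, a 1 - a 0 - a 2, a 2 - a 0 - a 1]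

/-- The symmetric matrix with zero diagonal whose six entries above the diagonal are the
coordinates of `p` and of `p ᵥ* N`. -/
def netMatrix (N : Matrix (Fin 3) (Fin 3) ℂ) : (Fin 3 → ℂ) →ₗ[ℂ] Matrix (Fin 4) (Fin 4) ℂ where
  toFun p := !![0, p 0, p 1, p 2;
    p 0, 0, (p ᵥ* N) 2, (p ᵥ* N) 1;
    p 1, (p ᵥ* N) 2, 0, (p ᵥ* N) 0;
    p 2, (p ᵥ* N) 1, (p ᵥ* N) 0, 0]
  map_add' p q := by
    rw [add_vecMul]
    ext i j
    fin_cases i <;> fin_cases j <;> simp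
  map_smul' c p := by
    rw [smul_vecMul]
    ext i j
    fin_cases i <;> fin_cases j <;> simp

theorem netMatrix_apply (N : Matrix (Fin 3) (Fin 3) ℂ) (p : Fin 3 → ℂ) :
    netMatrix N p = !![0, p 0, p 1, p 2;
      p 0, 0, (p ᵥ* N) 2, (p ᵥ* N) 1;
      p 1, (p ᵥ* N) 2, 0, (p ᵥ* N) 0;
      p 2, (p ᵥ* N) 1, (p ᵥ* N) 0, 0] :=
  rfl

theorem netMatrix_isSymm (N : Matrix (Fin 3) (Fin 3) ℂ) (p : Fin 3 → ℂ) :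
    (netMatrix N p).IsSymm := by
  ext i j
  fin_cases i <;> fin_cases j <;> rfl

theorem netMatrix_injective (N : Matrix (Fin 3) (Fin 3) ℂ) : Function.Injective (netMatrix N) := by
  intro p q h
  ext i
  have := congrFun (congrFun h 0) i.succ
  fin_cases i <;> simpa [netMatrix_apply] using this

theorem det_netMatrix (N : Matrix (Fin 3) (Fin 3) ℂ) (p : Fin 3 → ℂ) :
    (netMatrix N p).det = heronForm fun i => p i * (p ᵥ* N) i := by
  rw [netMatrix_apply]
  simp [det_succ_row_zero, Fin.sum_univ_succ, Fin.succAbove, heronForm]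
  ring

theorem eq_zero_of_heronGrad {N : Matrix (Fin 3) (Fin 3) ℂ}
    (hN : Smooth fun p => (netMatrix N p).det) {p : Fin 3 → ℂ}
    (h0 : heronForm (fun i => p i * (p ᵥ* N) i) = 0)
    (h1 : ∀ v : Fin 3 → ℂ, ∑ i, heronGrad (fun i => p i * (p ᵥ* N) i) i *
      (v i * (p ᵥ* N) i + p i * (v ᵥ* N) i) = 0) : p = 0 := by
  refine hN p fun v => ?_
  have h1v := h1 v
  simp only [det_netMatrix, add_vecMul, smul_vecMul]
  generalize p ᵥ* N = w at h0 h1v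
  generalize v ᵥ* N = z at h1v
  refine ⟨heronForm (fun i => v i * w i + p i * z i) +
      2 * ∑ i, heronGrad (fun i => p i * w i) i * (v i * z i),
    2 * ∑ i, heronGrad (fun i => v i * w i + p i * z i) i * (v i * z i),
    heronForm (fun i => v i * z i), fun t => ?_⟩
  simp only [heronForm, heronGrad, Fin.sum_univ_three, cons_val, Pi.add_apply, Pi.smul_apply,
    smul_eq_mul] at h0 h1v ⊢
  linear_combination h0 + 2 * t * h1v

theorem eq_zero_of_pairs {N : Matrix (Fin 3) (Fin 3) ℂ}
    (hN : Smooth fun p => (netMatrix N p).det) {p : Fin 3 → ℂ}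
    (h : ∀ i, p i = 0 ∨ (p ᵥ* N) i = 0) : p = 0 := by
  have h0 : (fun i => p i * (p ᵥ* N) i) = 0 := funext fun i => mul_eq_zero.2 (h i)
  refine eq_zero_of_heronGrad hN ?_ fun v => ?_ <;> rw [h0] <;>
    simp [heronForm, heronGrad, Fin.sum_univ_three]

theorem eq_zero_of_pairs_mulVec {N : Matrix (Fin 3) (Fin 3) ℂ}
    (hN : Smooth fun p => (netMatrix N p).det) {y : Fin 3 → ℂ}
    (h : ∀ i, y i = 0 ∨ (N *ᵥ y) i = 0) : y = 0 := by
  classical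
  by_contra hy
  set K : Matrix (Fin 3) (Fin 3) ℂ :=
    of fun i j => if y i = 0 then (1 : Matrix _ _ ℂ) i j else N i j with hK
  obtain ⟨p, hp0, hp⟩ := exists_vecMul_eq_zero_iff.2 <| exists_mulVec_eq_zero_iff.1
    ⟨y, hy, show K *ᵥ y = 0 from funext fun i => by
      by_cases hi : y i = 0
      · simp [hK, mulVec, dotProduct, hi, one_apply]
      · simpa [hK, mulVec, dotProduct, hi] using (h i).resolve_left hi⟩
  have hp' : (fun i => if y i = 0 then 0 else p i) = 0 := eq_zero_of_pairs hN fun j => by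
    by_cases hj : y j = 0
    · simp [hj]
    · refine Or.inr (Eq.trans ?_ (congrFun hp j))
      simp only [vecMul, dotProduct]
      refine Finset.sum_congr rfl fun i _ => ?_
      by_cases hi : y i = 0
      · simp [hK, hi, one_apply, show i ≠ j by rintro rfl; exact hj hi]
      · simp [hK, hi]
  refine hp0 (funext fun j => ?_)
  by_cases hj : y j = 0
  · have := congrFun hp j
    simp only [vecMul, dotProduct] at this
    rw [Finset.sum_eq_single j] at this
    · simpa [hK, hj] using this
    · intro i _ hij
      by_cases hi : y i = 0
      · simp [hK, hi, one_apply, hij]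
      · have := congrFun hp' i
        simp only [hi, if_false, Pi.zero_apply] at this
        simp [this]
    · simp
  · simpa [hj] using congrFun hp' j

theorem rank_netMatrix {N : Matrix (Fin 3) (Fin 3) ℂ}
    (hN : Smooth fun p => (netMatrix N p).det) {p : Fin 3 → ℂ} (hp : p ≠ 0) :
    3 ≤ (netMatrix N p).rank := by
  by_contra! hr
  have hminor : ∀ r c : Fin 3 → Fin 4, ((netMatrix N p).submatrix r c).det = 0 := fun r c => by
    by_contra hd
    have := rank_of_isUnit _ ((isUnit_iff_isUnit_det _).2 (isUnit_iff_ne_zero.2 hd))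
    have h2 := rank_submatrix_le (netMatrix N p) r c
    simp only [Fintype.card_fin] at this
    omega
  have key : ∀ i, p i * heronGrad (fun i => p i * (p ᵥ* N) i) i = 0 ∧
      (p ᵥ* N) i * heronGrad (fun i => p i * (p ᵥ* N) i) i = 0 := by
    have m01 := hminor ![1, 2, 3] ![0, 2, 3]
    have m02 := hminor ![1, 2, 3] ![0, 1, 3]
    have m03 := hminor ![1, 2, 3] ![0, 1, 2]
    have m23 := hminor ![0, 1, 3] ![0, 1, 2]
    have m13 := hminor ![0, 2, 3] ![0, 1, 2]
    have m12 := hminor ![0, 2, 3] ![0, 1, 3]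
    simp only [netMatrix_apply, det_fin_three, submatrix_apply, of_apply, cons_val]
      at m01 m02 m03 m23 m13 m12
    intro i
    fin_cases i <;> simp only [heronGrad, cons_val, Fin.zero_eta, Fin.mk_one, Fin.reduceFinMk]
    · constructor
      · linear_combination -m23
      · linear_combination -m01
    · constructor
      · linear_combination m13
      · linear_combination m02
    · constructor
      · linear_combination -m12
      · linear_combination -m03
  refine hp (eq_zero_of_heronGrad hN ?_ fun v => Finset.sum_eq_zero fun i _ => ?_)
  · have h0 := (key 0).1
    have h1 := (key 1).1
    have h2 := (key 2).1
    simp only [heronGrad, heronForm, cons_val] at h0 h1 h2 ⊢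
    linear_combination (p ᵥ* N) 0 * h0 + (p ᵥ* N) 1 * h1 + (p ᵥ* N) 2 * h2
  · linear_combination v i * (key i).2 + (v ᵥ* N) i * (key i).1

theorem eq_smul_of_crossProduct_eq_zero {n w : Fin 3 → ℂ} (hn : n ≠ 0) (h : n ⨯₃ w = 0) :
    ∃ c : ℂ, w = c • n := by
  obtain ⟨i, hi⟩ := Function.ne_iff.1 hn
  have h0 := congrFun h 0
  have h1 := congrFun h 1
  have h2 := congrFun h 2
  simp only [cross_apply, cons_val, Pi.zero_apply] at h0 h1 h2 hi
  have key : ∀ j, w j * n i = w i * n j := fun j => by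
    fin_cases i <;> fin_cases j <;>
      simp only [Fin.zero_eta, Fin.mk_one, Fin.reduceFinMk] <;>
      first
        | ring1
        | linear_combination h0
        | linear_combination -h0
        | linear_combination h1
        | linear_combination -h1
        | linear_combination h2
        | linear_combination -h2
  refine ⟨w i / n i, funext fun j => ?_⟩
  rw [Pi.smul_apply, smul_eq_mul, div_mul_eq_mul_div, eq_div_iff hi]
  exact key j

theorem eq_smul_cross {u v w : Fin 3 → ℂ} (hn : u ⨯₃ v ≠ 0) (hu : u ⬝ᵥ w = 0) (hv : v ⬝ᵥ w = 0) :
    ∃ c : ℂ, w = c • u ⨯₃ v := by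
  refine eq_smul_of_crossProduct_eq_zero hn ?_
  rw [cross_cross_eq_smul_sub_smul, hu, hv]
  simp

theorem exists_dual_of_cross {u v : Fin 3 → ℂ} (hn : u ⨯₃ v ≠ 0) :
    ∃ w : Fin 3 → ℂ, u ⬝ᵥ w = 0 ∧ v ⬝ᵥ w = 1 := by
  obtain ⟨i, hi⟩ := Function.ne_iff.1 hn
  refine ⟨((u ⨯₃ v) i)⁻¹ • (Pi.single i 1 ⨯₃ u), ?_, ?_⟩
  · rw [dotProduct_smul, dot_cross_self, smul_zero]
  · rw [dotProduct_smul, triple_product_permutation, single_one_dotProduct, smul_eq_mul,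
      inv_mul_cancel₀ hi]

theorem ternaryQuadratic_smul (q : Fin 6 → ℂ) (c : ℂ) (p : Fin 3 → ℂ) :
    ternaryQuadratic q (c • p) = c ^ 2 * ternaryQuadratic q p := by
  simp only [ternaryQuadratic, Pi.smul_apply, smul_eq_mul]
  ring

theorem exists_gradient_ternaryQuadratic (q : Fin 6 → ℂ) (p : Fin 3 → ℂ) :
    ∃ g : Fin 3 → ℂ, ∀ w, ternaryQuadratic q (p + w) =
      ternaryQuadratic q p + g ⬝ᵥ w + ternaryQuadratic q w := by
  refine ⟨![2 * q 0 * p 0 + q 3 * p 1 + q 4 * p 2, 2 * q 1 * p 1 + q 3 * p 0 + q 5 * p 2,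
    2 * q 2 * p 2 + q 4 * p 0 + q 5 * p 1], fun w => ?_⟩
  simp only [ternaryQuadratic, Pi.add_apply, dotProduct, Fin.sum_univ_three, cons_val]
  ring

/-- A conic meets a line of a transversal line pair in two points away from the vertex. -/
theorem exists_points_on_line {q : Fin 6 → ℂ} {u v : Fin 3 → ℂ} (hn : u ⨯₃ v ≠ 0)
    (hq : ternaryQuadratic q (u ⨯₃ v) ≠ 0)
    (hT : ∀ y : Fin 3 → ℂ, ternaryQuadratic q y = 0 → u ⬝ᵥ y = 0 → v ⬝ᵥ y = 1 → ∀ t : ℂ, ∃ w,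
      ternaryQuadratic q (y + w) - ternaryQuadratic q w ≠ t * (u ⬝ᵥ w)) :
    ∃ y z : Fin 3 → ℂ, y ≠ z ∧ (u ⬝ᵥ y = 0 ∧ v ⬝ᵥ y = 1 ∧ ternaryQuadratic q y = 0) ∧
      (u ⬝ᵥ z = 0 ∧ v ⬝ᵥ z = 1 ∧ ternaryQuadratic q z = 0) ∧
      ∀ w, u ⬝ᵥ w = 0 → ternaryQuadratic q w = 0 → ∃ c : ℂ, w = c • y ∨ w = c • z := by
  obtain ⟨m, hm0, hm1⟩ := exists_dual_of_cross hn
  obtain ⟨m', hm0', hm1'⟩ := exists_dual_of_cross (u := v) (v := u) (by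
    rwa [← cross_anticomm, neg_ne_zero])
  set n := u ⨯₃ v with hn'
  have hun : u ⬝ᵥ n = 0 := dot_self_cross u v
  have hvn : v ⬝ᵥ n = 0 := dot_cross_self u v
  obtain ⟨s, hs⟩ := ternaryQuadratic_add_smul q m n
  obtain ⟨a, b, hab⟩ : ∃ a b : ℂ, ∀ t, ternaryQuadratic q (m + t • n) =
      ternaryQuadratic q n * (t - a) * (t - b) := by
    obtain ⟨r, hr⟩ := exists_pow_eq two_ne_zero (s ^ 2 - 4 * ternaryQuadratic q n *
      ternaryQuadratic q m)
    refine ⟨(-s + r) / (2 * ternaryQuadratic q n), (-s - r) / (2 * ternaryQuadratic q n),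
      fun t => ?_⟩
    rw [hs]
    field_simp
    linear_combination hr
  have hline : ∀ w, u ⬝ᵥ w = 0 → ∃ c, w = (v ⬝ᵥ w) • m + c • n := fun w hw => by
    obtain ⟨c, hc⟩ := eq_smul_cross (w := w - (v ⬝ᵥ w) • m) hn
      (by rw [dotProduct_sub, dotProduct_smul, hw, hm0]; simp)
      (by rw [dotProduct_sub, dotProduct_smul, hm1]; simp)
    exact ⟨c, by rw [← hc]; abel⟩
  have hne : a ≠ b := by
    rintro rfl
    obtain ⟨g, hg⟩ := exists_gradient_ternaryQuadratic q (m + a • n)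
    have hgn := hg n
    rw [add_assoc, show a • n + n = (a + 1) • n by rw [add_smul, one_smul], hab, hab] at hgn
    have hgy := hg (m + a • n)
    rw [← two_smul ℂ, ternaryQuadratic_smul, hab] at hgy
    set y := m + a • n with hy
    obtain ⟨w, hw⟩ := hT y (by rw [hab]; ring) (by simp [y, hm0, hun]) (by simp [y, hm1, hvn])
      (g ⬝ᵥ m')
    obtain ⟨c, hc⟩ := eq_smul_cross (w := w - (v ⬝ᵥ w) • y - (u ⬝ᵥ w) • m') hn
      (by simp [dotProduct_sub, y, hm0, hun, hm1'])
      (by simp [dotProduct_sub, y, hm1, hvn, hm0'])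
    have hgc := congrArg (g ⬝ᵥ ·) hc
    simp only [dotProduct_sub, dotProduct_smul, smul_eq_mul] at hgc
    refine hw ?_
    rw [hg, hab]
    linear_combination hgc - (v ⬝ᵥ w) * hgy - c * hgn
  refine ⟨m + a • n, m + b • n, fun h => hne ?_, ⟨by simp [hm0, hun], by simp [hm1, hvn],
    by rw [hab]; ring⟩, ⟨by simp [hm0, hun], by simp [hm1, hvn], by rw [hab]; ring⟩,
    fun w hw hqw => ?_⟩
  · exact smul_left_injective ℂ hn (add_left_cancel h)
  · obtain ⟨c, hc⟩ := hline w hw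
    by_cases hv : v ⬝ᵥ w = 0
    · refine ⟨0, Or.inl ?_⟩
      rw [hv, zero_smul, zero_add] at hc
      rw [hc, ternaryQuadratic_smul, mul_eq_zero, or_iff_left hq] at hqw
      rw [hc, pow_eq_zero_iff two_ne_zero |>.1 hqw, zero_smul, zero_smul]
    · generalize v ⬝ᵥ w = d at hv hc
      have h2 : w = d • (m + (c / d) • n) := by
        rw [hc, smul_add, smul_smul, mul_div_cancel₀ _ hv]
      rw [h2, ternaryQuadratic_smul, hab] at hqw
      rcases mul_eq_zero.1 ((mul_eq_zero.1 hqw).resolve_left (pow_ne_zero 2 hv)) with h | h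
      · have := (mul_eq_zero.1 h).resolve_left hq
        exact ⟨d, Or.inl (by rw [h2, sub_eq_zero.1 this])⟩
      · exact ⟨d, Or.inr (by rw [h2, sub_eq_zero.1 h])⟩

theorem exists_four_points_of_line_pair {q : Fin 6 → ℂ} {u v : Fin 3 → ℂ}
    (hT : ∀ y : Fin 3 → ℂ, y ≠ 0 → ternaryQuadratic q y = 0 → (u ⬝ᵥ y) * (v ⬝ᵥ y) = 0 →
      ∀ s t : ℂ, (∀ w, s * (ternaryQuadratic q (y + w) - ternaryQuadratic q w) +
        t * ((u ⬝ᵥ (y + w)) * (v ⬝ᵥ (y + w)) - (u ⬝ᵥ w) * (v ⬝ᵥ w)) = 0) → s = 0 ∧ t = 0) :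
    ∃ y : Fin 4 → Fin 3 → ℂ,
      (∀ i, y i ≠ 0 ∧ ternaryQuadratic q (y i) = 0 ∧ (u ⬝ᵥ y i) * (v ⬝ᵥ y i) = 0) ∧
      (∀ i j, i ≠ j → ∀ c : ℂ, y j ≠ c • y i) ∧
      (∀ c : Fin 3 → ℂ, c 0 • y 0 + c 1 • y 1 + c 2 • y 2 = 0 → c = 0) ∧
      ∀ w, ternaryQuadratic q w = 0 → (u ⬝ᵥ w) * (v ⬝ᵥ w) = 0 → ∃ i, ∃ c : ℂ, w = c • y i := by
  have hq : ternaryQuadratic q (u ⨯₃ v) ≠ 0 := fun h => by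
    obtain ⟨p, hp0, hp, hu, hv⟩ := exists_common_zero_of_cross h
    exact one_ne_zero (hT p hp0 hp (by rw [hu, zero_mul]) 0 1 fun w => by
      rw [dotProduct_add, dotProduct_add, hu, hv]; ring).2
  have hn : u ⨯₃ v ≠ 0 := fun h => hq (by rw [h]; simp [ternaryQuadratic])
  obtain ⟨y0, y1, hy, ⟨hu0, hv0, hq0⟩, ⟨hu1, hv1, hq1⟩, h01⟩ := exists_points_on_line hn hq
    fun y hqy huy hvy t => by
      by_contra! h
      refine one_ne_zero (hT y ?_ hqy (by rw [huy, zero_mul]) 1 (-t) fun w => ?_).1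
      · rintro rfl
        simp at hvy
      · rw [h, dotProduct_add, dotProduct_add, huy, hvy]
        ring
  have hc : v ⨯₃ u = -(u ⨯₃ v) := (cross_anticomm u v).symm
  obtain ⟨y2, y3, hy', ⟨hv2, hu2, hq2⟩, ⟨hv3, hu3, hq3⟩, h23⟩ := exists_points_on_line
    (q := q) (u := v) (v := u) (by rwa [hc, neg_ne_zero])
    (by rwa [hc, ← neg_one_smul ℂ, ternaryQuadratic_smul, neg_one_sq, one_mul])
    fun y hqy huy hvy t => by
      by_contra! h
      refine one_ne_zero (hT y ?_ hqy (by rw [huy, mul_zero]) 1 (-t) fun w => ?_).1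
      · rintro rfl
        simp at hvy
      · rw [h, dotProduct_add, dotProduct_add, huy, hvy]
        ring
  refine ⟨![y0, y1, y2, y3], ?_, ?_, ?_, ?_⟩
  · have hne : ∀ {a b : Fin 3 → ℂ}, a ⬝ᵥ b = 1 → b ≠ 0 := by
      rintro a _ h rfl
      simp at h
    intro i
    fin_cases i
    · exact ⟨hne hv0, hq0, by simp [hu0]⟩
    · exact ⟨hne hv1, hq1, by simp [hu1]⟩
    · exact ⟨hne hu2, hq2, by simp [hv2]⟩
    · exact ⟨hne hu3, hq3, by simp [hv3]⟩
  · intro i j hij c h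
    have huy : ∀ k, u ⬝ᵥ ![y0, y1, y2, y3] k = ![0, 0, 1, 1] k := by
      intro k
      fin_cases k <;> assumption
    have hvy : ∀ k, v ⬝ᵥ ![y0, y1, y2, y3] k = ![1, 1, 0, 0] k := by
      intro k
      fin_cases k <;> assumption
    have hu := congrArg (u ⬝ᵥ ·) h
    have hv := congrArg (v ⬝ᵥ ·) h
    simp only [dotProduct_smul, smul_eq_mul, huy, hvy] at hu hv
    have hsum : ∀ k : Fin 4, (![0, 0, 1, 1] k + ![1, 1, 0, 0] k : ℂ) = 1 := by
      intro k
      fin_cases k <;> simp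
    have hc1 : c = 1 := by linear_combination hsum j - c * hsum i - hu - hv
    rw [hc1, one_smul] at h
    rw [hc1, one_mul] at hu
    clear hv hc1 huy hvy hsum
    fin_cases i <;> fin_cases j <;>
      first
        | exact hij rfl
        | exact hy h
        | exact hy h.symm
        | exact hy' h
        | exact hy' h.symm
        | exact zero_ne_one hu
        | exact one_ne_zero hu
  · intro c h
    have hu := congrArg (u ⬝ᵥ ·) h
    have hv := congrArg (v ⬝ᵥ ·) h
    simp only [cons_val, dotProduct_add, dotProduct_smul, smul_eq_mul, hu0, hu1, hu2, hv0, hv1,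
      hv2, dotProduct_zero, mul_zero, mul_one, add_zero, zero_add] at hu hv
    have h1 : c 1 = -c 0 := by linear_combination hv
    simp only [cons_val, hu, h1, zero_smul, add_zero, neg_smul, ← sub_eq_add_neg, ← smul_sub] at h
    have h0 := (smul_eq_zero.1 h).resolve_right (sub_ne_zero.2 hy)
    ext i
    fin_cases i
    · exact h0
    · show c 1 = 0
      rw [h1, h0, neg_zero]
    · exact hu
  · intro w hw huv
    rcases mul_eq_zero.1 huv with h | h
    · obtain ⟨c, hc | hc⟩ := h01 w h hw
      · exact ⟨0, c, hc⟩
      · exact ⟨1, c, hc⟩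
    · obtain ⟨c, hc | hc⟩ := h23 w h hw
      · exact ⟨2, c, hc⟩
      · exact ⟨3, c, hc⟩

theorem ternaryQuadratic_combination (q r : Fin 6 → ℂ) (s t : ℂ) (p : Fin 3 → ℂ) :
    ternaryQuadratic (s • q + t • r) p =
      s * ternaryQuadratic q p + t * ternaryQuadratic r p := by
  simp only [ternaryQuadratic, Pi.add_apply, Pi.smul_apply, smul_eq_mul]
  ring

/-- Two conics which meet transversally have four common points, the first three of which
are not collinear. -/
theorem exists_four_points {q r : Fin 6 → ℂ}
    (hT : ∀ y : Fin 3 → ℂ, y ≠ 0 → ternaryQuadratic q y = 0 → ternaryQuadratic r y = 0 →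
      ∀ s t : ℂ, (∀ w, s * (ternaryQuadratic q (y + w) - ternaryQuadratic q w) +
        t * (ternaryQuadratic r (y + w) - ternaryQuadratic r w) = 0) → s = 0 ∧ t = 0) :
    ∃ y : Fin 4 → Fin 3 → ℂ,
      (∀ i, y i ≠ 0 ∧ ternaryQuadratic q (y i) = 0 ∧ ternaryQuadratic r (y i) = 0) ∧
      (∀ i j, i ≠ j → ∀ c : ℂ, y j ≠ c • y i) ∧
      (∀ c : Fin 3 → ℂ, c 0 • y 0 + c 1 • y 1 + c 2 • y 2 = 0 → c = 0) ∧
      ∀ w, ternaryQuadratic q w = 0 → ternaryQuadratic r w = 0 → ∃ i, ∃ c : ℂ, w = c • y i := by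
  let z : Fin 6 → MvPolynomial (Fin 2) ℂ := fun i => C (q i) * X 0 + C (r i) * X 1
  obtain ⟨x, hx0, hx⟩ := exists_ne_zero_common_zero (n := 2) (r := 1) (by norm_num)
    ![4 * z 0 * z 1 * z 2 + z 3 * z 4 * z 5 - z 0 * z 5 ^ 2 - z 1 * z 4 ^ 2 - z 2 * z 3 ^ 2]
    (by intro i; fin_cases i; simp [z])
  have hd : ternaryDisc (x 0 • q + x 1 • r) = 0 := by
    have := hx 0
    simp only [cons_val, z, map_add, map_sub, map_mul, map_pow, eval_C, eval_X, map_ofNat] at this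
    simp only [ternaryDisc, Pi.add_apply, Pi.smul_apply, smul_eq_mul]
    linear_combination this
  obtain ⟨u, v, huv⟩ := exists_factor_of_ternaryDisc_eq_zero hd
  simp only [ternaryQuadratic_combination] at huv
  by_cases h0 : x 0 = 0
  · have h1 : x 1 ≠ 0 := fun h1 => hx0 (by ext i; fin_cases i <;> assumption)
    simp only [h0, zero_mul, zero_add] at huv
    have hz : ∀ y, (u ⬝ᵥ y) * (v ⬝ᵥ y) = 0 ↔ ternaryQuadratic r y = 0 := fun y => by
      rw [← huv, mul_eq_zero, or_iff_right h1]
    obtain ⟨y, hy⟩ := exists_four_points_of_line_pair (q := q) (u := u) (v := v)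
      fun y hy0 hqy hy s t h => by
        obtain ⟨hs, ht⟩ := hT y hy0 hqy ((hz y).1 hy) s (t * x 1) fun w => by
          rw [← h w, ← huv, ← huv]
          ring
        exact ⟨hs, (mul_eq_zero.1 ht).resolve_right h1⟩
    simp only [hz] at hy
    exact ⟨y, hy⟩
  · have hz : ∀ y, ternaryQuadratic r y = 0 →
        ((u ⬝ᵥ y) * (v ⬝ᵥ y) = 0 ↔ ternaryQuadratic q y = 0) := fun y hy => by
      rw [← huv, hy, mul_zero, add_zero, mul_eq_zero, or_iff_right h0]
    obtain ⟨y, hy1, hy2, hy3, hy4⟩ := exists_four_points_of_line_pair (q := r) (u := u) (v := v)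
      fun y hy0 hry hy s t h => by
        obtain ⟨hs, ht⟩ := hT y hy0 ((hz y hry).1 hy) hry (t * x 0) (s + t * x 1) fun w => by
          rw [← h w, ← huv, ← huv]
          ring
        have ht0 := (mul_eq_zero.1 hs).resolve_right h0
        rw [ht0, zero_mul, add_zero] at ht
        exact ⟨ht, ht0⟩
    exact ⟨y, fun i => ⟨(hy1 i).1, (hz _ (hy1 i).2.1).1 (hy1 i).2.2, (hy1 i).2.1⟩, hy2, hy3,
      fun w hq hr => hy4 w hr ((hz w hr).2 hq)⟩

/-- The equations of the base locus of the net of quadrics `netMatrix N`. -/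
def IsBasePoint (N : Matrix (Fin 3) (Fin 3) ℂ) (x : Fin 4 → ℂ) : Prop :=
  ∀ i : Fin 3, x 0 * x i.succ + (N *ᵥ ![x 2 * x 3, x 1 * x 3, x 1 * x 2]) i = 0

theorem isBasePoint_iff {N : Matrix (Fin 3) (Fin 3) ℂ} {x : Fin 4 → ℂ} :
    IsBasePoint N x ↔ ∀ p, x ⬝ᵥ netMatrix N p *ᵥ x = 0 := by
  have key : ∀ p, x ⬝ᵥ netMatrix N p *ᵥ x =
      2 * ∑ i, p i * (x 0 * x i.succ + (N *ᵥ ![x 2 * x 3, x 1 * x 3, x 1 * x 2]) i) := fun p => by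
    simp [netMatrix_apply, mulVec, vecMul, dotProduct, Fin.sum_univ_succ]
    ring
  refine ⟨fun h p => ?_, fun h i => ?_⟩
  · rw [key, Finset.sum_eq_zero fun i _ => by rw [h i, mul_zero], mul_zero]
  · have := h (Pi.single i 1)
    rw [key, Finset.sum_eq_single i (fun j _ hj => by simp [hj]) (by simp)] at this
    simpa using this

/-- The condition that the products `y i * (N *ᵥ y) i` are all equal. -/
def IsBalanced (N : Matrix (Fin 3) (Fin 3) ℂ) (y : Fin 3 → ℂ) : Prop :=
  ∀ i, y i * (N *ᵥ y) i = y 0 * (N *ᵥ y) 0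

theorem IsBalanced.apply_ne_zero {N : Matrix (Fin 3) (Fin 3) ℂ}
    (hN : Smooth fun p => (netMatrix N p).det) {y : Fin 3 → ℂ} (hy0 : y ≠ 0)
    (hy : IsBalanced N y) (i : Fin 3) : y i ≠ 0 := fun hi => by
  have h0 := hy i
  rw [hi, zero_mul] at h0
  exact hy0 (eq_zero_of_pairs_mulVec hN fun j => mul_eq_zero.1 ((hy j).trans h0.symm))

theorem IsBalanced.transversal {N : Matrix (Fin 3) (Fin 3) ℂ}
    (hN : Smooth fun p => (netMatrix N p).det) {y : Fin 3 → ℂ} (hy0 : y ≠ 0)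
    (hy : IsBalanced N y) {t : Fin 3 → ℂ} (ht : t 0 + t 1 + t 2 = 0)
    (h : ∀ w : Fin 3 → ℂ, ∑ i, t i * (w i * (N *ᵥ y) i + y i * (N *ᵥ w) i) = 0) : t = 0 := by
  have hpN : ∀ i, ((fun i => t i * y i) ᵥ* N) i = -(t i * (N *ᵥ y) i) := fun i => by
    have := h (Pi.single i 1)
    simp only [mul_add, Finset.sum_add_distrib, mulVec_single_one] at this
    rw [Finset.sum_eq_single i (fun j _ hj => by simp [hj]) (by simp)] at this
    simp only [Pi.single_eq_same, one_mul] at this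
    simp only [vecMul, dotProduct, Fin.sum_univ_three, col_apply] at this ⊢
    linear_combination this
  have hp : (fun i => t i * y i) = 0 := by
    have h2 : t 2 = -t 0 - t 1 := by linear_combination ht
    have h1 := hy 1
    have h2' := hy 2
    refine eq_zero_of_heronGrad hN ?_ fun v => ?_
    · simp only [hpN]
      have : (fun i => t i * y i * -(t i * (N *ᵥ y) i)) =
          fun i => -(t i ^ 2 * (y 0 * (N *ᵥ y) 0)) := funext fun i => by
        rw [← hy i]
        ring
      rw [this]
      simp only [heronForm, h2]
      ring
    · simp only [hpN]
      have : (fun i => t i * y i * -(t i * (N *ᵥ y) i)) =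
          fun i => -(t i ^ 2 * (y 0 * (N *ᵥ y) 0)) := funext fun i => by
        rw [← hy i]
        ring
      rw [this]
      have hv : v ⬝ᵥ N *ᵥ y = v ᵥ* N ⬝ᵥ y := dotProduct_mulVec v N y
      simp only [dotProduct, Fin.sum_univ_three] at hv
      simp only [heronGrad, Fin.sum_univ_three, cons_val, h2]
      generalize N *ᵥ y = a at hv
      generalize v ᵥ* N = b at hv
      linear_combination 2 * y 0 * a 0 * t 0 * t 1 * (-t 0 - t 1) * hv
  funext i
  exact (mul_eq_zero.1 (congrFun hp i)).resolve_right (hy.apply_ne_zero hN hy0 i)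

/-- Inverse of the standard Cremona transformation on the base locus. -/
def baseLift (N : Matrix (Fin 3) (Fin 3) ℂ) (y : Fin 3 → ℂ) : Fin 4 → ℂ :=
  ![-(y 0 * (N *ᵥ y) 0), y 1 * y 2, y 0 * y 2, y 0 * y 1]

theorem cremona_baseLift (N : Matrix (Fin 3) (Fin 3) ℂ) (y : Fin 3 → ℂ) :
    ![baseLift N y 2 * baseLift N y 3, baseLift N y 1 * baseLift N y 3,
      baseLift N y 1 * baseLift N y 2] = (y 0 * y 1 * y 2) • y := by
  ext i
  fin_cases i <;> simp [baseLift] <;> ring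

theorem baseLift_smul (N : Matrix (Fin 3) (Fin 3) ℂ) (c : ℂ) (y : Fin 3 → ℂ) :
    baseLift N (c • y) = c ^ 2 • baseLift N y := by
  ext i
  fin_cases i <;> simp [baseLift, mulVec_smul] <;> ring

theorem baseLift_ne_zero {N : Matrix (Fin 3) (Fin 3) ℂ} {y : Fin 3 → ℂ} (hy : ∀ i, y i ≠ 0)
    {j : Fin 4} (hj : j ≠ 0) : baseLift N y j ≠ 0 := by
  fin_cases j
  · exact absurd rfl hj
  · exact mul_ne_zero (hy 1) (hy 2)
  · exact mul_ne_zero (hy 0) (hy 2)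
  · exact mul_ne_zero (hy 0) (hy 1)

theorem IsBalanced.isBasePoint {N : Matrix (Fin 3) (Fin 3) ℂ} {y : Fin 3 → ℂ}
    (hy : IsBalanced N y) : IsBasePoint N (baseLift N y) := fun i => by
  have h1 := hy 1
  have h2 := hy 2
  rw [cremona_baseLift, mulVec_smul, Pi.smul_apply, smul_eq_mul]
  fin_cases i <;> simp [baseLift]
  · ring
  · linear_combination y 0 * y 2 * h1
  · linear_combination y 0 * y 1 * h2

theorem IsBasePoint.eq_smul {N : Matrix (Fin 3) (Fin 3) ℂ}
    (hN : Smooth fun p => (netMatrix N p).det) {x : Fin 4 → ℂ} (hx : IsBasePoint N x) :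
    (∃ j, ∃ c : ℂ, x = c • Pi.single j 1) ∨
      ∃ y, ∃ c : ℂ, IsBalanced N y ∧ x = c • baseLift N y := by
  have hb : ∀ i, ![x 2 * x 3, x 1 * x 3, x 1 * x 2] i *
      (N *ᵥ ![x 2 * x 3, x 1 * x 3, x 1 * x 2]) i = -(x 0 * (x 1 * x 2 * x 3)) := fun i => by
    have := hx i
    fin_cases i <;> simp only [Fin.zero_eta, Fin.mk_one, Fin.reduceFinMk, cons_val,
      Fin.succ_zero_eq_one, Fin.succ_one_eq_two, Fin.reduceSucc] at this ⊢
    · linear_combination x 2 * x 3 * this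
    · linear_combination x 1 * x 3 * this
    · linear_combination x 1 * x 2 * this
  by_cases h : x 1 * x 2 * x 3 = 0
  · left
    have hz := eq_zero_of_pairs_mulVec hN fun i => mul_eq_zero.1 ((hb i).trans (by simp [h]))
    have h0 := congrFun hz 0
    have h1 := congrFun hz 1
    have h2 := congrFun hz 2
    simp only [cons_val, Pi.zero_apply, mul_eq_zero] at h0 h1 h2
    have hx' : ∀ i : Fin 3, x 0 = 0 ∨ x i.succ = 0 := fun i => by
      have := hx i
      rw [hz, mulVec_zero, Pi.zero_apply, add_zero] at this
      exact mul_eq_zero.1 this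
    have e0 := hx' 0
    have e1 := hx' 1
    have e2 := hx' 2
    simp only [Fin.succ_zero_eq_one, Fin.succ_one_eq_two, Fin.reduceSucc] at e0 e1 e2
    have : ∃ j, ∀ k, k ≠ j → x k = 0 := by
      by_cases f0 : x 0 = 0
      · by_cases f1 : x 1 = 0
        · by_cases f2 : x 2 = 0
          · exact ⟨3, fun k hk => by fin_cases k <;> simp_all⟩
          · exact ⟨2, fun k hk => by fin_cases k <;> simp_all⟩
        · exact ⟨1, fun k hk => by fin_cases k <;> simp_all⟩
      · exact ⟨0, fun k hk => by fin_cases k <;> simp_all⟩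
    obtain ⟨j, hj⟩ := this
    refine ⟨j, x j, funext fun k => ?_⟩
    by_cases hk : k = j
    · simp [hk]
    · simp [hk, hj k hk]
  · right
    refine ⟨![x 2 * x 3, x 1 * x 3, x 1 * x 2], (x 1 * x 2 * x 3)⁻¹,
      fun i => (hb i).trans (hb 0).symm, ?_⟩
    rw [eq_inv_smul_iff₀ h]
    ext j
    have := hb 0
    fin_cases j <;> simp [baseLift] at this ⊢
    · linear_combination this
    · ring
    · ring
    · ring

theorem exists_balanced {N : Matrix (Fin 3) (Fin 3) ℂ}
    (hN : Smooth fun p => (netMatrix N p).det) :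
    ∃ y : Fin 4 → Fin 3 → ℂ, (∀ i, y i ≠ 0 ∧ IsBalanced N (y i)) ∧
      (∀ i j, i ≠ j → ∀ c : ℂ, y j ≠ c • y i) ∧
      (∀ c : Fin 3 → ℂ, c 0 • y 0 + c 1 • y 1 + c 2 • y 2 = 0 → c = 0) ∧
      ∀ w, IsBalanced N w → ∃ i, ∃ c : ℂ, w = c • y i := by
  set q : Fin 6 → ℂ := ![N 0 0, -N 1 1, 0, N 0 1 - N 1 0, N 0 2, -N 1 2] with hq
  set r : Fin 6 → ℂ := ![N 0 0, 0, -N 2 2, N 0 1, N 0 2 - N 2 0, -N 2 1] with hr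
  have hq' : ∀ w, ternaryQuadratic q w = w 0 * (N *ᵥ w) 0 - w 1 * (N *ᵥ w) 1 := fun w => by
    simp only [hq, ternaryQuadratic, cons_val, mulVec, dotProduct, Fin.sum_univ_three]
    ring
  have hr' : ∀ w, ternaryQuadratic r w = w 0 * (N *ᵥ w) 0 - w 2 * (N *ᵥ w) 2 := fun w => by
    simp only [hr, ternaryQuadratic, cons_val, mulVec, dotProduct, Fin.sum_univ_three]
    ring
  have hb : ∀ w, IsBalanced N w ↔ ternaryQuadratic q w = 0 ∧ ternaryQuadratic r w = 0 :=
    fun w => by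
      rw [hq', hr', sub_eq_zero, sub_eq_zero]
      refine ⟨fun h => ⟨(h 1).symm, (h 2).symm⟩, fun h i => ?_⟩
      fin_cases i
      · rfl
      · exact h.1.symm
      · exact h.2.symm
  simp only [hb]
  obtain ⟨y, h1, h2, h3, h4⟩ := exists_four_points (q := q) (r := r) fun y hy0 hqy hry s t h => by
    have := IsBalanced.transversal hN hy0 ((hb y).2 ⟨hqy, hry⟩) (t := ![s + t, -s, -t])
      (by simp) fun w => by
        have := h w
        rw [hq'] at hqy
        rw [hr'] at hry
        simp only [hq', hr', mulVec_add, Pi.add_apply] at this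
        simp only [Fin.sum_univ_three, cons_val]
        linear_combination this - s * hqy - t * hry
    exact ⟨by simpa using congrFun this 1, by simpa using congrFun this 2⟩
  exact ⟨y, h1, h2, h3, fun w hw => h4 w hw.1 hw.2⟩

theorem eq_smul_of_cremona_eq {n : ℕ} {y z : Fin n → ℂ} {a b c : ℂ} (ha : a ≠ 0)
    (h : a • y = c • b • z) : y = (a⁻¹ * (c * b)) • z := by
  rw [mul_smul, mul_smul, ← h, smul_smul, inv_mul_cancel₀ ha, one_smul]

theorem eq_zero_of_dotProduct_eq_zero {y : Fin 3 → Fin 3 → ℂ}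
    (hy : ∀ c : Fin 3 → ℂ, c 0 • y 0 + c 1 • y 1 + c 2 • y 2 = 0 → c = 0) {w : Fin 3 → ℂ}
    (hw : ∀ i, y i ⬝ᵥ w = 0) : w = 0 := by
  by_contra h0
  obtain ⟨c, hc0, hc⟩ := exists_vecMul_eq_zero_iff.2 <| exists_mulVec_eq_zero_iff.1
    ⟨w, h0, show of y *ᵥ w = 0 from funext hw⟩
  refine hc0 (hy c ?_)
  rw [← hc]
  ext j
  simp [vecMul, dotProduct, Fin.sum_univ_three]

/-- A symmetric matrix which vanishes on the coordinate points and on three suitable base points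
belongs to the net. -/
theorem exists_eq_netMatrix {N : Matrix (Fin 3) (Fin 3) ℂ}
    (hN : Smooth fun p => (netMatrix N p).det) {y : Fin 3 → Fin 3 → ℂ}
    (hy0 : ∀ i, y i ≠ 0) (hyb : ∀ i, IsBalanced N (y i))
    (hy : ∀ c : Fin 3 → ℂ, c 0 • y 0 + c 1 • y 1 + c 2 • y 2 = 0 → c = 0)
    {B : Matrix (Fin 4) (Fin 4) ℂ} (hB : B.IsSymm) (hd : ∀ j, B j j = 0)
    (hBy : ∀ i, baseLift N (y i) ⬝ᵥ B *ᵥ baseLift N (y i) = 0) : ∃ p, netMatrix N p = B := by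
  set p : Fin 3 → ℂ := ![B 0 1, B 0 2, B 0 3] with hp
  have h10 := hB.apply 0 1
  have h20 := hB.apply 0 2
  have h30 := hB.apply 0 3
  have h21 := hB.apply 1 2
  have h31 := hB.apply 1 3
  have h32 := hB.apply 2 3
  have hw : ![B 2 3 - (p ᵥ* N) 0, B 1 3 - (p ᵥ* N) 1, B 1 2 - (p ᵥ* N) 2] = 0 := by
    refine eq_zero_of_dotProduct_eq_zero hy fun i => ?_
    have h1 := hBy i
    have h2 := isBasePoint_iff.1 (hyb i).isBasePoint p
    have h3 := cremona_baseLift N (y i)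
    have hne := (hyb i).apply_ne_zero hN (hy0 i)
    have h4 : (y i 0 * y i 1 * y i 2) • y i ⬝ᵥ
        ![B 2 3 - (p ᵥ* N) 0, B 1 3 - (p ᵥ* N) 1, B 1 2 - (p ᵥ* N) 2] = 0 := by
      rw [← h3]
      generalize baseLift N (y i) = x at h1 h2
      have d0 := hd 0
      have d1 := hd 1
      have d2 := hd 2
      have d3 := hd 3
      simp only [netMatrix_apply, mulVec, dotProduct, Fin.sum_univ_four, Fin.sum_univ_three,
        of_apply, cons_val, hp, h10, h20, h30, h21, h31, h32, d0, d1, d2, d3] at h1 h2 ⊢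
      linear_combination (h1 - h2) / 2
    rw [smul_dotProduct, smul_eq_mul] at h4
    exact (mul_eq_zero.1 h4).resolve_left (mul_ne_zero (mul_ne_zero (hne 0) (hne 1)) (hne 2))
  have w0 := congrFun hw 0
  have w1 := congrFun hw 1
  have w2 := congrFun hw 2
  simp only [cons_val, Pi.zero_apply, sub_eq_zero] at w0 w1 w2
  refine ⟨p, ?_⟩
  rw [netMatrix_apply, ← w0, ← w1, ← w2]
  ext i j
  fin_cases i <;> fin_cases j <;> simp [hp, hd, h10, h20, h30, h21, h31, h32]

theorem exists_base_points {N : Matrix (Fin 3) (Fin 3) ℂ}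
    (hN : Smooth fun p => (netMatrix N p).det) :
    ∃ x : Fin 8 → Fin 4 → ℂ, (∀ i, x i ≠ 0) ∧ (∀ i j, i ≠ j → ∀ c : ℂ, x j ≠ c • x i) ∧
      (∀ i, IsBasePoint N (x i)) ∧ (∀ z, IsBasePoint N z → ∃ i, ∃ c : ℂ, z = c • x i) ∧
      ∀ B : Matrix (Fin 4) (Fin 4) ℂ, B.IsSymm →
        (∀ i : Fin 7, x i.castSucc ⬝ᵥ B *ᵥ x i.castSucc = 0) → ∃ p, netMatrix N p = B := by
  obtain ⟨y, hy, hne, hind, hall⟩ := exists_balanced hN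
  have hy' : ∀ i k, y i k ≠ 0 := fun i => (hy i).2.apply_ne_zero hN (hy i).1
  have hother : ∀ j : Fin 4, ∃ k, k ≠ j ∧ k ≠ 0 := by decide
  let x : Fin (4 + 4) → Fin 4 → ℂ :=
    Fin.append (fun j => Pi.single j 1) fun k => baseLift N (y k)
  have hxl : ∀ j : Fin 4, x (Fin.castAdd 4 j) = Pi.single j 1 := fun j => Fin.append_left _ _ j
  have hxr : ∀ k : Fin 4, x (Fin.natAdd 4 k) = baseLift N (y k) := fun k => Fin.append_right _ _ k
  refine ⟨x, fun i => ?_, fun i j => ?_, fun i => ?_, fun z hz => ?_, fun B hB h => ?_⟩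
  · refine Fin.addCases (m := 4) (n := 4) (fun i => ?_) (fun i => ?_) i
    · rw [hxl]
      simp
    · rw [hxr]
      exact fun h => baseLift_ne_zero (N := N) (hy' i) one_ne_zero (congrFun h 1)
  · refine Fin.addCases (m := 4) (n := 4) (fun i => ?_) (fun i => ?_) i <;>
      refine Fin.addCases (m := 4) (n := 4) (fun j => ?_) (fun j => ?_) j <;> intro hij c h
    · rw [hxl, hxl] at h
      have hij' : j ≠ i := by
        rintro rfl
        exact hij rfl
      simpa [hij'] using congrFun h j
    · rw [hxl, hxr] at h
      obtain ⟨k, hki, hk0⟩ := hother i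
      refine baseLift_ne_zero (N := N) (hy' j) hk0 ?_
      rw [h, Pi.smul_apply, Pi.single_eq_of_ne hki, smul_zero]
    · rw [hxl, hxr] at h
      obtain ⟨k, hkj, hk0⟩ := hother j
      have hc := congrFun h k
      rw [Pi.single_eq_of_ne hkj, Pi.smul_apply, smul_eq_mul, eq_comm, mul_eq_zero,
        or_iff_left (baseLift_ne_zero (hy' i) hk0)] at hc
      rw [hc, zero_smul] at h
      simpa using congrFun h j
    · rw [hxr, hxr] at h
      have hij' : i ≠ j := by
        rintro rfl
        exact hij rfl
      refine hne i j hij' _ (eq_smul_of_cremona_eq (a := y j 0 * y j 1 * y j 2) (c := c ^ 2)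
        (b := y i 0 * y i 1 * y i 2)
        (mul_ne_zero (mul_ne_zero (hy' j 0) (hy' j 1)) (hy' j 2)) ?_)
      rw [← cremona_baseLift N, ← cremona_baseLift N, h]
      ext k
      fin_cases k <;> simp <;> ring
  · refine Fin.addCases (m := 4) (n := 4) (fun i => ?_) (fun i => ?_) i
    · rw [hxl]
      intro k
      fin_cases i <;> fin_cases k <;> simp [mulVec, dotProduct, Fin.sum_univ_three]
    · rw [hxr]
      exact (hy i).2.isBasePoint
  · rcases hz.eq_smul hN with ⟨j, c, rfl⟩ | ⟨w, c, hw, rfl⟩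
    · exact ⟨Fin.castAdd 4 j, c, by rw [hxl]⟩
    · obtain ⟨i, d, rfl⟩ := hall w hw
      exact ⟨Fin.natAdd 4 i, c * d ^ 2, by rw [hxr, baseLift_smul, smul_smul]⟩
  · refine exists_eq_netMatrix hN (y := fun i : Fin 3 => y i.castSucc) (fun i => (hy _).1)
      (fun i => (hy _).2) hind hB (fun j => ?_) fun i => ?_
    · have := h (Fin.castLE (by norm_num) j)
      rw [show (Fin.castLE (by norm_num) j : Fin 7).castSucc = Fin.castAdd 4 j from rfl,
        hxl] at this
      simpa using this
    · rw [← hxr]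
      exact h (Fin.natAdd 4 i)

theorem exists_regular_net {f : (Fin 3 → ℂ) → ℂ} (hf : IsForm 3 4 f) (hs : Smooth f) :
    ∃ (g : (Fin 3 → ℂ) ≃ₗ[ℂ] (Fin 3 → ℂ)) (N : Matrix (Fin 3) (Fin 3) ℂ),
      ∀ p, f (g p) = (netMatrix N p).det := by
  obtain ⟨g, hg, a, b, c, d, e, h, H⟩ := exists_six_linear_forms hf hs
  have hs' := hs.comp hg
  set l : (Fin 3 → ℂ) →ₗ[ℂ] (Fin 3 → ℂ) := (of ![a, b, c]).mulVecLin with hl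
  have hl' : ∀ p, l p = ![a ⬝ᵥ p, b ⬝ᵥ p, c ⬝ᵥ p] := fun p => by
    ext i
    fin_cases i <;> rfl
  have hinj : Function.Injective l := by
    rw [injective_iff_map_eq_zero]
    intro p hp
    rw [hl'] at hp
    have ha := congrFun hp 0
    have hb := congrFun hp 1
    have hc := congrFun hp 2
    simp only [cons_val, Pi.zero_apply] at ha hb hc
    refine hs' p fun v => ?_
    refine ⟨((a ⬝ᵥ v) * (h ⬝ᵥ p) - (b ⬝ᵥ v) * (e ⬝ᵥ p) - (c ⬝ᵥ v) * (d ⬝ᵥ p)) ^ 2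
        - 4 * ((b ⬝ᵥ v) * (e ⬝ᵥ p)) * ((c ⬝ᵥ v) * (d ⬝ᵥ p)),
      2 * ((a ⬝ᵥ v) * (h ⬝ᵥ p) - (b ⬝ᵥ v) * (e ⬝ᵥ p) - (c ⬝ᵥ v) * (d ⬝ᵥ p)) *
        ((a ⬝ᵥ v) * (h ⬝ᵥ v) - (b ⬝ᵥ v) * (e ⬝ᵥ v) - (c ⬝ᵥ v) * (d ⬝ᵥ v))
        - 4 * (b ⬝ᵥ v) * (c ⬝ᵥ v) * ((e ⬝ᵥ p) * (d ⬝ᵥ v) + (e ⬝ᵥ v) * (d ⬝ᵥ p)),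
      ((a ⬝ᵥ v) * (h ⬝ᵥ v) - (b ⬝ᵥ v) * (e ⬝ᵥ v) - (c ⬝ᵥ v) * (d ⬝ᵥ v)) ^ 2
        - 4 * ((b ⬝ᵥ v) * (e ⬝ᵥ v)) * ((c ⬝ᵥ v) * (d ⬝ᵥ v)), fun t => ?_⟩
    show f (g _) = _
    rw [H]
    simp only [dotProduct_add, dotProduct_smul, smul_eq_mul, ha, hb, hc]
    ring
  let L := LinearEquiv.ofInjectiveEndo l hinj
  let G := LinearEquiv.ofInjectiveEndo g hg
  have hK : ∀ p, l (L.symm p) = p := fun p => L.apply_symm_apply p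
  refine ⟨L.symm.trans G, (LinearMap.toMatrix' (L.symm : (Fin 3 → ℂ) →ₗ[ℂ] (Fin 3 → ℂ)))ᵀ *
    (of ![h, e, d])ᵀ, fun p => ?_⟩
  have hpN : p ᵥ* ((LinearMap.toMatrix' (L.symm : (Fin 3 → ℂ) →ₗ[ℂ] (Fin 3 → ℂ)))ᵀ *
      (of ![h, e, d])ᵀ) = ![h ⬝ᵥ L.symm p, e ⬝ᵥ L.symm p, d ⬝ᵥ L.symm p] := by
    rw [← vecMul_vecMul, vecMul_transpose, vecMul_transpose, LinearMap.toMatrix'_mulVec]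
    ext i
    fin_cases i <;> rfl
  have hp := hK p
  rw [hl'] at hp
  rw [det_netMatrix, hpN]
  show f (g (L.symm p)) = _
  rw [H]
  generalize L.symm p = s at hp
  rw [← hp]
  simp only [heronForm, cons_val]
  ring

theorem exists_taylor_pderiv {n : ℕ} (F : MvPolynomial (Fin n) ℂ) (p : Fin n → ℂ) (k : Fin n) :
    ∃ Q : Polynomial ℂ, ∀ t : ℂ, eval (p + t • Pi.single k 1) F =
      eval p F + t * eval p (pderiv k F) + t ^ 2 * Q.eval t := by
  induction F using MvPolynomial.induction_on with
  | C a => exact ⟨0, fun t => by simp⟩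
  | add F G hF hG =>
    obtain ⟨Q, hQ⟩ := hF
    obtain ⟨R, hR⟩ := hG
    refine ⟨Q + R, fun t => ?_⟩
    simp only [map_add, hQ, hR, Polynomial.eval_add]
    ring
  | mul_X F i hF =>
    obtain ⟨Q, hQ⟩ := hF
    refine ⟨Polynomial.C (eval p (pderiv k F) * (Pi.single k 1 : Fin n → ℂ) i) +
      Q * Polynomial.C (p i) + Q * Polynomial.X * Polynomial.C ((Pi.single k 1 : Fin n → ℂ) i),
      fun t => ?_⟩
    simp only [map_mul, hQ, Derivation.leibniz, pderiv_X, eval_X, Pi.add_apply, Pi.smul_apply,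
      smul_eq_mul, map_add, Polynomial.eval_add, Polynomial.eval_mul, Polynomial.eval_C,
      Polynomial.eval_X]
    by_cases h : i = k
    · subst h
      simp
      ring
    · simp [h]
      ring

theorem smooth_of_pderiv {F : MvPolynomial (Fin 3) ℂ}
    (hF : ¬ ∃ p : Fin 3 → ℂ, p ≠ 0 ∧ eval p F = 0 ∧ ∀ k : Fin 3, eval p (pderiv k F) = 0) :
    Smooth fun p => eval p F := by
  intro p hp
  by_contra hp0
  refine hF ⟨p, hp0, ?_, fun k => ?_⟩
  · obtain ⟨a, b, c, h⟩ := hp 0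
    simpa using h 0
  · obtain ⟨a, b, c, h⟩ := hp (Pi.single k 1)
    obtain ⟨Q, hQ⟩ := exists_taylor_pderiv F p k
    have h0 : eval p F = 0 := by simpa using h 0
    have : Polynomial.C (eval p (pderiv k F)) * Polynomial.X + Q * Polynomial.X ^ 2 =
        Polynomial.C a * Polynomial.X ^ 2 + Polynomial.C b * Polynomial.X ^ 3 +
          Polynomial.C c * Polynomial.X ^ 4 := Polynomial.funext fun t => by
      have h1 := h t
      simp only [hQ, h0] at h1
      simp only [Polynomial.eval_add, Polynomial.eval_mul, Polynomial.eval_C, Polynomial.eval_X,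
        Polynomial.eval_pow]
      linear_combination h1
    simpa [Polynomial.coeff_X_pow, Polynomial.coeff_mul_X_pow'] using
      congrArg (fun P => Polynomial.coeff P 1) this

theorem span_range_comp_single {M : Type*} [AddCommGroup M] [Module ℂ M]
    (φ : (Fin 3 → ℂ) →ₗ[ℂ] M) :
    Submodule.span ℂ (Set.range fun k => φ (Pi.single k 1)) = LinearMap.range φ := by
  have h := (Pi.basisFun ℂ (Fin 3)).span_eq
  rw [LinearMap.range_eq_map, ← h, Submodule.map_span, ← Set.range_comp]
  congr 2
  ext k
  simp

/-- Every smooth plane quartic arises as the Hessian quartic of the net of quadrics through an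
Aronhold heptad in `ℙ³`. -/
theorem stmt_6 (F : MvPolynomial (Fin 3) ℂ) (hF4 : F.IsHomogeneous 4)
    (hFsmooth : ¬ ∃ p : Fin 3 → ℂ, p ≠ 0 ∧ eval p F = 0 ∧
      ∀ k : Fin 3, eval p (pderiv k F) = 0) :
    ∃ v : Fin 7 → (Fin 4 → ℂ), ∃ A : Fin 3 → Matrix (Fin 4) (Fin 4) ℂ,
      (∀ i, v i ≠ 0) ∧
      (∀ i j : Fin 7, i ≠ j → ∀ c : ℂ, v j ≠ c • v i) ∧
      (∀ k, (A k).IsSymm) ∧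
      LinearIndependent ℂ A ∧
      (∀ B : Matrix (Fin 4) (Fin 4) ℂ,
        (B.IsSymm ∧ ∀ i, v i ⬝ᵥ B *ᵥ v i = 0) ↔ B ∈ Submodule.span ℂ (Set.range A)) ∧
      (∀ B ∈ Submodule.span ℂ (Set.range A), B ≠ 0 → 3 ≤ B.rank) ∧
      (∃ p : Fin 8 → Projectivization ℂ (Fin 4 → ℂ), Function.Injective p ∧
        {x : Projectivization ℂ (Fin 4 → ℂ) |
          ∀ B ∈ Submodule.span ℂ (Set.range A), x.rep ⬝ᵥ B *ᵥ x.rep = 0} = Set.range p) ∧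
      Matrix.det (Matrix.of fun i j : Fin 4 =>
        X 0 * C (A 0 i j) + X 1 * C (A 1 i j) + X 2 * C (A 2 i j)) = F := by
  have hs := smooth_of_pderiv hFsmooth
  obtain ⟨g, N, hgN⟩ := exists_regular_net (f := fun p => eval p F) ⟨F, hF4, fun _ => rfl⟩ hs
  have hN : Smooth fun p => (netMatrix N p).det := by
    simp only [← hgN]
    exact hs.comp (g := (g : (Fin 3 → ℂ) →ₗ[ℂ] (Fin 3 → ℂ))) g.injective
  obtain ⟨x, hx0, hx, hxb, hxall, hxB⟩ := exists_base_points hN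
  set φ : (Fin 3 → ℂ) →ₗ[ℂ] Matrix (Fin 4) (Fin 4) ℂ :=
    netMatrix N ∘ₗ (g.symm : (Fin 3 → ℂ) →ₗ[ℂ] (Fin 3 → ℂ)) with hφ
  have hspan : ∀ B, B ∈ Submodule.span ℂ (Set.range fun k => φ (Pi.single k 1)) ↔
      ∃ p, netMatrix N p = B := fun B => by
    rw [span_range_comp_single, LinearMap.mem_range]
    exact (g.symm.surjective.exists (p := fun p => netMatrix N p = B)).symm
  refine ⟨fun i => x i.castSucc, fun k => φ (Pi.single k 1), fun i => hx0 _,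
    fun i j hij => hx _ _ ?_, fun k => netMatrix_isSymm N _, ?_, fun B => ?_,
    fun B hB hB0 => ?_, ?_, ?_⟩
  · exact fun h => hij (Fin.castSucc_injective 7 h)
  · have h := (Pi.basisFun ℂ (Fin 3)).linearIndependent.map' φ (LinearMap.ker_eq_bot.2
      ((netMatrix_injective N).comp g.symm.injective))
    rwa [show φ ∘ Pi.basisFun ℂ (Fin 3) = fun k => φ (Pi.single k 1) by ext; simp] at h
  · rw [hspan]
    refine ⟨fun h => hxB B h.1 h.2, ?_⟩
    rintro ⟨p, rfl⟩
    exact ⟨netMatrix_isSymm N p, fun i => isBasePoint_iff.1 (hxb _) p⟩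
  · obtain ⟨p, rfl⟩ := (hspan B).1 hB
    refine rank_netMatrix hN ?_
    rintro rfl
    exact hB0 (map_zero _)
  · refine ⟨fun i => Projectivization.mk ℂ (x i) (hx0 i), fun i j h => ?_, ?_⟩
    · by_contra hij
      obtain ⟨c, hc⟩ := (Projectivization.mk_eq_mk_iff' ℂ _ _ (hx0 j) (hx0 i)).1 h.symm
      exact hx i j hij c hc.symm
    · ext z
      have hz : (∀ B ∈ Submodule.span ℂ (Set.range fun k => φ (Pi.single k 1)),
          z.rep ⬝ᵥ B *ᵥ z.rep = 0) ↔ IsBasePoint N z.rep := by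
        rw [isBasePoint_iff]
        refine ⟨fun h p => h _ ((hspan _).2 ⟨p, rfl⟩), fun h B hB => ?_⟩
        obtain ⟨p, rfl⟩ := (hspan B).1 hB
        exact h p
      rw [Set.mem_ofPred_eq, hz]
      constructor
      · intro h
        obtain ⟨i, c, hc⟩ := hxall _ h
        refine ⟨i, ?_⟩
        rw [← z.mk_rep]
        exact ((Projectivization.mk_eq_mk_iff' ℂ _ _ z.rep_nonzero (hx0 i)).2 ⟨c, hc.symm⟩).symm
      · rintro ⟨i, rfl⟩
        obtain ⟨c, hc⟩ := (Projectivization.mk_eq_mk_iff' ℂ _ _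
          (Projectivization.rep_nonzero _) (hx0 i)).1
          (Projectivization.mk_rep (Projectivization.mk ℂ (x i) (hx0 i)))
        rw [← hc, isBasePoint_iff]
        intro p
        rw [mulVec_smul, dotProduct_smul, smul_dotProduct, isBasePoint_iff.1 (hxb i) p]
        simp
  · refine MvPolynomial.funext fun p => ?_
    rw [RingHom.map_det]
    have hp : p = g (g.symm p) := (g.apply_symm_apply p).symm
    have h := hgN (g.symm p)
    rw [← hp] at h
    rw [h]
    congr 1
    have hφp : netMatrix N (g.symm p) =
        p 0 • φ (Pi.single 0 1) + p 1 • φ (Pi.single 1 1) + p 2 • φ (Pi.single 2 1) := by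
      rw [← map_smul, ← map_smul, ← map_smul, ← map_add, ← map_add]
      show φ p = _
      congr 1
      ext i
      fin_cases i <;> simp
    rw [hφp]
    ext i j
    simp
end

section
/- Let A and B be linearly independent symmetric 4×4 complex matrices (defining two distinct quadric surfaces in ℙ³). Then the following are equivalent: (a) the intersection of the two quadrics is smooth of codimension 2, i.e., for every nonzero v ∈ ℂ⁴ with vᵀAv = 0 and vᵀBv = 0, the vectors Av and Bv are linearly independent over ℂ; (b) the binary quartic det(x·A + y·B) ∈ ℂ[x,y] is nonzero and squarefree, i.e., the line through A and B in the projective space of symmetric 4×4 matrices meets the determinantal hypersurface det = 0 in exactly four distinct points; (c) there exist P ∈ GL₄(ℂ), an invertible 2×2 matrix with entries a, b, c, d, and pairwise distinct λ₀, λ₁, λ₂, λ₃ ∈ ℂ such that Pᵀ(aA + bB)P is the identity matrix and Pᵀ(cA + dB)P = diag(λ₀, λ₁, λ₂, λ₃) (after a suitable linear change of coordinates the intersection is defined by x₀² + x₁² + x₂² + x₃² = 0 and λ₀x₀² + λ₁x₁² + λ₂x₂² + λ₃x₃² = 0 with distinct λᵢ). -/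
open Matrix MvPolynomial

/-- The one-variable pencil `M + t N` of matrices, over the polynomial ring in `t`. -/
noncomputable def polyPencil {n : Type*} (M N : Matrix n n ℂ) : Matrix n n (Polynomial ℂ) :=
  M.map Polynomial.C + (Polynomial.X : Polynomial ℂ) • N.map Polynomial.C

theorem polyPencil_apply {n : Type*} (M N : Matrix n n ℂ) (i j : n) :
    polyPencil M N i j = Polynomial.C (M i j) + Polynomial.X * Polynomial.C (N i j) := by
  simp [polyPencil]

theorem eval_det_polyPencil {n : Type*} [Fintype n] [DecidableEq n] (M N : Matrix n n ℂ) (t : ℂ) :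
    (polyPencil M N).det.eval t = (M + t • N).det := by
  rw [← Polynomial.coe_evalRingHom, RingHom.map_det]
  congr 1
  ext i j
  simp [polyPencil_apply]
  ring

theorem polyPencil_conj {n : Type*} [Fintype n] [DecidableEq n] (Q M N : Matrix n n ℂ) :
    (polyPencil (Qᵀ * M * Q) (Qᵀ * N * Q)).det
      = Polynomial.C (Q.det ^ 2) * (polyPencil M N).det := by
  have h : polyPencil (Qᵀ * M * Q) (Qᵀ * N * Q)
      = (Q.map Polynomial.C)ᵀ * polyPencil M N * Q.map Polynomial.C := by
    simp only [polyPencil, Matrix.map_mul, Matrix.mul_add, Matrix.add_mul, Matrix.mul_smul,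
      Matrix.smul_mul, Matrix.transpose_map]
  have hd : (Q.map Polynomial.C).det = Polynomial.C Q.det := (RingHom.map_det Polynomial.C Q).symm
  rw [h, det_mul, det_mul, det_transpose, hd, map_pow]
  ring

theorem exists_isotropic_of_linearIndependent {n : Type*} [Fintype n] (N : Matrix n n ℂ)
    {v w : n → ℂ} (h : LinearIndependent ℂ ![v, w]) :
    ∃ s t : ℂ, s • v + t • w ≠ 0 ∧
      (s • v + t • w) ⬝ᵥ N *ᵥ (s • v + t • w) = 0 := by
  rw [LinearIndependent.pair_iff] at h
  by_cases hv : v ⬝ᵥ N *ᵥ v = 0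
  · refine ⟨1, 0, fun h0 => ?_, by simpa using hv⟩
    exact one_ne_zero (h 1 0 h0).1
  · obtain ⟨s, hs⟩ := exists_quadratic_eq_zero (b := v ⬝ᵥ N *ᵥ w + w ⬝ᵥ N *ᵥ v)
      (c := w ⬝ᵥ N *ᵥ w) hv (by
        obtain ⟨z, hz⟩ := IsAlgClosed.exists_pow_nat_eq
          (discrim (v ⬝ᵥ N *ᵥ v) (v ⬝ᵥ N *ᵥ w + w ⬝ᵥ N *ᵥ v) (w ⬝ᵥ N *ᵥ w)) two_pos
        exact ⟨z, by rw [← hz, sq]⟩)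
    refine ⟨s, 1, fun h0 => one_ne_zero (h s 1 h0).2, ?_⟩
    simp only [one_smul, mulVec_add, mulVec_smul, dotProduct_add, add_dotProduct, smul_dotProduct,
      dotProduct_smul, smul_eq_mul]
    linear_combination hs

theorem exists_isotropic_ker_aux {n : ℕ} (M N : Matrix (Fin (n + 1)) (Fin (n + 1)) ℂ)
    (k : Fin (n + 1)) (hrow : ∀ j, M k j = 0) (hcol : ∀ i, M i k = 0)
    (h : Polynomial.X ^ 2 ∣ (polyPencil M N).det) :
    ∃ x : Fin (n + 1) → ℂ, x ≠ 0 ∧ M *ᵥ x = 0 ∧ x ⬝ᵥ N *ᵥ x = 0 := by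
  classical
  by_cases hkk : N k k = 0
  · refine ⟨Pi.single k 1, by simp, ?_, by simp [hkk]⟩
    ext i
    simp [hcol]
  have hsub : (M.submatrix k.succAbove k.succAbove).det = 0 := by
    rw [det_succ_row _ k, Fin.sum_univ_succAbove _ k] at h
    have h2 : Polynomial.X ^ 2 ∣ ∑ i : Fin n, (-1) ^ ((k : ℕ) + (k.succAbove i : ℕ))
        * polyPencil M N k (k.succAbove i) *
          ((polyPencil M N).submatrix k.succAbove (k.succAbove i).succAbove).det := by
      refine Finset.dvd_sum fun i _ => ?_
      have hX : Polynomial.X ∣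
          ((polyPencil M N).submatrix k.succAbove (k.succAbove i).succAbove).det := by
        obtain ⟨l, hl⟩ := Fin.exists_succAbove_eq (Fin.succAbove_ne k i).symm
        rw [det_eq_sum_mul_adjugate_col _ l]
        refine Finset.dvd_sum fun r _ => Dvd.dvd.mul_right ?_ _
        simp [polyPencil_apply, hl, hcol]
      rw [sq, polyPencil_apply, hrow]
      refine mul_dvd_mul (Dvd.dvd.mul_left ?_ _) hX
      simp
    have h1 := (dvd_add_left h2).1 h
    rw [polyPencil_apply, hrow, map_zero, zero_add, ← two_mul, pow_mul, neg_one_sq, one_pow, one_mul,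
      sq, mul_assoc, mul_dvd_mul_iff_left Polynomial.X_ne_zero, Polynomial.X_dvd_iff,
      Polynomial.coeff_zero_eq_eval_zero, Polynomial.eval_mul, Polynomial.eval_C] at h1
    have h3 := (mul_eq_zero.1 h1).resolve_left hkk
    have h4 : (polyPencil M N).submatrix k.succAbove k.succAbove
        = polyPencil (M.submatrix k.succAbove k.succAbove)
          (N.submatrix k.succAbove k.succAbove) := rfl
    rw [h4, eval_det_polyPencil] at h3
    simpa using h3
  obtain ⟨u, hu0, hu⟩ := exists_mulVec_eq_zero_iff.2 hsub
  set w : Fin (n + 1) → ℂ := k.insertNth 0 u with hw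
  have hMw : M *ᵥ w = 0 := by
    ext i
    rcases Fin.eq_self_or_eq_succAbove k i with rfl | ⟨i, rfl⟩
    · simp [mulVec, dotProduct, hrow]
    · have := congrFun hu i
      simpa [mulVec, dotProduct, Fin.sum_univ_succAbove _ k, hcol, hw] using this
  have hMv : M *ᵥ (Pi.single k 1) = 0 := by
    ext i
    simp [hcol]
  have hli : LinearIndependent ℂ ![(Pi.single k 1 : Fin (n + 1) → ℂ), w] := by
    rw [LinearIndependent.pair_iff]
    intro s t hst
    have hs : s = 0 := by simpa [hw] using congrFun hst k
    refine ⟨hs, ?_⟩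
    by_contra ht
    refine hu0 (funext fun i => ?_)
    simpa [hw, ht] using congrFun hst (k.succAbove i)
  obtain ⟨s, t, h0, hq⟩ := exists_isotropic_of_linearIndependent N hli
  exact ⟨_, h0, by simp [mulVec_add, mulVec_smul, hMw, hMv], hq⟩

theorem dotProduct_conj_mulVec {n : Type*} [Fintype n] (Q N : Matrix n n ℂ) (y : n → ℂ) :
    y ⬝ᵥ (Qᵀ * N * Q) *ᵥ y = (Q *ᵥ y) ⬝ᵥ N *ᵥ (Q *ᵥ y) := by
  rw [← mulVec_mulVec, ← mulVec_mulVec, dotProduct_mulVec, vecMul_transpose]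

/-- If `0` is a multiple root of `det (M + t N)`, then some nonzero kernel vector of `M` is
isotropic for `N`. -/
theorem exists_isotropic_ker {n : ℕ} {M : Matrix (Fin (n + 1)) (Fin (n + 1)) ℂ} (hM : M.IsSymm)
    (N : Matrix (Fin (n + 1)) (Fin (n + 1)) ℂ)
    (h : Polynomial.X ^ 2 ∣ (polyPencil M N).det) :
    ∃ x : Fin (n + 1) → ℂ, x ≠ 0 ∧ M *ᵥ x = 0 ∧ x ⬝ᵥ N *ᵥ x = 0 := by
  have hdet : M.det = 0 := by
    have h0 := Polynomial.X_dvd_iff.1 ((dvd_pow_self Polynomial.X two_ne_zero).trans h)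
    rw [Polynomial.coeff_zero_eq_eval_zero, eval_det_polyPencil] at h0
    simpa using h0
  obtain ⟨v, hv0, hv⟩ := exists_mulVec_eq_zero_iff.2 hdet
  obtain ⟨k, hk⟩ := Function.ne_iff.1 hv0
  set Q : Matrix (Fin (n + 1)) (Fin (n + 1)) ℂ := (1 : Matrix _ _ ℂ).updateCol k v with hQ
  have hQdet : IsUnit Q.det := by
    have : Q.det = v k := by
      have := cramer_apply (1 : Matrix (Fin (n + 1)) (Fin (n + 1)) ℂ) v k
      rw [hQ, ← this, cramer_one]
      rfl
    rw [this]
    exact isUnit_iff_ne_zero.2 hk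
  have hQk : Q *ᵥ Pi.single k 1 = v := by
    ext i
    simp [hQ]
  have hcol : ∀ i, (Qᵀ * M * Q) i k = 0 := fun i => by
    have : (Qᵀ * M * Q) *ᵥ Pi.single k 1 = 0 := by
      rw [← mulVec_mulVec, ← mulVec_mulVec, hQk, hv, mulVec_zero]
    simpa using congrFun this i
  have hsymm : (Qᵀ * M * Q).IsSymm := by
    simp [IsSymm, transpose_mul, hM.eq, Matrix.mul_assoc]
  obtain ⟨y, hy0, hy, hyq⟩ := exists_isotropic_ker_aux (Qᵀ * M * Q) (Qᵀ * N * Q) k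
    (fun j => by rw [← hsymm.apply, hcol]) hcol (by
      rw [polyPencil_conj]
      exact Dvd.dvd.mul_left h _)
  refine ⟨Q *ᵥ y, fun h0 => hy0 ?_, ?_, by rw [← dotProduct_conj_mulVec, hyq]⟩
  · exact mulVec_injective_of_isUnit ((isUnit_iff_isUnit_det Q).2 hQdet) (by simpa using h0)
  · refine mulVec_injective_of_isUnit (A := Qᵀ)
      ((isUnit_iff_isUnit_det _).2 (by rwa [det_transpose])) ?_
    simpa [← mulVec_mulVec] using hy

/-- The determinant of `u M + v N` is a binary form in `u` and `v`. -/
theorem exists_det_smul_add_smul_eq {n : ℕ} (M N : Matrix (Fin n) (Fin n) ℂ) :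
    ∃ c : ℕ → ℂ, ∀ (R : Type) [CommRing R] [Algebra ℂ R] (u v : R),
      (u • M.map (algebraMap ℂ R) + v • N.map (algebraMap ℂ R)).det
        = ∑ k ∈ Finset.range (n + 1), algebraMap ℂ R (c k) * (u ^ (n - k) * v ^ k) := by
  refine ⟨fun k => ∑ s : Finset (Fin n), if n - s.card = k then
    detRowAlternating (s.piecewise M N) else 0, fun R _ _ u v => ?_⟩
  have key : ∀ s : Finset (Fin n),
      detRowAlternating (s.piecewise (u • M.map (algebraMap ℂ R)) (v • N.map (algebraMap ℂ R)))
      = algebraMap ℂ R (detRowAlternating (s.piecewise M N))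
        * (u ^ s.card * v ^ (n - s.card)) := by
    intro s
    have h1 : s.piecewise (u • M.map (algebraMap ℂ R)) (v • N.map (algebraMap ℂ R))
        = fun i => (s.piecewise (fun _ => u) (fun _ => v) : Fin n → R) i •
          ((Matrix.of (s.piecewise M N)).map (algebraMap ℂ R)) i := by
      funext i j
      by_cases hi : i ∈ s <;> simp [Finset.piecewise, hi]
    rw [h1]
    erw [MultilinearMap.map_smul_univ]
    rw [Finset.prod_piecewise]
    have h2 : (detRowAlternating ((Matrix.of (s.piecewise M N)).map (algebraMap ℂ R)) : R)
      = algebraMap ℂ R (detRowAlternating (s.piecewise M N)) :=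
        (RingHom.map_det (algebraMap ℂ R) (Matrix.of (s.piecewise M N))).symm
    erw [h2]
    simp [Finset.card_sdiff, mul_comm]
  have h3 : (u • M.map (algebraMap ℂ R) + v • N.map (algebraMap ℂ R)).det
      = ∑ s : Finset (Fin n), detRowAlternating
        (s.piecewise (u • M.map (algebraMap ℂ R)) (v • N.map (algebraMap ℂ R))) :=
    MultilinearMap.map_add_univ detRowAlternating.toMultilinearMap _ _
  rw [h3]
  simp_rw [key, map_sum, Finset.sum_mul]
  rw [Finset.sum_comm]
  refine Finset.sum_congr rfl fun s _ => ?_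
  have hs : s.card ≤ n := by simpa using s.card_le_univ
  rw [Finset.sum_eq_single (n - s.card)]
  · simp [Nat.sub_sub_self hs]
  · intro b _ hb
    simp [hb.symm]
  · intro hb
    exact absurd (Finset.mem_range.2 (by omega)) hb

/-- A multiple root at `t = 0` of `det (M + t N)` makes the binary form `det (u M + v N)`
divisible by `v ^ 2`. -/
theorem sq_dvd_det_smul_add_smul {n : ℕ} {M N : Matrix (Fin n) (Fin n) ℂ}
    (h : Polynomial.X ^ 2 ∣ (polyPencil M N).det) {R : Type} [CommRing R] [Algebra ℂ R] (u v : R) :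
    v ^ 2 ∣ (u • M.map (algebraMap ℂ R) + v • N.map (algebraMap ℂ R)).det := by
  obtain ⟨c, hc⟩ := exists_det_smul_add_smul_eq M N
  have h1 := hc (Polynomial ℂ) 1 Polynomial.X
  rw [one_smul] at h1
  change (polyPencil M N).det = _ at h1
  rw [hc R u v]
  refine Finset.dvd_sum fun k hk => ?_
  rcases lt_or_ge k 2 with hk2 | hk2
  · have h2 := Polynomial.X_pow_dvd_iff.1 h k hk2
    rw [h1] at h2
    have h3 : c k = 0 := by
      simpa [Polynomial.finsetSum_coeff, Polynomial.coeff_X_pow, hk, ← Polynomial.C_eq_algebraMap,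
        Finset.mem_range.1 hk]
        using h2
    simp [h3]
  · exact Dvd.dvd.mul_left (Dvd.dvd.mul_left (pow_dvd_pow v hk2) _) _

theorem nodup_roots_charpoly_inv_mul {n : Type*} [Fintype n] [DecidableEq n] {M N : Matrix n n ℂ}
    (hM : M.det ≠ 0) (h : ∀ t : ℂ, ¬ Polynomial.X ^ 2 ∣ (polyPencil (t • M - N) M).det) :
    (M⁻¹ * N).charpoly.roots.Nodup := by
  classical
  rw [Multiset.nodup_iff_count_le_one]
  intro t
  by_contra! ht
  rw [Polynomial.count_roots] at ht
  refine h t ?_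
  have hcomp : (polyPencil (t • M - N) M).det
      = Polynomial.C M.det * (M⁻¹ * N).charpoly.comp (Polynomial.X + Polynomial.C t) := by
    refine Polynomial.funext fun s => ?_
    rw [eval_det_polyPencil, Polynomial.eval_mul, Polynomial.eval_C, Polynomial.eval_comp,
      eval_charpoly, ← det_mul]
    congr 1
    rw [Matrix.mul_sub, mul_nonsing_inv_cancel_left _ _ (isUnit_iff_ne_zero.2 hM)]
    simp only [Polynomial.eval_add, Polynomial.eval_X, Polynomial.eval_C, scalar_apply,
      ← smul_one_eq_diagonal, add_smul, Matrix.mul_add, Matrix.mul_smul, Matrix.mul_one]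
    abel
  rw [hcomp]
  refine Dvd.dvd.mul_left ?_ _
  obtain ⟨q, hq⟩ :=
    (Polynomial.le_rootMultiplicity_iff (charpoly_monic (M⁻¹ * N)).ne_zero).1 (Nat.succ_le_of_lt ht)
  rw [hq]
  simp

/-- Two symmetric matrices `M`, `N`, with `M` invertible and all roots of `det (t M - N)` simple,
are simultaneously congruent to the identity and to a diagonal matrix with distinct entries. -/
theorem exists_conj_one_diagonal {n : ℕ} {M N : Matrix (Fin n) (Fin n) ℂ}
    (hMs : M.IsSymm) (hNs : N.IsSymm) (hM : M.det ≠ 0)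
    (h : ∀ t : ℂ, ¬ Polynomial.X ^ 2 ∣ (polyPencil (t • M - N) M).det) :
    ∃ P : Matrix (Fin n) (Fin n) ℂ, IsUnit P ∧ ∃ lam : Fin n → ℂ, Function.Injective lam ∧
      Pᵀ * M * P = 1 ∧ Pᵀ * N * P = diagonal lam := by
  classical
  have hcard : (M⁻¹ * N).charpoly.roots.toFinset.card = n := by
    rw [Multiset.toFinset_card_of_nodup (nodup_roots_charpoly_inv_mul hM h),
      ← (IsAlgClosed.splits _).natDegree_eq_card_roots, charpoly_natDegree_eq_dim, Fintype.card_fin]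
  let e := (Finset.equivFinOfCardEq hcard).symm
  let lam : Fin n → ℂ := fun i => e i
  have hlam : Function.Injective lam := Subtype.val_injective.comp e.injective
  have hev : ∀ i, ∃ v : Fin n → ℂ, v ≠ 0 ∧ (M⁻¹ * N) *ᵥ v = lam i • v := fun i => by
    have h1 : (M⁻¹ * N).charpoly.IsRoot (lam i) :=
      Polynomial.isRoot_of_mem_roots (Multiset.mem_toFinset.1 (e i).2)
    rw [Polynomial.IsRoot, eval_charpoly] at h1
    obtain ⟨v, hv0, hv⟩ := exists_mulVec_eq_zero_iff.2 h1
    refine ⟨v, hv0, ?_⟩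
    rw [scalar_apply, ← smul_one_eq_diagonal, sub_mulVec, smul_mulVec, one_mulVec] at hv
    exact (sub_eq_zero.1 hv).symm
  choose v hv0 hv using hev
  have hNv : ∀ i, N *ᵥ v i = lam i • M *ᵥ v i := fun i => by
    rw [← mulVec_smul, ← hv i, mulVec_mulVec,
      mul_nonsing_inv_cancel_left _ _ (isUnit_iff_ne_zero.2 hM)]
  have hli : LinearIndependent ℂ v :=
    Module.End.eigenvectors_linearIndependent' (toLin' (M⁻¹ * N)) lam hlam v fun i =>
      ⟨Module.End.mem_eigenspace_iff.2 (by simpa using hv i), hv0 i⟩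
  have hsym : ∀ {K : Matrix (Fin n) (Fin n) ℂ}, K.IsSymm → ∀ x y, x ⬝ᵥ K *ᵥ y = y ⬝ᵥ K *ᵥ x := by
    intro K hK x y
    rw [dotProduct_mulVec, ← mulVec_transpose, hK.eq, dotProduct_comm]
  have horth : ∀ i j, i ≠ j → v i ⬝ᵥ M *ᵥ v j = 0 := fun i j hij => by
    have h1 := hsym hNs (v i) (v j)
    rw [hNv, hNv, dotProduct_smul, dotProduct_smul, hsym hMs (v j) (v i), smul_eq_mul, smul_eq_mul,
      ← sub_eq_zero, ← sub_mul] at h1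
    exact (mul_eq_zero.1 h1).resolve_left (sub_ne_zero.2 fun h2 => hij (hlam h2).symm)
  let V : Matrix (Fin n) (Fin n) ℂ := Matrix.of fun i j => v j i
  have hV : IsUnit V := by
    rw [← linearIndependent_cols_iff_isUnit]
    exact hli
  have hconj : ∀ (K : Matrix (Fin n) (Fin n) ℂ) i j, (Vᵀ * K * V) i j = v i ⬝ᵥ K *ᵥ v j := by
    intro K i j
    rw [Matrix.mul_assoc, mul_apply']
    rfl
  have hVM : Vᵀ * M * V = diagonal fun i => v i ⬝ᵥ M *ᵥ v i := by
    ext i j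
    rw [hconj]
    rcases eq_or_ne i j with rfl | hij
    · simp
    · rw [diagonal_apply_ne _ hij, horth i j hij]
  have hVN : Vᵀ * N * V = diagonal fun i => lam i * (v i ⬝ᵥ M *ᵥ v i) := by
    ext i j
    rw [hconj, hNv, dotProduct_smul, smul_eq_mul]
    rcases eq_or_ne i j with rfl | hij
    · simp
    · rw [diagonal_apply_ne _ hij, horth i j hij, mul_zero]
  have hne : ∀ i, v i ⬝ᵥ M *ᵥ v i ≠ 0 := by
    have h1 : (Vᵀ * M * V).det ≠ 0 := by
      have := ((isUnit_iff_isUnit_det V).1 hV).ne_zero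
      simp [det_mul, hM, this]
    rw [hVM, det_diagonal, Finset.prod_ne_zero_iff] at h1
    exact fun i => h1 i (Finset.mem_univ i)
  choose r hr using fun i => IsAlgClosed.exists_pow_nat_eq (v i ⬝ᵥ M *ᵥ v i) two_pos
  have hr0 : ∀ i, r i ≠ 0 := fun i h0 => hne i (by rw [← hr, h0]; simp)
  refine ⟨V * diagonal fun i => (r i)⁻¹, hV.mul ?_, lam, hlam, ?_, ?_⟩
  · rw [isUnit_iff_isUnit_det, det_diagonal, isUnit_iff_ne_zero, Finset.prod_ne_zero_iff]
    exact fun i _ => inv_ne_zero (hr0 i)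
  · rw [transpose_mul, diagonal_transpose, ← Matrix.mul_assoc, Matrix.mul_assoc _ Vᵀ,
      Matrix.mul_assoc _ (Vᵀ * M), hVM, diagonal_mul_diagonal, diagonal_mul_diagonal,
      ← diagonal_one]
    congr 1
    funext i
    rw [← hr]
    field_simp [hr0 i]
  · rw [transpose_mul, diagonal_transpose, ← Matrix.mul_assoc, Matrix.mul_assoc _ Vᵀ,
      Matrix.mul_assoc _ (Vᵀ * N), hVN, diagonal_mul_diagonal, diagonal_mul_diagonal]
    congr 1
    funext i
    rw [← hr]
    field_simp [hr0 i]

theorem eq_zero_of_linear_comb_eq_zero {a b c d : ℂ} (h : a * d - b * c ≠ 0) {x y : ℂ}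
    (h1 : a * x + b * y = 0) (h2 : c * x + d * y = 0) : x = 0 ∧ y = 0 := by
  constructor
  · refine (mul_eq_zero.1 (?_ : (a * d - b * c) * x = 0)).resolve_left h
    linear_combination d * h1 - b * h2
  · refine (mul_eq_zero.1 (?_ : (a * d - b * c) * y = 0)).resolve_left h
    linear_combination a * h2 - c * h1

/-- The linear form `p X₀ + q X₁`. -/
noncomputable def linearForm (p q : ℂ) : MvPolynomial (Fin 2) ℂ :=
  C p * X 0 + C q * X 1

theorem eval_linearForm (p q : ℂ) (x : Fin 2 → ℂ) :
    eval x (linearForm p q) = p * x 0 + q * x 1 := by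
  simp [linearForm]

theorem not_isUnit_linearForm (p q : ℂ) : ¬ IsUnit (linearForm p q) := fun h => by
  have h0 := (h.map (eval (0 : Fin 2 → ℂ))).ne_zero
  rw [eval_linearForm] at h0
  simp at h0

theorem irreducible_linearForm {p q : ℂ} (h : p ≠ 0 ∨ q ≠ 0) : Irreducible (linearForm p q) := by
  have hne : linearForm p q ≠ 0 := fun h0 => by
    have h1 := eval_linearForm p q ![1, 0]
    have h2 := eval_linearForm p q ![0, 1]
    simp [h0] at h1 h2
    simp [← h1, ← h2] at h
  have hhom : (linearForm p q).IsHomogeneous 1 :=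
    ((isHomogeneous_X ℂ 0).C_mul p).add ((isHomogeneous_X ℂ 1).C_mul q)
  refine irreducible_of_totalDegree_eq_one (hhom.totalDegree hne) fun x hx => ?_
  obtain ⟨d, hd⟩ := MvPolynomial.ne_zero_iff.1 hne
  exact isUnit_iff_ne_zero.2 fun h0 => hd (zero_dvd_iff.1 (h0 ▸ hx d))

theorem isRelPrime_linearForm {p q r s : ℂ} (h : p * s - q * r ≠ 0) :
    IsRelPrime (linearForm p q) (linearForm r s) := by
  have hpq : p ≠ 0 ∨ q ≠ 0 := by
    by_contra! h0
    simp [h0.1, h0.2] at h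
  rw [(irreducible_linearForm hpq).isRelPrime_iff_not_dvd]
  rintro ⟨g, hg⟩
  have h1 := congrArg (eval ![-q, p]) hg
  rw [map_mul, eval_linearForm, eval_linearForm] at h1
  refine h ?_
  simp only [Matrix.cons_val_zero, Matrix.cons_val_one] at h1
  linear_combination h1

/-- The matrix `X₀ A + X₁ B` in terms of another basis of the pencil. -/
theorem pencil_eq {n : Type*} (A B : Matrix n n ℂ) {a b c d : ℂ} (h : a * d - b * c ≠ 0) :
    (Matrix.of fun i j => (X 0 : MvPolynomial (Fin 2) ℂ) * C (A i j) + X 1 * C (B i j))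
      = linearForm (d / (a * d - b * c)) (-c / (a * d - b * c)) •
          (a • A + b • B).map (algebraMap ℂ (MvPolynomial (Fin 2) ℂ))
        + linearForm (-b / (a * d - b * c)) (a / (a * d - b * c)) •
          (c • A + d • B).map (algebraMap ℂ (MvPolynomial (Fin 2) ℂ)) := by
  ext1 i j
  refine MvPolynomial.funext fun x => ?_
  set D := a * d - b * c with hD
  simp [algebraMap_eq, eval_linearForm]
  field_simp
  rw [hD]
  ring

theorem linearIndependent_mulVec_of_conj_diagonal {n : Type*} [Fintype n] [DecidableEq n]
    {A B P : Matrix n n ℂ} (hP : IsUnit P) {a b c d : ℂ} (h : a * d - b * c ≠ 0)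
    {lam : n → ℂ} (hlam : Function.Injective lam) (h1 : Pᵀ * (a • A + b • B) * P = 1)
    (h2 : Pᵀ * (c • A + d • B) * P = diagonal lam) {x : n → ℂ} (hx : x ≠ 0)
    (hAx : x ⬝ᵥ A *ᵥ x = 0) (hBx : x ⬝ᵥ B *ᵥ x = 0) :
    LinearIndependent ℂ ![A *ᵥ x, B *ᵥ x] := by
  obtain ⟨y, rfl⟩ := (mulVec_surjective_iff_isUnit.2 hP) x
  have hy : y ≠ 0 := fun h0 => hx (by simp [h0])
  have hM : y ⬝ᵥ y = 0 := by
    have := dotProduct_conj_mulVec P (a • A + b • B) y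
    rwa [h1, one_mulVec, add_mulVec, smul_mulVec, smul_mulVec, dotProduct_add, dotProduct_smul,
      dotProduct_smul, hAx, hBx, smul_zero, smul_zero, add_zero] at this
  rw [LinearIndependent.pair_iff]
  intro s t hst
  set D := a * d - b * c with hD
  have hvec : ((d * s - c * t) / D) • (a • A + b • B) + ((a * t - b * s) / D) • (c • A + d • B)
      = s • A + t • B := by
    ext i j
    simp only [Matrix.add_apply, Matrix.smul_apply, smul_eq_mul]
    field_simp
    rw [hD]
    ring
  have hy0 : (((d * s - c * t) / D) • (1 : Matrix n n ℂ)
      + ((a * t - b * s) / D) • diagonal lam) *ᵥ y = 0 := by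
    have hconj : ((d * s - c * t) / D) • (1 : Matrix n n ℂ) + ((a * t - b * s) / D) • diagonal lam
        = Pᵀ * (s • A + t • B) * P := by
      rw [← h1, ← h2, ← hvec]
      simp only [Matrix.mul_add, Matrix.add_mul, Matrix.mul_smul, Matrix.smul_mul]
    rw [hconj, ← mulVec_mulVec, ← mulVec_mulVec, add_mulVec, smul_mulVec, smul_mulVec, hst,
      mulVec_zero]
  have hcoord : ∀ i, ((d * s - c * t) / D + (a * t - b * s) / D * lam i) * y i = 0 := fun i => by
    have := congrFun hy0 i
    simpa [add_mulVec, smul_mulVec, mulVec_diagonal, add_mul, mul_assoc] using this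
  have hzero : (d * s - c * t) / D = 0 ∧ (a * t - b * s) / D = 0 := by
    obtain ⟨i, hi⟩ := Function.ne_iff.1 hy
    obtain ⟨j, hji, hj⟩ : ∃ j, j ≠ i ∧ y j ≠ 0 := by
      by_contra! hall
      rw [dotProduct, Finset.sum_eq_single i (fun j _ hj => by simp [hall j hj]) (by simp)] at hM
      exact hi (mul_self_eq_zero.1 hM)
    have ei := (mul_eq_zero.1 (hcoord i)).resolve_right hi
    have ej := (mul_eq_zero.1 (hcoord j)).resolve_right hj
    have h0 : (a * t - b * s) / D = 0 := by
      have : (a * t - b * s) / D * (lam i - lam j) = 0 := by linear_combination ei - ej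
      exact (mul_eq_zero.1 this).resolve_right (sub_ne_zero.2 fun e => hji (hlam e).symm)
    exact ⟨by simpa [h0] using ei, h0⟩
  rw [div_eq_zero_iff, div_eq_zero_iff] at hzero
  have e1 := hzero.1.resolve_right h
  have e2 := hzero.2.resolve_right h
  exact eq_zero_of_linear_comb_eq_zero (a := d) (b := -c) (c := -b) (d := a)
    (by rw [hD] at h; contrapose! h; linear_combination h)
    (by linear_combination e1) (by linear_combination e2)

theorem squarefree_det_of_conj_diagonal {n : Type*} [Fintype n] [DecidableEq n]
    {A B P : Matrix n n ℂ} {a b c d : ℂ} (h : a * d - b * c ≠ 0)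
    {lam : n → ℂ} (hlam : Function.Injective lam) (h1 : Pᵀ * (a • A + b • B) * P = 1)
    (h2 : Pᵀ * (c • A + d • B) * P = diagonal lam) :
    Squarefree (Matrix.of fun i j =>
      (X 0 : MvPolynomial (Fin 2) ℂ) * C (A i j) + X 1 * C (B i j)).det := by
  set D := a * d - b * c with hD
  have key : (Matrix.of fun i j =>
      (X 0 : MvPolynomial (Fin 2) ℂ) * C (A i j) + X 1 * C (B i j)).det * C (P.det ^ 2)
      = ∏ i, linearForm ((d - b * lam i) / D) ((a * lam i - c) / D) := by
    let φ := algebraMap ℂ (MvPolynomial (Fin 2) ℂ)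
    have hd : C P.det = (P.map φ).det := RingHom.map_det φ P
    have e1 := congrArg (fun K => K.map φ) h1
    have e2 := congrArg (fun K => K.map φ) h2
    simp only [Matrix.map_mul, transpose_map] at e1 e2
    have e3 : ∀ M : Matrix n n (MvPolynomial (Fin 2) ℂ),
        M.det * C (P.det ^ 2) = ((P.map φ)ᵀ * M * P.map φ).det := fun M => by
      rw [det_mul, det_mul, det_transpose, ← hd, map_pow]
      ring
    rw [e3, pencil_eq A B h, Matrix.mul_add, Matrix.add_mul, Matrix.mul_smul, Matrix.mul_smul,
      Matrix.smul_mul, Matrix.smul_mul, ← hD, e1, e2,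
      Matrix.map_one _ (map_zero φ) (map_one φ), Matrix.diagonal_map (map_zero φ),
      smul_one_eq_diagonal, ← diagonal_smul, diagonal_add,
      det_diagonal]
    refine Finset.prod_congr rfl fun i _ => MvPolynomial.funext fun x => ?_
    simp [φ, algebraMap_eq, eval_linearForm]
    ring
  have hsq : Squarefree (∏ i, linearForm ((d - b * lam i) / D) ((a * lam i - c) / D)) := by
    refine Finset.squarefree_prod_of_pairwise_isCoprime (fun i _ j _ hij => ?_) fun i _ => ?_
    · refine isRelPrime_linearForm ?_
      have : (d - b * lam i) / D * ((a * lam j - c) / D)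
          - (a * lam i - c) / D * ((d - b * lam j) / D) = (lam j - lam i) / D := by
        field_simp
        rw [hD]
        ring
      rw [this]
      exact div_ne_zero (sub_ne_zero.2 fun e => hij (hlam e).symm) h
    · refine (irreducible_linearForm ?_).squarefree
      by_contra! h0
      obtain ⟨h3, h4⟩ := h0
      rw [div_eq_zero_iff] at h3 h4
      refine h ?_
      linear_combination a * h3.resolve_right h + b * h4.resolve_right h
  rw [← key] at hsq
  exact hsq.of_mul_left

/-- For a pencil of quadrics in `ℙ³` spanned by two linearly independent symmetric matrices
`A, B`, the following are equivalent: (a) the base locus is smooth of codimension 2;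
(b) the binary quartic `det (x·A + y·B)` is nonzero and squarefree; (c) after a linear change of
coordinates the two quadrics are `x₀²+x₁²+x₂²+x₃²` and `λ₀x₀²+λ₁x₁²+λ₂x₂²+λ₃x₃²` with pairwise
distinct `λᵢ`. -/
theorem stmt_7 (A B : Matrix (Fin 4) (Fin 4) ℂ)
    (hA : A.IsSymm) (hB : B.IsSymm)
    (hli : LinearIndependent ℂ ![A, B]) :
    ((∀ x : Fin 4 → ℂ, x ≠ 0 → x ⬝ᵥ A *ᵥ x = 0 → x ⬝ᵥ B *ᵥ x = 0 →
        LinearIndependent ℂ ![A *ᵥ x, B *ᵥ x])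
      ↔ (Matrix.det (Matrix.of fun i j : Fin 4 =>
            (X 0 : MvPolynomial (Fin 2) ℂ) * C (A i j) + X 1 * C (B i j)) ≠ 0 ∧
          Squarefree (Matrix.det (Matrix.of fun i j : Fin 4 =>
            (X 0 : MvPolynomial (Fin 2) ℂ) * C (A i j) + X 1 * C (B i j)))))
    ∧ ((Matrix.det (Matrix.of fun i j : Fin 4 =>
            (X 0 : MvPolynomial (Fin 2) ℂ) * C (A i j) + X 1 * C (B i j)) ≠ 0 ∧
          Squarefree (Matrix.det (Matrix.of fun i j : Fin 4 =>
            (X 0 : MvPolynomial (Fin 2) ℂ) * C (A i j) + X 1 * C (B i j))))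
      ↔ (∃ P : Matrix (Fin 4) (Fin 4) ℂ, IsUnit P ∧
          ∃ a b c d : ℂ, a * d - b * c ≠ 0 ∧
          ∃ lam : Fin 4 → ℂ, Function.Injective lam ∧
            Pᵀ * (a • A + b • B) * P = 1 ∧
            Pᵀ * (c • A + d • B) * P = Matrix.diagonal lam)) := by

  set F := Matrix.det (Matrix.of fun i j : Fin 4 =>
    (X 0 : MvPolynomial (Fin 2) ℂ) * C (A i j) + X 1 * C (B i j)) with hF
  have hsimple_diag : (∀ a b c d : ℂ, a * d - b * c ≠ 0 →
      ¬ Polynomial.X ^ 2 ∣ (polyPencil (a • A + b • B) (c • A + d • B)).det) →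
      ∃ P : Matrix (Fin 4) (Fin 4) ℂ, IsUnit P ∧ ∃ a b c d : ℂ, a * d - b * c ≠ 0 ∧
        ∃ lam : Fin 4 → ℂ, Function.Injective lam ∧
          Pᵀ * (a • A + b • B) * P = 1 ∧ Pᵀ * (c • A + d • B) * P = Matrix.diagonal lam := by
    intro h
    obtain ⟨t, ht⟩ : ∃ t : ℂ, (A + t • B).det ≠ 0 := by
      by_contra! h0
      refine h 1 0 0 1 (by simp) ?_
      have : (polyPencil A B).det = 0 :=
        Polynomial.funext fun t => by rw [eval_det_polyPencil, h0, Polynomial.eval_zero]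
      simp [this]
    obtain ⟨P, hP, lam, hlam, h1, h2⟩ := exists_conj_one_diagonal (hA.add (hB.smul t)) hB ht
      fun s => by
        have := h s (s * t - 1) 1 t (by ring_nf; simp)
        convert this using 4
        · rw [smul_add, smul_smul, sub_smul, one_smul, add_sub_assoc]
        · rw [one_smul]
    exact ⟨P, hP, 1, t, 0, 1, by simp, lam, hlam, by simpa using h1, by simpa using h2⟩
  have hsmooth_simple : (∀ x : Fin 4 → ℂ, x ≠ 0 → x ⬝ᵥ A *ᵥ x = 0 → x ⬝ᵥ B *ᵥ x = 0 →
        LinearIndependent ℂ ![A *ᵥ x, B *ᵥ x]) → ∀ a b c d : ℂ, a * d - b * c ≠ 0 →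
      ¬ Polynomial.X ^ 2 ∣ (polyPencil (a • A + b • B) (c • A + d • B)).det := by
    intro h a b c d hD hdvd
    obtain ⟨x, hx0, hx, hxq⟩ :=
      exists_isotropic_ker ((hA.smul a).add (hB.smul b)) (c • A + d • B) hdvd
    have hx1 := congrArg (fun w => x ⬝ᵥ w) hx
    simp only [add_mulVec, smul_mulVec, dotProduct_add, dotProduct_smul, smul_eq_mul,
      dotProduct_zero] at hx hx1 hxq
    obtain ⟨hAx, hBx⟩ := eq_zero_of_linear_comb_eq_zero hD hx1 hxq
    obtain ⟨rfl, rfl⟩ := LinearIndependent.pair_iff.1 (h x hx0 hAx hBx) a b hx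
    simp at hD
  have hsquarefree_simple : Squarefree F → ∀ a b c d : ℂ, a * d - b * c ≠ 0 →
      ¬ Polynomial.X ^ 2 ∣ (polyPencil (a • A + b • B) (c • A + d • B)).det := by
    intro h a b c d hD hdvd
    refine not_isUnit_linearForm _ _ (h (linearForm (-b / (a * d - b * c)) (a / (a * d - b * c))) ?_)
    rw [hF, pencil_eq A B hD, ← sq]
    exact sq_dvd_det_smul_add_smul hdvd _ _
  refine ⟨⟨fun h => ?_, fun h => ?_⟩, fun h => hsimple_diag (hsquarefree_simple h.2), ?_⟩
  · obtain ⟨P, hP, a, b, c, d, hD, lam, hlam, h1, h2⟩ := hsimple_diag (hsmooth_simple h)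
    have hsq := squarefree_det_of_conj_diagonal hD hlam h1 h2
    exact ⟨hsq.ne_zero, hsq⟩
  · obtain ⟨P, hP, a, b, c, d, hD, lam, hlam, h1, h2⟩ := hsimple_diag (hsquarefree_simple h.2)
    exact fun x hx hAx hBx =>
      linearIndependent_mulVec_of_conj_diagonal hP hD hlam h1 h2 hx hAx hBx
  · rintro ⟨P, -, a, b, c, d, hD, lam, hlam, h1, h2⟩
    have hsq := squarefree_det_of_conj_diagonal hD hlam h1 h2
    exact ⟨hsq.ne_zero, hsq⟩
end

section
/- Let λ₀, λ₁, λ₂, λ₃ ∈ ℂ be pairwise distinct, and let p, q ∈ ℂ satisfy p² = (λ₃ − λ₂)(λ₁ − λ₀) and q² = (λ₀ − λ₂)(λ₁ − λ₃). Set x₁ = p + q, x₂ = −p + q, x₃ = p − q, x₄ = −p − q. Then x₁, x₂, x₃, x₄ are pairwise distinct and their cross-ratio satisfies ((x₁ − x₃)(x₄ − x₂)) / ((x₁ − x₂)(x₄ − x₃)) = ((λ₁ − λ₃)(λ₂ − λ₀)) / ((λ₁ − λ₀)(λ₂ − λ₃)). -/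
/-- Key cross-ratio computation: for pairwise distinct `λ₀, λ₁, λ₂, λ₃` and square roots
`p² = (λ₃−λ₂)(λ₁−λ₀)`, `q² = (λ₀−λ₂)(λ₁−λ₃)`, the four points `±p±q` are pairwise distinct
and their cross-ratio equals `((λ₁−λ₃)(λ₂−λ₀))/((λ₁−λ₀)(λ₂−λ₃))`. -/
theorem stmt_8 (l₀ l₁ l₂ l₃ p q : ℂ)
    (h01 : l₀ ≠ l₁) (h02 : l₀ ≠ l₂) (h03 : l₀ ≠ l₃)
    (h12 : l₁ ≠ l₂) (h13 : l₁ ≠ l₃) (h23 : l₂ ≠ l₃)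
    (hp : p ^ 2 = (l₃ - l₂) * (l₁ - l₀))
    (hq : q ^ 2 = (l₀ - l₂) * (l₁ - l₃))
    (x₁ x₂ x₃ x₄ : ℂ)
    (hx₁ : x₁ = p + q) (hx₂ : x₂ = -p + q) (hx₃ : x₃ = p - q) (hx₄ : x₄ = -p - q) :
    (x₁ ≠ x₂ ∧ x₁ ≠ x₃ ∧ x₁ ≠ x₄ ∧ x₂ ≠ x₃ ∧ x₂ ≠ x₄ ∧ x₃ ≠ x₄) ∧
    ((x₁ - x₃) * (x₄ - x₂)) / ((x₁ - x₂) * (x₄ - x₃))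
      = ((l₁ - l₃) * (l₂ - l₀)) / ((l₁ - l₀) * (l₂ - l₃)) := by
  have hp0 : p ≠ 0 := by
    rintro rfl
    have h : (l₃ - l₂) * (l₁ - l₀) ≠ 0 :=
      mul_ne_zero (sub_ne_zero.2 h23.symm) (sub_ne_zero.2 h01.symm)
    exact h (by rw [← hp]; ring)
  have hq0 : q ≠ 0 := by
    rintro rfl
    have h : (l₀ - l₂) * (l₁ - l₃) ≠ 0 :=
      mul_ne_zero (sub_ne_zero.2 h02) (sub_ne_zero.2 h13)
    exact h (by rw [← hq]; ring)
  have hpq : (p + q) * (p - q) ≠ 0 := by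
    have h : (p + q) * (p - q) = (l₃ - l₀) * (l₁ - l₂) := by linear_combination hp - hq
    rw [h]
    exact mul_ne_zero (sub_ne_zero.2 h03.symm) (sub_ne_zero.2 h12)
  have hadd : p + q ≠ 0 := left_ne_zero_of_mul hpq
  have hsub : p - q ≠ 0 := right_ne_zero_of_mul hpq
  subst hx₁ hx₂ hx₃ hx₄
  refine ⟨⟨fun h => hp0 ?_, fun h => hq0 ?_, fun h => hadd ?_, fun h => hsub ?_,
    fun h => hq0 ?_, fun h => hp0 ?_⟩, ?_⟩
  · linear_combination h / 2
  · linear_combination h / 2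
  · linear_combination h / 2
  · linear_combination -h / 2
  · linear_combination h / 2
  · linear_combination h / 2
  · have hnum : (p + q - (p - q)) * (-p - q - (-p + q))
        = 4 * ((l₁ - l₃) * (l₂ - l₀)) := by linear_combination -4 * hq
    have hden : (p + q - (-p + q)) * (-p - q - (p - q))
        = 4 * ((l₁ - l₀) * (l₂ - l₃)) := by linear_combination -4 * hp
    rw [hnum, hden, mul_div_mul_left _ _ (by norm_num)]
end

section
/- Let x₁, x₂, x₃, x₄ ∈ ℂ be pairwise distinct, let e₁, e₂, e₃, e₄ be their elementary symmetric polynomials, and set h₂ = (e₂² − 3e₁e₃ + 12e₄)/3 and h₃ = (72e₂e₄ − 27e₃² − 27e₁²e₄ + 9e₁e₂e₃ − 2e₂³)/27. Let λ = ((x₁ − x₃)(x₄ − x₂)) / ((x₁ − x₂)(x₄ − x₃)) be the cross-ratio. Then λ ≠ 0, λ ≠ 1, 4h₂³ − 27h₃² ≠ 0, and 256·(1 − λ(1 − λ))³ / (λ²(1 − λ)²) = 1728·(4h₂³) / (4h₂³ − 27h₃²). In particular, the j-invariant of four distinct points on a line is a rational function of the coefficients of the monic quartic having them as roots, independent of the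 ordering of the points. -/
/-- The `j`-invariant of four distinct points on a line is the rational function
`1728·4h₂³/(4h₂³ − 27h₃²)` of the coefficients of the monic quartic having them as roots. -/
theorem stmt_9 (x₁ x₂ x₃ x₄ : ℂ)
    (h12 : x₁ ≠ x₂) (h13 : x₁ ≠ x₃) (h14 : x₁ ≠ x₄)
    (h23 : x₂ ≠ x₃) (h24 : x₂ ≠ x₄) (h34 : x₃ ≠ x₄)
    (e₁ e₂ e₃ e₄ h₂ h₃ lam : ℂ)
    (he₁ : e₁ = x₁ + x₂ + x₃ + x₄)
    (he₂ : e₂ = x₁ * x₂ + x₁ * x₃ + x₁ * x₄ + x₂ * x₃ + x₂ * x₄ + x₃ * x₄)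
    (he₃ : e₃ = x₁ * x₂ * x₃ + x₁ * x₂ * x₄ + x₁ * x₃ * x₄ + x₂ * x₃ * x₄)
    (he₄ : e₄ = x₁ * x₂ * x₃ * x₄)
    (hh₂ : h₂ = (e₂ ^ 2 - 3 * e₁ * e₃ + 12 * e₄) / 3)
    (hh₃ : h₃ = (72 * e₂ * e₄ - 27 * e₃ ^ 2 - 27 * e₁ ^ 2 * e₄ + 9 * e₁ * e₂ * e₃ - 2 * e₂ ^ 3) / 27)
    (hlam : lam = ((x₁ - x₃) * (x₄ - x₂)) / ((x₁ - x₂) * (x₄ - x₃))) :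
    lam ≠ 0 ∧ lam ≠ 1 ∧ 4 * h₂ ^ 3 - 27 * h₃ ^ 2 ≠ 0 ∧
      256 * (1 - lam * (1 - lam)) ^ 3 / (lam ^ 2 * (1 - lam) ^ 2)
        = 1728 * (4 * h₂ ^ 3) / (4 * h₂ ^ 3 - 27 * h₃ ^ 2) := by
  have hsub : (x₁ - x₂) * (x₄ - x₃) - (x₁ - x₃) * (x₄ - x₂) = (x₁ - x₄) * (x₂ - x₃) := by ring
  have hI : h₂ = (((x₁ - x₃) * (x₄ - x₂)) ^ 2
      - (x₁ - x₃) * (x₄ - x₂) * ((x₁ - x₂) * (x₄ - x₃))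
      + ((x₁ - x₂) * (x₄ - x₃)) ^ 2) / 3 := by
    rw [hh₂, he₁, he₂, he₃, he₄]; ring
  have hJ : h₃ = ((x₁ - x₃) * (x₄ - x₂) + (x₁ - x₂) * (x₄ - x₃))
      * ((x₁ - x₃) * (x₄ - x₂) - 2 * ((x₁ - x₂) * (x₄ - x₃)))
      * (2 * ((x₁ - x₃) * (x₄ - x₂)) - (x₁ - x₂) * (x₄ - x₃)) / 27 := by
    rw [hh₃, he₁, he₂, he₃, he₄]; ring
  have ha : (x₁ - x₃) * (x₄ - x₂) ≠ 0 := mul_ne_zero (sub_ne_zero.2 h13) (sub_ne_zero.2 h24.symm)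
  have hb : (x₁ - x₂) * (x₄ - x₃) ≠ 0 := mul_ne_zero (sub_ne_zero.2 h12) (sub_ne_zero.2 h34.symm)
  have hc : (x₁ - x₂) * (x₄ - x₃) - (x₁ - x₃) * (x₄ - x₂) ≠ 0 :=
    hsub ▸ mul_ne_zero (sub_ne_zero.2 h14) (sub_ne_zero.2 h23)
  clear hsub
  generalize (x₁ - x₃) * (x₄ - x₂) = a at *
  generalize (x₁ - x₂) * (x₄ - x₃) = b at *
  have hdisc : 4 * h₂ ^ 3 - 27 * h₃ ^ 2 = (a * b * (b - a)) ^ 2 := by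
    rw [hI, hJ]; ring
  have hlam' : 1 - lam = (b - a) / b := by rw [hlam]; field_simp
  refine ⟨hlam ▸ div_ne_zero ha hb, fun h => ?_, ?_, ?_⟩
  · rw [h, sub_self] at hlam'
    exact div_ne_zero hc hb hlam'.symm
  · rw [hdisc]
    exact pow_ne_zero 2 (mul_ne_zero (mul_ne_zero ha hb) hc)
  · rw [hdisc, hlam', hI, hlam]
    field_simp
    ring
end

section
/- For every homogeneous quartic form H ∈ ℂ[x,y,z], the polynomial h₂ ∈ ℂ[s,t,u] is divisible by u⁴ and the polynomial h₃ ∈ ℂ[s,t,u] is divisible by u⁶; consequently there exist unique homogeneous polynomials g₄, g₆ ∈ ℂ[s,t,u] of degrees 4 and 6 with h₂ = u⁴·g₄ and h₃ = u⁶·g₆. -/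
open MvPolynomial

/-- The coefficient of `x ^ (4 - r) * y ^ r` in
`(x * u) ^ i * (y * u) ^ j * (-(s * x + t * y)) ^ k`, where `i + j + k = 4`. -/
def lineCoeff {R : Type*} [CommRing R] (s t u : R) (i j k r : ℕ) : R :=
  if j ≤ r then (-1) ^ k * (k.choose (r - j) : R) * s ^ (k - (r - j)) * t ^ (r - j) * u ^ (i + j)
  else 0

section lineCoeff

variable {R : Type*} [CommRing R] (s t u : R) {i j k : ℕ}

lemma monomial_on_line (x y : R) (h : i + j + k = 4) :
    (x * u) ^ i * (y * u) ^ j * (-(s * x + t * y)) ^ k =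
      lineCoeff s t u i j k 0 * x ^ 4 + lineCoeff s t u i j k 1 * x ^ 3 * y
        + lineCoeff s t u i j k 2 * x ^ 2 * y ^ 2 + lineCoeff s t u i j k 3 * x * y ^ 3
        + lineCoeff s t u i j k 4 * y ^ 4 := by
  obtain rfl : k = 4 - i - j := by omega
  have hi : i ≤ 4 := by omega
  have hj : j ≤ 4 - i := by omega
  interval_cases i <;> interval_cases j <;> simp [lineCoeff, Nat.choose] <;> ring

/-- The coefficient of `X ^ (4 - r) * Y ^ r`, divided by `u ^ r`, of the form
`(x * u) ^ i * (y * u) ^ j * (-(s * x + t * y)) ^ k` after substituting `x = X - t * Y`, `y = s * Y`. -/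
def shearedCoeff (s t u : R) (i j k r : ℕ) : R :=
  if j ≤ r then
    (-1) ^ k * (i.choose (r - j) : R) * s ^ (4 - i) * (-t) ^ (r - j) * u ^ (i + j - r)
  else 0

lemma sheared_lineCoeff (h : i + j + k = 4) :
    s * lineCoeff s t u i j k 1 - 4 * t * lineCoeff s t u i j k 0
        = u * shearedCoeff s t u i j k 1 ∧
    s ^ 2 * lineCoeff s t u i j k 2 - 3 * s * t * lineCoeff s t u i j k 1
        + 6 * t ^ 2 * lineCoeff s t u i j k 0 = u ^ 2 * shearedCoeff s t u i j k 2 ∧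
    s ^ 3 * lineCoeff s t u i j k 3 - 2 * s ^ 2 * t * lineCoeff s t u i j k 2
        + 3 * s * t ^ 2 * lineCoeff s t u i j k 1 - 4 * t ^ 3 * lineCoeff s t u i j k 0
        = u ^ 3 * shearedCoeff s t u i j k 3 ∧
    s ^ 4 * lineCoeff s t u i j k 4 - s ^ 3 * t * lineCoeff s t u i j k 3
        + s ^ 2 * t ^ 2 * lineCoeff s t u i j k 2 - s * t ^ 3 * lineCoeff s t u i j k 1
        + t ^ 4 * lineCoeff s t u i j k 0 = u ^ 4 * shearedCoeff s t u i j k 4 := by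
  obtain rfl : k = 4 - i - j := by omega
  have hi : i ≤ 4 := by omega
  have hj : j ≤ 4 - i := by omega
  interval_cases i <;> interval_cases j <;> refine ⟨?_, ?_, ?_, ?_⟩ <;>
    simp [lineCoeff, shearedCoeff, Nat.choose] <;> ring

end lineCoeff

section invariants

variable {R : Type*} [CommRing R]

/-- Three times the quadratic invariant of a binary quartic. -/
def quarticI (b₀ b₁ b₂ b₃ b₄ : R) : R := -3 * b₁ * b₃ + 12 * b₀ * b₄ + b₂ ^ 2

/-- Twenty-seven times the cubic invariant of a binary quartic. -/
def quarticJ (b₀ b₁ b₂ b₃ b₄ : R) : R :=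
  72 * b₀ * b₂ * b₄ - 27 * b₀ * b₃ ^ 2 - 27 * b₁ ^ 2 * b₄ + 9 * b₁ * b₂ * b₃ - 2 * b₂ ^ 3

variable {s t u b₀ b₁ b₂ b₃ b₄ e₁ e₂ e₃ e₄ : R}

lemma pow_mul_quarticI
    (h₁ : s * b₁ - 4 * t * b₀ = u * e₁)
    (h₂ : s ^ 2 * b₂ - 3 * s * t * b₁ + 6 * t ^ 2 * b₀ = u ^ 2 * e₂)
    (h₃ : s ^ 3 * b₃ - 2 * s ^ 2 * t * b₂ + 3 * s * t ^ 2 * b₁ - 4 * t ^ 3 * b₀ = u ^ 3 * e₃)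
    (h₄ : s ^ 4 * b₄ - s ^ 3 * t * b₃ + s ^ 2 * t ^ 2 * b₂ - s * t ^ 3 * b₁ + t ^ 4 * b₀
      = u ^ 4 * e₄) :
    s ^ 4 * quarticI b₀ b₁ b₂ b₃ b₄ = u ^ 4 * quarticI b₀ e₁ e₂ e₃ e₄ := by
  trans quarticI b₀ (u * e₁) (u ^ 2 * e₂) (u ^ 3 * e₃) (u ^ 4 * e₄)
  · rw [← h₁, ← h₂, ← h₃, ← h₄]
    simp only [quarticI]
    ring
  · simp only [quarticI]
    ring

lemma pow_mul_quarticJ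
    (h₁ : s * b₁ - 4 * t * b₀ = u * e₁)
    (h₂ : s ^ 2 * b₂ - 3 * s * t * b₁ + 6 * t ^ 2 * b₀ = u ^ 2 * e₂)
    (h₃ : s ^ 3 * b₃ - 2 * s ^ 2 * t * b₂ + 3 * s * t ^ 2 * b₁ - 4 * t ^ 3 * b₀ = u ^ 3 * e₃)
    (h₄ : s ^ 4 * b₄ - s ^ 3 * t * b₃ + s ^ 2 * t ^ 2 * b₂ - s * t ^ 3 * b₁ + t ^ 4 * b₀
      = u ^ 4 * e₄) :
    s ^ 6 * quarticJ b₀ b₁ b₂ b₃ b₄ = u ^ 6 * quarticJ b₀ e₁ e₂ e₃ e₄ := by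
  trans quarticJ b₀ (u * e₁) (u ^ 2 * e₂) (u ^ 3 * e₃) (u ^ 4 * e₄)
  · rw [← h₁, ← h₂, ← h₃, ← h₄]
    simp only [quarticJ]
    ring
  · simp only [quarticJ]
    ring

end invariants

/-- A binary quartic over `ℂ` is determined by its values. -/
lemma binary_quartic_coeff_eq {a₀ a₁ a₂ a₃ a₄ b₀ b₁ b₂ b₃ b₄ : ℂ}
    (h : ∀ x y : ℂ, a₀ * x ^ 4 + a₁ * x ^ 3 * y + a₂ * x ^ 2 * y ^ 2 + a₃ * x * y ^ 3 + a₄ * y ^ 4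
      = b₀ * x ^ 4 + b₁ * x ^ 3 * y + b₂ * x ^ 2 * y ^ 2 + b₃ * x * y ^ 3 + b₄ * y ^ 4) :
    a₀ = b₀ ∧ a₁ = b₁ ∧ a₂ = b₂ ∧ a₃ = b₃ ∧ a₄ = b₄ := by
  have h10 := h 1 0
  have h01 := h 0 1
  have h11 := h 1 1
  have hn := h 1 (-1)
  have h2 := h 2 1
  refine ⟨?_, ?_, ?_, ?_, ?_⟩ <;> grind

namespace MvPolynomial

lemma IsHomogeneous.of_X_pow_mul {σ R : Type*} [CommSemiring R] {i : σ} {n m : ℕ}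
    {g : MvPolynomial σ R} (h : (X i ^ n * g).IsHomogeneous (n + m)) : g.IsHomogeneous m := by
  intro d hd
  have := @h (Finsupp.single i n + d) (by
    rwa [X_pow_eq_monomial, coeff_monomial_mul, one_mul])
  simpa [Finsupp.weight_apply, Finsupp.sum_add_index'] using this

lemma existsUnique_isHomogeneous_of_X_pow_dvd {σ R : Type*} [CommRing R] [IsDomain R] {i : σ}
    {n m : ℕ} {h : MvPolynomial σ R} (hh : h.IsHomogeneous (n + m)) (hd : X i ^ n ∣ h) :
    ∃! g : MvPolynomial σ R, g.IsHomogeneous m ∧ h = X i ^ n * g := by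
  obtain ⟨g, rfl⟩ := hd
  refine ⟨g, ⟨hh.of_X_pow_mul, rfl⟩, fun g' hg' ↦ ?_⟩
  exact (mul_left_cancel₀ (pow_ne_zero n (X_ne_zero i)) hg'.2).symm

lemma X_pow_dvd_of_dvd_X_pow_mul {σ R : Type*} [CommRing R] [IsDomain R] {i j : σ} (hij : i ≠ j)
    (n m : ℕ) {h : MvPolynomial σ R} (hd : X i ^ n ∣ X j ^ m * h) : X i ^ n ∣ h :=
  (X_prime (i := i)).pow_dvd_of_dvd_mul_left n
    (fun hdvd ↦ hij (X_dvd_X.mp ((X_prime (i := i)).dvd_of_dvd_pow hdvd))) hd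

/-- The coefficient of `x ^ (4 - r) * y ^ r` in `H(x * u, y * u, -(s * x + t * y))`, for a ternary
quartic form `H`. -/
noncomputable def quarticLineCoeff (H : MvPolynomial (Fin 3) ℂ) (r : ℕ) : MvPolynomial (Fin 3) ℂ :=
  ∑ d ∈ H.support, C (coeff d H) * lineCoeff (X 0) (X 1) (X 2) (d 0) (d 1) (d 2) r

variable {H : MvPolynomial (Fin 3) ℂ}

lemma IsHomogeneous.add_add_eq_of_mem_support {n : ℕ} (hH : H.IsHomogeneous n)
    {d : Fin 3 →₀ ℕ} (hd : d ∈ H.support) : d 0 + d 1 + d 2 = n := by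
  have := hH (mem_support_iff.mp hd)
  simpa [Finsupp.weight_apply, Finsupp.sum_fintype, Fin.sum_univ_three] using this

lemma eval_lineCoeff (s t u : ℂ) (i j k r : ℕ) :
    eval ![s, t, u] (lineCoeff (X 0) (X 1) (X 2) i j k r) = lineCoeff s t u i j k r := by
  unfold lineCoeff
  split_ifs <;> simp

lemma isHomogeneous_quarticLineCoeff (hH : H.IsHomogeneous 4) (r : ℕ) :
    (quarticLineCoeff H r).IsHomogeneous 4 := by
  refine IsHomogeneous.sum _ _ _ fun d hd ↦ IsHomogeneous.C_mul ?_ _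
  have hd4 := hH.add_add_eq_of_mem_support hd
  unfold lineCoeff
  split_ifs with hr
  · rcases lt_or_ge (d 2) (r - d 1) with hlt | hle
    · simp [Nat.choose_eq_zero_of_lt hlt, isHomogeneous_zero]
    · have hc : ((-1) ^ d 2 * ((d 2).choose (r - d 1) : MvPolynomial (Fin 3) ℂ))
          = C ((-1) ^ d 2 * ((d 2).choose (r - d 1) : ℂ)) := by simp
      rw [hc]
      have hdeg : 4 = 0 + (d 2 - (r - d 1)) + (r - d 1) + (d 0 + d 1) := by omega
      rw [hdeg]
      exact (((isHomogeneous_C _ _).mul (isHomogeneous_X_pow 0 _)).mul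
        (isHomogeneous_X_pow 1 _)).mul (isHomogeneous_X_pow 2 _)
  · exact isHomogeneous_zero _ _ _

lemma eval_on_line (hH : H.IsHomogeneous 4) (s t u x y : ℂ) :
    eval ![x * u, y * u, -(s * x + t * y)] H
      = eval ![s, t, u] (quarticLineCoeff H 0) * x ^ 4
        + eval ![s, t, u] (quarticLineCoeff H 1) * x ^ 3 * y
        + eval ![s, t, u] (quarticLineCoeff H 2) * x ^ 2 * y ^ 2
        + eval ![s, t, u] (quarticLineCoeff H 3) * x * y ^ 3
        + eval ![s, t, u] (quarticLineCoeff H 4) * y ^ 4 := by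
  simp only [quarticLineCoeff, map_sum, map_mul, eval_C, eval_lineCoeff, Finset.sum_mul,
    ← Finset.sum_add_distrib]
  rw [eval_eq']
  refine Finset.sum_congr rfl fun d hd ↦ ?_
  have := monomial_on_line s t u x y (hH.add_add_eq_of_mem_support hd)
  simp only [Fin.prod_univ_three, Matrix.cons_val]
  rw [this]
  ring

lemma sheared_quarticLineCoeff (hH : H.IsHomogeneous 4) :
    ∃ e : ℕ → MvPolynomial (Fin 3) ℂ,
      X 0 * quarticLineCoeff H 1 - 4 * X 1 * quarticLineCoeff H 0 = X 2 * e 1 ∧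
      X 0 ^ 2 * quarticLineCoeff H 2 - 3 * X 0 * X 1 * quarticLineCoeff H 1
        + 6 * X 1 ^ 2 * quarticLineCoeff H 0 = X 2 ^ 2 * e 2 ∧
      X 0 ^ 3 * quarticLineCoeff H 3 - 2 * X 0 ^ 2 * X 1 * quarticLineCoeff H 2
        + 3 * X 0 * X 1 ^ 2 * quarticLineCoeff H 1 - 4 * X 1 ^ 3 * quarticLineCoeff H 0
        = X 2 ^ 3 * e 3 ∧
      X 0 ^ 4 * quarticLineCoeff H 4 - X 0 ^ 3 * X 1 * quarticLineCoeff H 3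
        + X 0 ^ 2 * X 1 ^ 2 * quarticLineCoeff H 2 - X 0 * X 1 ^ 3 * quarticLineCoeff H 1
        + X 1 ^ 4 * quarticLineCoeff H 0 = X 2 ^ 4 * e 4 := by
  refine ⟨fun r ↦ ∑ d ∈ H.support,
    C (coeff d H) * shearedCoeff (X 0) (X 1) (X 2) (d 0) (d 1) (d 2) r, ?_⟩
  have key (d) (hd : d ∈ H.support) := sheared_lineCoeff (X 0 : MvPolynomial (Fin 3) ℂ) (X 1) (X 2)
    (hH.add_add_eq_of_mem_support hd)
  simp only [quarticLineCoeff, Finset.mul_sum, ← Finset.sum_add_distrib, ← Finset.sum_sub_distrib]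
  refine ⟨?_, ?_, ?_, ?_⟩ <;> refine Finset.sum_congr rfl fun d hd ↦ ?_ <;>
    obtain ⟨k₁, k₂, k₃, k₄⟩ := key d hd
  · linear_combination C (coeff d H) * k₁
  · linear_combination C (coeff d H) * k₂
  · linear_combination C (coeff d H) * k₃
  · linear_combination C (coeff d H) * k₄

lemma eq_quarticLineCoeff (hH : H.IsHomogeneous 4) {b₀ b₁ b₂ b₃ b₄ : MvPolynomial (Fin 3) ℂ}
    (hb : ∀ s t u x y : ℂ,
      eval ![x * u, y * u, -(s * x + t * y)] H
        = eval ![s, t, u] b₀ * x ^ 4 + eval ![s, t, u] b₁ * x ^ 3 * y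
          + eval ![s, t, u] b₂ * x ^ 2 * y ^ 2 + eval ![s, t, u] b₃ * x * y ^ 3
          + eval ![s, t, u] b₄ * y ^ 4) :
    b₀ = quarticLineCoeff H 0 ∧ b₁ = quarticLineCoeff H 1 ∧ b₂ = quarticLineCoeff H 2 ∧
      b₃ = quarticLineCoeff H 3 ∧ b₄ = quarticLineCoeff H 4 := by
  have key (v : Fin 3 → ℂ) := binary_quartic_coeff_eq fun x y ↦
    (hb (v 0) (v 1) (v 2) x y).symm.trans (eval_on_line hH (v 0) (v 1) (v 2) x y)
  have hv (v : Fin 3 → ℂ) : ![v 0, v 1, v 2] = v := by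
    ext i
    fin_cases i <;> rfl
  simp only [hv] at key
  exact ⟨funext fun v ↦ (key v).1, funext fun v ↦ (key v).2.1, funext fun v ↦ (key v).2.2.1,
    funext fun v ↦ (key v).2.2.2.1, funext fun v ↦ (key v).2.2.2.2⟩

lemma IsHomogeneous.quarticI {σ : Type*} {b₀ b₁ b₂ b₃ b₄ : MvPolynomial σ ℂ} {n : ℕ}
    (h₀ : b₀.IsHomogeneous n) (h₁ : b₁.IsHomogeneous n) (h₂ : b₂.IsHomogeneous n)
    (h₃ : b₃.IsHomogeneous n) (h₄ : b₄.IsHomogeneous n) :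
    (quarticI b₀ b₁ b₂ b₃ b₄).IsHomogeneous (n * 2) := by
  have heq : _root_.quarticI b₀ b₁ b₂ b₃ b₄
      = C (-3) * (b₁ * b₃) + C 12 * (b₀ * b₄) + b₂ * b₂ := by
    simp only [_root_.quarticI, map_neg, map_ofNat]
    ring
  rw [heq, mul_two]
  exact (((h₁.mul h₃).C_mul (-3)).add ((h₀.mul h₄).C_mul 12)).add (h₂.mul h₂)

lemma IsHomogeneous.quarticJ {σ : Type*} {b₀ b₁ b₂ b₃ b₄ : MvPolynomial σ ℂ} {n : ℕ}
    (h₀ : b₀.IsHomogeneous n) (h₁ : b₁.IsHomogeneous n) (h₂ : b₂.IsHomogeneous n)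
    (h₃ : b₃.IsHomogeneous n) (h₄ : b₄.IsHomogeneous n) :
    (quarticJ b₀ b₁ b₂ b₃ b₄).IsHomogeneous (n * 3) := by
  have heq : _root_.quarticJ b₀ b₁ b₂ b₃ b₄ = C 72 * (b₀ * b₂ * b₄) - C 27 * (b₀ * b₃ * b₃)
      - C 27 * (b₁ * b₁ * b₄) + C 9 * (b₁ * b₂ * b₃) - C 2 * (b₂ * b₂ * b₂) := by
    simp only [_root_.quarticJ, map_ofNat]
    ring
  have hn : n * 3 = n + n + n := by omega
  rw [heq, hn]
  exact ((((((h₀.mul h₂).mul h₄).C_mul 72).sub (((h₀.mul h₃).mul h₃).C_mul 27)).sub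
    (((h₁.mul h₁).mul h₄).C_mul 27)).add (((h₁.mul h₂).mul h₃).C_mul 9)).sub
    (((h₂.mul h₂).mul h₂).C_mul 2)

end MvPolynomial

/-- For any homogeneous quartic form `H ∈ ℂ[x,y,z]`, the covariant `h₂` is divisible by `u⁴`
and `h₃` is divisible by `u⁶`; consequently there are unique homogeneous polynomials
`g₄, g₆ ∈ ℂ[s,t,u]` of degrees 4 and 6 with `h₂ = u⁴·g₄` and `h₃ = u⁶·g₆`. -/
theorem stmt_11 (H : MvPolynomial (Fin 3) ℂ) (hH4 : H.IsHomogeneous 4)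
    (b₀ b₁ b₂ b₃ b₄ : MvPolynomial (Fin 3) ℂ)
    (hb : ∀ s t u x y : ℂ,
      eval ![x * u, y * u, -(s * x + t * y)] H
        = eval ![s, t, u] b₀ * x ^ 4 + eval ![s, t, u] b₁ * x ^ 3 * y
          + eval ![s, t, u] b₂ * x ^ 2 * y ^ 2 + eval ![s, t, u] b₃ * x * y ^ 3
          + eval ![s, t, u] b₄ * y ^ 4)
    (h₂ h₃ : MvPolynomial (Fin 3) ℂ)
    (hh₂ : h₂ = C (1 / 3 : ℂ) * (-3 * b₁ * b₃ + 12 * b₀ * b₄ + b₂ ^ 2))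
    (hh₃ : h₃ = C (1 / 27 : ℂ) * (72 * b₀ * b₂ * b₄ - 27 * b₀ * b₃ ^ 2 - 27 * b₁ ^ 2 * b₄
      + 9 * b₁ * b₂ * b₃ - 2 * b₂ ^ 3)) :
    (X 2 : MvPolynomial (Fin 3) ℂ) ^ 4 ∣ h₂ ∧ (X 2 : MvPolynomial (Fin 3) ℂ) ^ 6 ∣ h₃ ∧
      (∃! g₄ : MvPolynomial (Fin 3) ℂ, g₄.IsHomogeneous 4 ∧ h₂ = X 2 ^ 4 * g₄) ∧
      (∃! g₆ : MvPolynomial (Fin 3) ℂ, g₆.IsHomogeneous 6 ∧ h₃ = X 2 ^ 6 * g₆) := by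
  obtain ⟨rfl, rfl, rfl, rfl, rfl⟩ := eq_quarticLineCoeff hH4 hb
  obtain ⟨e, k₁, k₂, k₃, k₄⟩ := sheared_quarticLineCoeff hH4
  have hom := isHomogeneous_quarticLineCoeff hH4
  have dvd₂ : (X 2 : MvPolynomial (Fin 3) ℂ) ^ 4 ∣ h₂ := by
    rw [hh₂]
    exact (X_pow_dvd_of_dvd_X_pow_mul (by decide) 4 4
      ⟨_, pow_mul_quarticI k₁ k₂ k₃ k₄⟩).mul_left _
  have dvd₃ : (X 2 : MvPolynomial (Fin 3) ℂ) ^ 6 ∣ h₃ := by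
    rw [hh₃]
    exact (X_pow_dvd_of_dvd_X_pow_mul (by decide) 6 6
      ⟨_, pow_mul_quarticJ k₁ k₂ k₃ k₄⟩).mul_left _
  refine ⟨dvd₂, dvd₃, existsUnique_isHomogeneous_of_X_pow_dvd ?_ dvd₂,
    existsUnique_isHomogeneous_of_X_pow_dvd ?_ dvd₃⟩
  · rw [hh₂]
    exact ((hom 0).quarticI (hom 1) (hom 2) (hom 3) (hom 4)).C_mul _
  · rw [hh₃]
    exact ((hom 0).quarticJ (hom 1) (hom 2) (hom 3) (hom 4)).C_mul _
end
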